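/- arXiv:1701.02762 — 2 statements merged into one kernel-verified Lean document; each statement's English description precedes it below -/
import Mathlib

section
/- For every s ∈ (2/3, 1] there exists a Cantor set C ⊆ [1,2] of Hausdorff dimension s with the following property: whenever B, S ⊆ ℝ are sets such that S has positive Lebesgue (outer) measure and for every x ∈ S there exists r > 0 with x + r • C ⊆ B (i.e. {x + r·c : c ∈ C} ⊆ B), the set B also has positive Lebesgue (outer) measure. (Łaba–Pramanik theorem.) -/
open MeasureTheory
open scoped ENNReal Pointwise

namespace LP

theorem mgf_step {m : ℕ} (hm : 4 ≤ m) (y : Fin m → ℝ) (t : ℝ) (ht0 : 0 ≤ t) (ht : t ≤ m / 3)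
    (hy0 : ∀ u, 0 ≤ y u) (hy1 : ∀ u, m * y u ≤ 3 / m) (hy2 : ∑ u, y u ≤ 12 / (m : ℝ) ^ 2) :
    ∑ u, Real.exp (t * (m * y u - ∑ v, y v)) ≤ m * Real.exp (36 * t ^ 2 / (m : ℝ) ^ 3) := by
  have hm' : (4 : ℝ) ≤ m := by exact_mod_cast hm
  have hmpos : (0 : ℝ) < m := by linarith
  set s := ∑ v, y v with hs
  have hs0 : 0 ≤ s := Finset.sum_nonneg (fun u _ => hy0 u)
  have hs3 : s ≤ 3 / m := by
    refine hy2.trans ?_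
    rw [div_le_div_iff₀ (by positivity) hmpos]
    nlinarith
  have h1 : ∀ u, Real.exp (t * (m * y u - s)) ≤ 1 + t * (m * y u - s) + t ^ 2 * (m * y u - s) ^ 2 := by
    intro u
    have habs : |m * y u - s| ≤ 3 / m := by
      have : 0 ≤ m * y u := mul_nonneg hmpos.le (hy0 u)
      rw [abs_le]; constructor <;> linarith [hy1 u]
    have hz : |t * (m * y u - s)| ≤ 1 := by
      rw [abs_mul, abs_of_nonneg ht0]
      calc t * |m * y u - s| ≤ (m / 3) * (3 / m) := by gcongr
        _ = 1 := by field_simp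
    have := Real.abs_exp_sub_one_sub_id_le hz
    have h2 := (abs_le.1 this).2
    nlinarith
  have h3 : ∑ u : Fin m, (1 + t * (m * y u - s) + t ^ 2 * (m * y u - s) ^ 2)
      = m + t ^ 2 * ∑ u : Fin m, (m * y u - s) ^ 2 := by
    rw [Finset.sum_add_distrib, Finset.sum_add_distrib, ← Finset.mul_sum, ← Finset.mul_sum,
      Finset.sum_sub_distrib, ← Finset.mul_sum, ← hs]
    simp
  have h4 : ∑ u : Fin m, (m * y u - s) ^ 2 ≤ 36 / (m : ℝ) ^ 2 := by
    have e : ∀ u : Fin m, (m * y u - s) ^ 2 = (m * y u) ^ 2 - 2 * s * m * y u + s ^ 2 := by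
      intro u; ring
    simp_rw [e]
    rw [Finset.sum_add_distrib, Finset.sum_sub_distrib, ← Finset.mul_sum, ← hs]
    simp only [Finset.sum_const, Finset.card_univ, Fintype.card_fin, nsmul_eq_mul]
    have h5 : ∑ u : Fin m, (m * y u) ^ 2 ≤ ∑ u : Fin m, 3 * y u := by
      apply Finset.sum_le_sum
      intro u _
      have := hy1 u
      have h0 := hy0 u
      calc (m * y u) ^ 2 = (m * y u) * (m * y u) := by ring
        _ ≤ (3 / m) * (m * y u) := by gcongr
        _ = 3 * y u := by field_simp
    rw [← Finset.mul_sum, ← hs] at h5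
    have : 3 * s ≤ 36 / (m : ℝ) ^ 2 := by
      calc 3 * s ≤ 3 * (12 / (m : ℝ) ^ 2) := by gcongr
        _ = _ := by ring
    nlinarith [mul_nonneg hmpos.le (sq_nonneg s)]
  calc ∑ u, Real.exp (t * (m * y u - s)) ≤ _ := Finset.sum_le_sum (fun u _ => h1 u)
    _ = m + t ^ 2 * ∑ u : Fin m, (m * y u - s) ^ 2 := h3
    _ ≤ m + t ^ 2 * (36 / (m : ℝ) ^ 2) := by gcongr
    _ = m * (36 * t ^ 2 / (m : ℝ) ^ 3 + 1) := by field_simp; ring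
    _ ≤ _ := by gcongr; exact Real.add_one_le_exp _

/-- The hypotheses on the interaction weights. -/
structure Wt {ι : Type} [Fintype ι] [DecidableEq ι] (m : ℕ) (w : ι × Fin m → ι × Fin m → ℝ) : Prop where
  nn : ∀ p q, 0 ≤ w p q
  diag : ∀ l u v, w (l, u) (l, v) = 0
  row : ∀ p, ∑ q, w p q ≤ 1 / (m : ℝ) ^ 3
  col : ∀ q, ∑ p, w p q ≤ 2 / (m : ℝ) ^ 3
  nbr1 : ∀ i, ∃ s : Finset ι, s.card ≤ 4 ∧ ∀ j ∉ s, ∀ u v, w (i, u) (j, v) = 0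
  nbr2 : ∀ i, ∃ s : Finset ι, s.card ≤ 4 ∧ ∀ j ∉ s, ∀ u v, w (j, u) (i, v) = 0

/-- The quadratic form. -/
noncomputable def ZZ {ι : Type} [Fintype ι] {m : ℕ} (w : ι × Fin m → ι × Fin m → ℝ)
    (φ : ι → Fin m → ℝ) : ℝ := ∑ p, ∑ q, φ p.1 p.2 * φ q.1 q.2 * w p q

/-- The linear part at `l`. -/
noncomputable def YY {ι : Type} [Fintype ι] {m : ℕ} (w : ι × Fin m → ι × Fin m → ℝ)
    (φ : ι → Fin m → ℝ) (l : ι) (u : Fin m) : ℝ :=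
  ∑ q, φ q.1 q.2 * (w (l, u) q + w q (l, u))

section
variable {ι : Type} [Fintype ι] [DecidableEq ι] {m : ℕ} {w : ι × Fin m → ι × Fin m → ℝ}

theorem ZZ_update (hw : Wt m w) (φ : ι → Fin m → ℝ) (l : ι) (ψ : Fin m → ℝ) :
    ZZ w (Function.update φ l ψ) = ZZ w (Function.update φ l 0) + ∑ u, ψ u * YY w φ l u := by
  set χ : ι × Fin m → ℝ := fun p => if p.1 = l then ψ p.2 else 0 with hχ
  set φ0 : ι → Fin m → ℝ := Function.update φ l 0 with hφ0
  have hup : ∀ p : ι × Fin m, Function.update φ l ψ p.1 p.2 = φ0 p.1 p.2 + χ p := by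
    rintro ⟨i, u⟩
    by_cases h : i = l
    · subst h; simp [hφ0, hχ]
    · simp [hφ0, hχ, h, Function.update_of_ne]
  have hsum : ∀ f : ι × Fin m → ℝ, ∑ p, χ p * f p = ∑ u, ψ u * f (l, u) := by
    intro f
    rw [Fintype.sum_prod_type, Finset.sum_eq_single l]
    · simp [hχ]
    · intro b _ hb; simp [hχ, hb]
    · simp
  have hYY : ∀ u, YY w φ l u = ∑ q, φ0 q.1 q.2 * (w (l, u) q + w q (l, u)) := by
    intro u
    unfold YY
    apply Finset.sum_congr rfl
    rintro ⟨i, v⟩ _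
    by_cases h : i = l
    · subst h; simp [hw.diag]
    · simp [hφ0, h, Function.update_of_ne]
  have hcc : ∀ p q, χ p * χ q * w p q = 0 := by
    rintro ⟨i, u⟩ ⟨j, v⟩
    by_cases h : i = l
    · by_cases h' : j = l
      · subst h; subst h'; simp [hw.diag]
      · simp [hχ, h']
    · simp [hχ, h]
  have hexp : ∀ p q, (φ0 p.1 p.2 + χ p) * (φ0 q.1 q.2 + χ q) * w p q
      = φ0 p.1 p.2 * φ0 q.1 q.2 * w p q + (χ p * (φ0 q.1 q.2 * w p q) +
        χ q * (φ0 p.1 p.2 * w p q)) := by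
    intro p q; linear_combination hcc p q
  unfold ZZ
  simp_rw [hup, hexp, Finset.sum_add_distrib]
  congr 1
  rw [Finset.sum_comm (f := fun p q => χ q * (φ0 p.1 p.2 * w p q))]
  simp_rw [← Finset.mul_sum]
  rw [hsum (fun p => ∑ q, φ0 q.1 q.2 * w p q), hsum (fun q => ∑ p, φ0 p.1 p.2 * w p q),
    ← Finset.sum_add_distrib]
  apply Finset.sum_congr rfl
  intro u _
  rw [hYY, ← mul_add, ← Finset.sum_add_distrib]
  congr 1
  apply Finset.sum_congr rfl
  intro q _
  ring

theorem YY_nonneg (hw : Wt m w) (φ : ι → Fin m → ℝ) (h0 : ∀ i u, 0 ≤ φ i u) (l : ι) (u : Fin m) :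
    0 ≤ YY w φ l u :=
  Finset.sum_nonneg fun q _ => mul_nonneg (h0 _ _) (add_nonneg (hw.nn _ _) (hw.nn _ _))

theorem YY_le (hw : Wt m w) (φ : ι → Fin m → ℝ) (h0 : ∀ i u, 0 ≤ φ i u)
    (h1 : ∀ i u, φ i u ≤ m) (l : ι) (u : Fin m) :
    m * YY w φ l u ≤ 3 / m := by
  have hmpos : (0 : ℝ) < m := by exact_mod_cast u.pos
  have : YY w φ l u ≤ m * (3 / (m : ℝ) ^ 3) := by
    calc YY w φ l u ≤ ∑ q, (m : ℝ) * (w (l, u) q + w q (l, u)) := by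
          apply Finset.sum_le_sum
          intro q _
          exact mul_le_mul_of_nonneg_right (h1 _ _) (add_nonneg (hw.nn _ _) (hw.nn _ _))
      _ = m * (∑ q, w (l, u) q + ∑ q, w q (l, u)) := by
          rw [← Finset.mul_sum, Finset.sum_add_distrib]
      _ ≤ m * (1 / (m : ℝ) ^ 3 + 2 / (m : ℝ) ^ 3) := by
          gcongr
          · exact hw.row _
          · exact hw.col _
      _ = _ := by ring
  calc m * YY w φ l u ≤ m * (m * (3 / (m : ℝ) ^ 3)) := by gcongr
    _ = 3 / m := by field_simp

theorem YY_sum_le (hm : 0 < m) (hw : Wt m w) (φ : ι → Fin m → ℝ) (h0 : ∀ i u, 0 ≤ φ i u)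
    (h2 : ∀ i, ∑ u, φ i u = m) (l : ι) :
    ∑ u, YY w φ l u ≤ 12 / (m : ℝ) ^ 2 := by
  have hmpos : (0 : ℝ) < m := by exact_mod_cast hm
  have key : ∀ (g : ι × Fin m → ℝ) (c : ℝ), (∀ q, 0 ≤ g q) → (∀ q, g q ≤ c) → 0 ≤ c →
      (∃ s : Finset ι, s.card ≤ 4 ∧ ∀ j ∉ s, ∀ v, g (j, v) = 0) →
      ∑ q, φ q.1 q.2 * g q ≤ 4 * (m * c) := by
    rintro g c hg0 hgc hc ⟨s, hs, hz⟩
    rw [Fintype.sum_prod_type]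
    rw [← Finset.sum_subset (Finset.subset_univ s)]
    · calc ∑ i ∈ s, ∑ v, φ i v * g (i, v) ≤ ∑ i ∈ s, (m : ℝ) * c := by
            apply Finset.sum_le_sum
            intro i _
            rw [← h2 i, Finset.sum_mul]
            exact Finset.sum_le_sum fun v _ => mul_le_mul_of_nonneg_left (hgc _) (h0 _ _)
        _ = s.card * (m * c) := by simp
        _ ≤ _ := by
            gcongr
            exact_mod_cast hs
    · intro j _ hj
      simp [hz j hj]
  have e : ∑ u, YY w φ l u = ∑ q, φ q.1 q.2 * (∑ u, w (l, u) q) +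
      ∑ q, φ q.1 q.2 * (∑ u, w q (l, u)) := by
    unfold YY
    rw [Finset.sum_comm, ← Finset.sum_add_distrib]
    apply Finset.sum_congr rfl
    intro q _
    rw [← Finset.mul_sum, Finset.sum_add_distrib, mul_add]
  rw [e]
  have hA := key (fun q => ∑ u, w (l, u) q) (2 / (m : ℝ) ^ 3)
    (fun q => Finset.sum_nonneg fun u _ => hw.nn _ _)
    (fun q => by
      refine le_trans ?_ (hw.col q)
      rw [Fintype.sum_prod_type]
      exact Finset.single_le_sum (f := fun i => ∑ u, w (i, u) q)
        (fun i _ => Finset.sum_nonneg fun u _ => hw.nn _ _) (Finset.mem_univ l)) (by positivity)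
    (by
      obtain ⟨s, hs, hz⟩ := hw.nbr1 l
      exact ⟨s, hs, fun j hj v => Finset.sum_eq_zero fun u _ => hz j hj u v⟩)
  have hB := key (fun q => ∑ u, w q (l, u)) (1 / (m : ℝ) ^ 3)
    (fun q => Finset.sum_nonneg fun u _ => hw.nn _ _)
    (fun q => by
      refine le_trans ?_ (hw.row q)
      rw [Fintype.sum_prod_type]
      exact Finset.single_le_sum (f := fun i => ∑ u, w q (i, u))
        (fun i _ => Finset.sum_nonneg fun u _ => hw.nn _ _) (Finset.mem_univ l)) (by positivity)
    (by
      obtain ⟨s, hs, hz⟩ := hw.nbr2 l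
      exact ⟨s, hs, fun j hj v => Finset.sum_eq_zero fun u _ => hz j hj v u⟩)
  calc _ ≤ 4 * (m * (2 / (m : ℝ) ^ 3)) + 4 * (m * (1 / (m : ℝ) ^ 3)) := add_le_add hA hB
    _ = _ := by field_simp; ring
end

/-- Partially revealed configuration. -/
noncomputable def phi {ι : Type} [DecidableEq ι] (m : ℕ) (s : Finset ι) (X : ι → Fin m)
    (i : ι) (u : Fin m) : ℝ :=
  if i ∈ s then (if X i = u then (m : ℝ) else 0) else 1

theorem derand_aux {ι : Type} [Fintype ι] [DecidableEq ι] {m : ℕ} (hm : 4 ≤ m)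
    {α : Type} (𝒜 : Finset α) (w : α → ι × Fin m → ι × Fin m → ℝ) (hw : ∀ A ∈ 𝒜, Wt m (w A))
    (t : ℝ) (ht0 : 0 ≤ t) (ht : t ≤ m / 3) (s : Finset ι) :
    ∃ X : ι → Fin m, ∑ A ∈ 𝒜, Real.exp (t * (ZZ (w A) (phi m s X) - ZZ (w A) (fun _ _ => 1)))
      ≤ 𝒜.card * Real.exp (36 * t ^ 2 / (m : ℝ) ^ 3) ^ s.card := by
  have hmpos : (0 : ℝ) < m := by exact_mod_cast (by omega : 0 < m)
  induction s using Finset.induction_on with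
  | empty =>
    refine ⟨fun _ => ⟨0, by omega⟩, ?_⟩
    have : phi m (∅ : Finset ι) (fun _ => ⟨0, by omega⟩) = fun _ _ => 1 := by
      funext i u; simp [phi]
    rw [this]; simp
  | insert l s hl ih =>
    obtain ⟨X, hX⟩ := ih
    set β := Real.exp (36 * t ^ 2 / (m : ℝ) ^ 3) with hβ
    set φ := phi m s X with hφ
    have hφ0 : ∀ i u, 0 ≤ φ i u := by
      intro i u; rw [hφ]; unfold phi; split_ifs <;> positivity
    have hφ1 : ∀ i u, φ i u ≤ m := by
      intro i u; rw [hφ]; unfold phi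
      have : (1 : ℝ) ≤ m := by exact_mod_cast (by omega : 1 ≤ m)
      split_ifs <;> linarith
    have hφ2 : ∀ i, ∑ u, φ i u = m := by
      intro i; rw [hφ]; unfold phi
      by_cases h : i ∈ s <;> simp [h]
    have hup : ∀ u, phi m (insert l s) (Function.update X l u)
        = Function.update φ l (fun v => if u = v then (m : ℝ) else 0) := by
      intro u; funext i v
      by_cases h : i = l
      · subst h; simp [phi]
      · simp [phi, hφ, h, Function.update_of_ne]
    have hself : φ = Function.update φ l (fun _ => 1) := by
      funext i v
      by_cases h : i = l
      · subst h; simp [phi, hφ, hl]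
      · simp [h, Function.update_of_ne]
    have hdiff : ∀ A ∈ 𝒜, ∀ u, ZZ (w A) (phi m (insert l s) (Function.update X l u))
        = ZZ (w A) φ + (m * YY (w A) φ l u - ∑ v, YY (w A) φ l v) := by
      intro A hA u
      have e1 := ZZ_update (hw A hA) φ l (fun _ => 1)
      rw [← hself] at e1
      rw [hup u, ZZ_update (hw A hA) φ l, e1]
      simp
    have hsum : ∑ u : Fin m, ∑ A ∈ 𝒜, Real.exp (t * (ZZ (w A) (phi m (insert l s)
        (Function.update X l u)) - ZZ (w A) (fun _ _ => 1))) ≤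
        ∑ u : Fin m, 𝒜.card * β ^ (s.card + 1) := by
      rw [Finset.sum_comm]
      calc _ ≤ ∑ A ∈ 𝒜, Real.exp (t * (ZZ (w A) φ - ZZ (w A) (fun _ _ => 1))) * (m * β) := by
            apply Finset.sum_le_sum
            intro A hA
            have : ∀ u, Real.exp (t * (ZZ (w A) (phi m (insert l s)
              (Function.update X l u)) - ZZ (w A) (fun _ _ => 1))) =
              Real.exp (t * (ZZ (w A) φ - ZZ (w A) (fun _ _ => 1))) *
              Real.exp (t * (m * YY (w A) φ l u - ∑ v, YY (w A) φ l v)) := by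
              intro u
              rw [hdiff A hA u, ← Real.exp_add]; ring_nf
            simp_rw [this]
            rw [← Finset.mul_sum]
            gcongr
            exact mgf_step hm _ t ht0 ht (fun u => YY_nonneg (hw A hA) φ hφ0 l u)
              (fun u => YY_le (hw A hA) φ hφ0 hφ1 l u) (YY_sum_le (by omega) (hw A hA) φ hφ0 hφ2 l)
        _ = (∑ A ∈ 𝒜, Real.exp (t * (ZZ (w A) φ - ZZ (w A) (fun _ _ => 1)))) * (m * β) := by
            rw [Finset.sum_mul]
        _ ≤ (𝒜.card * β ^ s.card) * (m * β) := by gcongr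
        _ = _ := by simp; ring
    haveI : Nonempty (Fin m) := ⟨⟨0, by omega⟩⟩
    obtain ⟨u, -, hu⟩ := Finset.exists_le_of_sum_le Finset.univ_nonempty hsum
    exact ⟨Function.update X l u, by rw [Finset.card_insert_of_notMem hl]; exact hu⟩

theorem derand {ι : Type} [Fintype ι] [DecidableEq ι] {m : ℕ} (hm : 4 ≤ m)
    {α : Type} (𝒜 : Finset α) (w : α → ι × Fin m → ι × Fin m → ℝ) (hw : ∀ A ∈ 𝒜, Wt m (w A))
    (hι : Fintype.card ι ≤ m ^ 2)
    (η : ℝ) (hη0 : 0 < η) (hη1 : η ≤ 1)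
    (hbig : (𝒜.card : ℝ) < Real.exp (η ^ 2 / 144 * m)) :
    ∃ X : ι → Fin m, ∀ A ∈ 𝒜, (m : ℝ) ^ 2 * ∑ i, ∑ j, w A (i, X i) (j, X j) ≤
      ∑ p, ∑ q, w A p q + η := by
  have hmpos : (0 : ℝ) < m := by exact_mod_cast (by omega : 0 < m)
  set t := η / 72 * m with ht
  have ht0 : 0 < t := by positivity
  obtain ⟨X, hX⟩ := derand_aux hm 𝒜 w hw t ht0.le (by rw [ht]; nlinarith) Finset.univ
  refine ⟨X, fun A hA => ?_⟩
  have e1 : ZZ (w A) (phi m Finset.univ X) = (m : ℝ) ^ 2 * ∑ i, ∑ j, w A (i, X i) (j, X j) := by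
    unfold ZZ
    have : ∀ f : ι × Fin m → ℝ, ∑ p, phi m Finset.univ X p.1 p.2 * f p = m * ∑ i, f (i, X i) := by
      intro f
      rw [Fintype.sum_prod_type, Finset.mul_sum]
      apply Finset.sum_congr rfl
      intro i _
      simp [phi]
    simp_rw [mul_assoc, ← Finset.mul_sum]
    rw [this (fun p => ∑ q, phi m Finset.univ X q.1 q.2 * w A p q)]
    simp_rw [this]
    rw [← Finset.mul_sum]; ring
  have e2 : ZZ (w A) (fun _ _ => 1) = ∑ p, ∑ q, w A p q := by simp [ZZ]
  by_contra hcon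
  push Not at hcon
  have h1 : Real.exp (t * η) ≤ 𝒜.card * Real.exp (36 * t ^ 2 / (m : ℝ) ^ 3) ^ (m ^ 2) := by
    calc Real.exp (t * η) ≤ Real.exp (t * (ZZ (w A) (phi m Finset.univ X) - ZZ (w A) (fun _ _ => 1))) := by
          rw [e1, e2]; gcongr; linarith
      _ ≤ _ := Finset.single_le_sum (f := fun A => Real.exp (t * (ZZ (w A) (phi m Finset.univ X) - ZZ (w A) (fun _ _ => 1)))) (fun _ _ => (Real.exp_pos _).le) hA
      _ ≤ _ := hX
      _ ≤ _ := by
        gcongr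
        · exact Real.one_le_exp (by positivity)
        · simpa using hι
  rw [← Real.exp_nat_mul] at h1
  have h2 : ((m ^ 2 : ℕ) : ℝ) * (36 * t ^ 2 / (m : ℝ) ^ 3) = η ^ 2 / 144 * m := by
    rw [ht]; push_cast; field_simp; ring
  have h3 : t * η = η ^ 2 / 144 * m + η ^ 2 / 144 * m := by rw [ht]; ring
  rw [h2, h3, Real.exp_add] at h1
  have := le_of_mul_le_mul_right h1 (Real.exp_pos _)
  linarith

/-- The half-open grid interval. -/
def J (D g : ℕ) : Set ℝ := Set.Ico (1 + (g : ℝ) / D) (1 + ((g : ℝ) + 1) / D)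

/-- overlap weight of two grid intervals -/
noncomputable def wA (a b : ℝ) (D p q : ℕ) : ℝ :=
  volume.real (J D p ∩ (fun y => a * y + b) ⁻¹' J D q)

/-- union of grid intervals -/
def H (D : ℕ) (G : Finset ℕ) : Set ℝ := ⋃ g ∈ G, J D g

/-- overlap -/
noncomputable def Q (a b : ℝ) (D : ℕ) (G : Finset ℕ) : ℝ :=
  volume.real (H D G ∩ (fun y => a * y + b) ⁻¹' H D G)

theorem J_meas (D g : ℕ) : MeasurableSet (J D g) := measurableSet_Ico

theorem H_meas (D : ℕ) (G : Finset ℕ) : MeasurableSet (H D G) :=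
  Finset.measurableSet_biUnion _ fun g _ => J_meas D g

theorem aff_meas (a b : ℝ) : Measurable (fun y : ℝ => a * y + b) := by fun_prop

theorem mem_J {D : ℕ} (hD : 0 < D) (g : ℕ) (y : ℝ) :
    y ∈ J D g ↔ (g : ℝ) ≤ (y - 1) * D ∧ (y - 1) * D < g + 1 := by
  have hD' : (0 : ℝ) < D := by exact_mod_cast hD
  unfold J
  rw [Set.mem_Ico, ← le_sub_iff_add_le', div_le_iff₀ hD', ← sub_lt_iff_lt_add', lt_div_iff₀ hD']

theorem J_vol (D g : ℕ) : volume (J D g) = ENNReal.ofReal (1 / (D : ℝ)) := by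
  rw [J, Real.volume_Ico]; congr 1; ring

theorem J_real (D g : ℕ) : volume.real (J D g) = 1 / (D : ℝ) := by
  rw [measureReal_def, J_vol, ENNReal.toReal_ofReal (by positivity)]

theorem J_disj {D : ℕ} (hD : 0 < D) {g g' : ℕ} (h : g ≠ g') : Disjoint (J D g) (J D g') := by
  rw [Set.disjoint_left]
  intro y hy hy'
  rw [mem_J hD] at hy hy'
  have h1 : (g : ℝ) < g' + 1 := lt_of_le_of_lt hy.1 hy'.2
  have h2 : (g' : ℝ) < g + 1 := lt_of_le_of_lt hy'.1 hy.2
  norm_cast at h1 h2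
  omega

theorem pre_Ico {a : ℝ} (ha : 0 < a) (b l r : ℝ) :
    (fun y : ℝ => a * y + b) ⁻¹' Set.Ico l r = Set.Ico ((l - b) / a) ((r - b) / a) := by
  ext y
  simp only [Set.mem_preimage, Set.mem_Ico]
  rw [div_le_iff₀ ha, lt_div_iff₀ ha]
  constructor <;> rintro ⟨h1, h2⟩ <;> constructor <;> linarith

theorem pre_Ico_vol {a : ℝ} (ha : 0 < a) (b l r : ℝ) :
    volume ((fun y : ℝ => a * y + b) ⁻¹' Set.Ico l r) = ENNReal.ofReal ((r - l) / a) := by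
  rw [pre_Ico ha, Real.volume_Ico]; congr 1; ring

theorem sum_vol_le {κ : Type} [Fintype κ] (f : κ → Set ℝ) (T : Set ℝ)
    (hf : ∀ k, MeasurableSet (f k)) (hd : Pairwise (Function.onFun Disjoint f)) (hT : ∀ k, f k ⊆ T)
    (hfin : volume T ≠ ⊤) : ∑ k, volume.real (f k) ≤ volume.real T := by
  rw [← measureReal_biUnion_finset (fun i _ j _ hij => hd hij) (fun k _ => hf k)
    (fun k _ => ne_top_of_le_ne_top hfin (measure_mono (hT k)))]
  exact measureReal_mono (by simpa using hT) hfin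

theorem J_ne_top (D g : ℕ) : volume (J D g) ≠ ⊤ := by rw [J_vol]; exact ENNReal.ofReal_ne_top

theorem H_ne_top (D : ℕ) (G : Finset ℕ) : volume (H D G) ≠ ⊤ := by
  refine ne_top_of_le_ne_top ?_ (measure_biUnion_finset_le G (J D))
  exact ENNReal.sum_ne_top.2 fun g _ => J_ne_top D g

theorem H_real {D : ℕ} (hD : 0 < D) (G : Finset ℕ) : volume.real (H D G) = G.card / (D : ℝ) := by
  unfold H
  rw [measureReal_biUnion_finset (fun i _ j _ hij => J_disj hD hij) (fun k _ => J_meas D k)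
    (fun k _ => J_ne_top D k)]
  simp [J_real, div_eq_mul_inv]

theorem wA_nonneg (a b : ℝ) (D p q : ℕ) : 0 ≤ wA a b D p q := measureReal_nonneg

theorem wA_row {κ : Type} [Fintype κ] {D : ℕ} (hD : 0 < D) (e : κ → ℕ) (he : Function.Injective e)
    (a b : ℝ) (p : ℕ) : ∑ k, wA a b D p (e k) ≤ 1 / (D : ℝ) := by
  rw [← J_real D p]
  apply sum_vol_le _ _ (fun k => (J_meas _ _).inter (aff_meas a b (J_meas _ _)))
    _ (fun k => Set.inter_subset_left) (J_ne_top D p)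
  intro k l hkl
  exact ((J_disj hD (he.ne hkl)).preimage _).mono Set.inter_subset_right Set.inter_subset_right

theorem wA_col {κ : Type} [Fintype κ] {D : ℕ} (hD : 0 < D) (e : κ → ℕ) (he : Function.Injective e)
    (a b : ℝ) (ha : 1 / 2 ≤ a) (q : ℕ) : ∑ k, wA a b D (e k) q ≤ 2 / (D : ℝ) := by
  have hD' : (0 : ℝ) < D := by exact_mod_cast hD
  have hv : volume ((fun y : ℝ => a * y + b) ⁻¹' J D q) = ENNReal.ofReal (1 / D / a) := by
    unfold J; rw [pre_Ico_vol (by linarith)]; congr 1; ring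
  have h1 : ∑ k, wA a b D (e k) q ≤ volume.real ((fun y : ℝ => a * y + b) ⁻¹' J D q) := by
    apply sum_vol_le _ _ (fun k => (J_meas _ _).inter (aff_meas a b (J_meas _ _)))
      _ (fun k => Set.inter_subset_right) (by rw [hv]; exact ENNReal.ofReal_ne_top)
    intro k l hkl
    exact (J_disj hD (he.ne hkl)).mono Set.inter_subset_left Set.inter_subset_left
  refine h1.trans ?_
  rw [measureReal_def, hv, ENNReal.toReal_ofReal (by positivity), div_div]
  rw [div_le_div_iff₀ (by positivity) hD']
  nlinarith

theorem wA_le {D : ℕ} (a b : ℝ) (p q : ℕ) : wA a b D p q ≤ 1 / (D : ℝ) := by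
  rw [← J_real D p]
  exact measureReal_mono Set.inter_subset_left (J_ne_top D p)

theorem wA_full {κ : Type} [Fintype κ] {D : ℕ} (hD : 0 < D) (e : κ → ℕ) (he : Function.Injective e)
    (a b : ℝ) (T : Set ℝ) (hT : ∀ k, J D (e k) ⊆ T) (hfin : volume T ≠ ⊤) :
    ∑ p, ∑ q, wA a b D (e p) (e q) ≤ volume.real (T ∩ (fun y => a * y + b) ⁻¹' T) := by
  rw [← Fintype.sum_prod_type']
  apply sum_vol_le (fun k : κ × κ => J D (e k.1) ∩ (fun y => a * y + b) ⁻¹' J D (e k.2)) _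
    (fun k => (J_meas _ _).inter (aff_meas a b (J_meas _ _)))
  · rintro ⟨k, l⟩ ⟨k', l'⟩ hkl
    by_cases h : k = k'
    · have hl : l ≠ l' := by rintro rfl; exact hkl (by rw [h])
      exact ((J_disj hD (he.ne hl)).preimage _).mono Set.inter_subset_right Set.inter_subset_right
    · exact (J_disj hD (he.ne h)).mono Set.inter_subset_left Set.inter_subset_left
  · intro k
    exact Set.inter_subset_inter (hT _) (Set.preimage_mono (hT _))
  · exact ne_top_of_le_ne_top hfin (measure_mono Set.inter_subset_left)

theorem Q_le_sum (a b : ℝ) (D : ℕ) {κ : Type} [Fintype κ] (e : κ → ℕ) (G : Finset ℕ)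
    (hG : ∀ g ∈ G, ∃ k, e k = g) :
    Q a b D G ≤ ∑ p, ∑ q, wA a b D (e p) (e q) := by
  have hsub : H D G ∩ (fun y => a * y + b) ⁻¹' H D G ⊆
      ⋃ k : κ × κ, (J D (e k.1) ∩ (fun y => a * y + b) ⁻¹' J D (e k.2)) := by
    rintro y ⟨h1, h2⟩
    simp only [H, Set.mem_preimage, Set.mem_iUnion, exists_prop] at h1 h2
    obtain ⟨g, hg, h1⟩ := h1
    obtain ⟨g', hg', h2⟩ := h2
    obtain ⟨k, rfl⟩ := hG g hg
    obtain ⟨k', rfl⟩ := hG g' hg'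
    exact Set.mem_iUnion.2 ⟨(k, k'), h1, h2⟩
  rw [← Fintype.sum_prod_type']
  unfold Q wA
  refine le_trans (measureReal_mono hsub ?_) (measureReal_iUnion_fintype_le _)
  refine ne_top_of_le_ne_top ?_ (measure_iUnion_fintype_le _ _)
  exact ENNReal.sum_ne_top.2 fun k _ =>
    ne_top_of_le_ne_top (J_ne_top D (e k.1)) (measure_mono Set.inter_subset_left)

theorem J_sub {m c : ℕ} (hm : 0 < m) (hc : 0 < c) (i u : ℕ) (hu : u < m) :
    J (c * m) (i * m + u) ⊆ J c i := by
  intro y hy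
  rw [mem_J (by positivity)] at hy
  rw [mem_J hc]
  push_cast at hy
  have hm' : (0 : ℝ) < m := by exact_mod_cast hm
  have hu' : (u : ℝ) + 1 ≤ m := by exact_mod_cast hu
  have hu0 : (0 : ℝ) ≤ u := by positivity
  constructor
  · by_contra hcon
    push Not at hcon
    nlinarith
  · by_contra hcon
    push Not at hcon
    nlinarith

theorem J_sub' {D c : ℕ} (hD : 0 < D) (hc : 0 < c) (i : ℕ) : J (D * c) i ⊆ J D (i / c) := by
  have := J_sub (m := c) (c := D) hc hD (i / c) (i % c) (Nat.mod_lt _ hc)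
  rwa [Nat.div_add_mod'] at this

theorem wA_ne_zero {m c : ℕ} (hm : 0 < m) (hc : 0 < c) {a b : ℝ} {i u j v : ℕ} (hu : u < m)
    (hv : v < m) (h : wA a b (c * m) (i * m + u) (j * m + v) ≠ 0) :
    ∃ y, y ∈ J c i ∧ a * y + b ∈ J c j := by
  have : (J (c * m) (i * m + u) ∩ (fun y => a * y + b) ⁻¹' J (c * m) (j * m + v)).Nonempty := by
    by_contra hcon
    rw [Set.not_nonempty_iff_eq_empty] at hcon
    exact h (by rw [wA, hcon]; simp)
  obtain ⟨y, h1, h2⟩ := this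
  exact ⟨y, J_sub hm hc i u hu h1, J_sub hm hc j v hv h2⟩

theorem near_card (Act : Finset ℕ) (P : Act → Prop) (α : ℝ)
    (h : ∀ j, P j → α - 1 < ((j : ℕ) : ℝ) ∧ ((j : ℕ) : ℝ) < α + 2) :
    ∃ s : Finset Act, s.card ≤ 4 ∧ ∀ j ∉ s, ¬ P j := by
  classical
  refine ⟨Finset.univ.filter P, ?_, fun j hj hP => hj (by simp [hP])⟩
  have : (Finset.univ.filter P).card ≤ (Finset.Icc ⌊α⌋ (⌊α⌋ + 2)).card := by
    apply Finset.card_le_card_of_injOn (fun j : Act => ((j : ℕ) : ℤ))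
    · intro j hj
      have hj : P j := by simpa using hj
      obtain ⟨h1, h2⟩ := h j hj
      have h3 := Int.floor_le α
      have h4 := Int.lt_floor_add_one α
      simp only [Finset.coe_Icc, Set.mem_Icc]
      constructor
      · have : ((⌊α⌋ : ℤ) : ℝ) < ((j : ℕ) : ℤ) + 1 := by push_cast; linarith
        have : ⌊α⌋ < ((j : ℕ) : ℤ) + 1 := by exact_mod_cast this
        omega
      · have : (((j : ℕ) : ℤ) : ℝ) < (⌊α⌋ : ℤ) + 3 := by push_cast; linarith
        have : ((j : ℕ) : ℤ) < ⌊α⌋ + 3 := by exact_mod_cast this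
        omega
    · intro j _ j' _ hjj
      have : ((j : ℕ) : ℤ) = ((j' : ℕ) : ℤ) := hjj
      exact Subtype.ext (by exact_mod_cast this)
  refine this.trans ?_
  rw [Int.card_Icc]; omega

theorem nbr1 {c : ℕ} (hc : 0 < c) {a b : ℝ} (ha : 1 / 2 ≤ a) (ha2 : a ≤ 2) (i : ℕ) :
    ∃ α : ℝ, ∀ j : ℕ, (∃ y, y ∈ J c i ∧ a * y + b ∈ J c j) → α - 1 < (j : ℝ) ∧ (j : ℝ) < α + 2 := by
  refine ⟨a * i + (a + b - 1) * c, ?_⟩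
  rintro j ⟨y, h1, h2⟩
  rw [mem_J hc] at h1 h2
  have e : (a * y + b - 1) * c = a * ((y - 1) * c) + (a + b - 1) * c := by ring
  rw [e] at h2
  constructor <;> nlinarith

theorem nbr2 {c : ℕ} (hc : 0 < c) {a b : ℝ} (ha : 1 / 2 ≤ a) (j : ℕ) :
    ∃ α : ℝ, ∀ i : ℕ, (∃ y, y ∈ J c i ∧ a * y + b ∈ J c j) → α - 1 < (i : ℝ) ∧ (i : ℝ) < α + 2 := by
  refine ⟨(j - (a + b - 1) * c) / a, ?_⟩
  rintro i ⟨y, h1, h2⟩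
  rw [mem_J hc] at h1 h2
  have ha0 : 0 < a := by linarith
  have e : (a * y + b - 1) * c = a * ((y - 1) * c) + (a + b - 1) * c := by ring
  rw [e] at h2
  have h3 : (j - (a + b - 1) * c) / a ≤ (y - 1) * c := by
    rw [div_le_iff₀ ha0]; nlinarith
  have h4 : (y - 1) * c < (j - (a + b - 1) * c) / a + 1 / a := by
    rw [← add_div, lt_div_iff₀ ha0]; nlinarith
  have h5 : 1 / a ≤ 2 := by rw [div_le_iff₀ ha0]; linarith
  constructor <;> linarith

theorem diag_card {c : ℕ} (hc : 0 < c) {a b : ℝ} (hb : 4 / (c : ℝ) ≤ b) (hb3 : b ≤ 3)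
    (Dg : Finset ℕ) (hDg : ∀ i ∈ Dg, i < c ∧ ∃ y, y ∈ J c i ∧ a * y + b ∈ J c i) :
    (Dg.card : ℝ) ≤ 14 / b := by
  have hc' : (0 : ℝ) < c := by exact_mod_cast hc
  have hb0 : 0 < b := lt_of_lt_of_le (by positivity) hb
  rcases Dg.eq_empty_or_nonempty with rfl | hne
  · simp; positivity
  obtain ⟨h1c, y1, h1, h1'⟩ := hDg _ (Dg.min'_mem hne)
  obtain ⟨h2c, y2, h2, h2'⟩ := hDg _ (Dg.max'_mem hne)
  have hsub : Dg ⊆ Finset.Icc (Dg.min' hne) (Dg.max' hne) := fun x hx =>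
    Finset.mem_Icc.2 ⟨Dg.min'_le x hx, Dg.le_max' x hx⟩
  have hcard := Finset.card_le_card hsub
  rw [Nat.card_Icc] at hcard
  have hle := Dg.min'_le _ (Dg.max'_mem hne)
  set i := Dg.min' hne
  set k := Dg.max' hne
  have hcard' : (Dg.card : ℝ) ≤ k + 1 - i := by
    have : Dg.card + i ≤ k + 1 := by omega
    have : (Dg.card : ℝ) + i ≤ k + 1 := by exact_mod_cast this
    linarith
  rw [mem_J hc] at h1 h1' h2 h2'
  have hk : (k : ℝ) + 1 ≤ c := by exact_mod_cast h2c
  have hcb : 4 ≤ c * b := by rw [div_le_iff₀ hc'] at hb; linarith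
  -- `u1`, `u2` are the rescaled displacements
  have u1 : |((a - 1) * y1 + b) * c| < 1 := by
    rw [abs_lt]; constructor <;> nlinarith
  have u2 : |((a - 1) * y2 + b) * c| < 1 := by
    rw [abs_lt]; constructor <;> nlinarith
  have hy2 : y2 ≤ 2 := by
    by_contra hcon
    push Not at hcon
    nlinarith
  have hy2' : 1 ≤ y2 := by
    have : (0 : ℝ) ≤ k := by positivity
    by_contra hcon
    push Not at hcon
    nlinarith
  rw [abs_lt] at u1 u2
  have ha : (1 - a) * 4 ≥ b := by
    have : (1 - a) * y2 * c > b * c - 1 := by nlinarith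
    have h3 : (1 - a) * y2 * c > b * c / 2 := by nlinarith
    have h4 : (1 - a) * y2 > b / 2 := by
      by_contra hcon
      push Not at hcon
      nlinarith
    nlinarith
  have hdiff : (1 - a) * ((y2 - y1) * c) ≤ 2 := by nlinarith
  have h5 : (y2 - y1) * c * b ≤ 8 := by
    rcases le_total 0 ((y2 - y1) * c) with h | h
    · nlinarith
    · nlinarith
  have h6 : (k : ℝ) - i - 1 ≤ (y2 - y1) * c := by nlinarith
  rw [le_div_iff₀ hb0]
  nlinarith

theorem wA_lip {D p q : ℕ} (hp : p < D) {a b a' b' ε : ℝ} (ha : 1 / 2 ≤ a)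
    (haa : a ≤ a') (haa' : a' ≤ a + ε) (hbb : b ≤ b') (hbb' : b' ≤ b + ε) :
    wA a b D p q ≤ wA a' b' D p q + 6 * ε := by
  have hD : 0 < D := by omega
  have hD' : (0 : ℝ) < D := by exact_mod_cast hD
  have hε : 0 ≤ ε := by linarith
  set r : ℝ := 1 + ((q : ℝ) + 1) / D with hr
  have hsub : J D p ∩ (fun y => a * y + b) ⁻¹' J D q ⊆
      (J D p ∩ (fun y => a' * y + b') ⁻¹' J D q) ∪ (fun y => a' * y + b') ⁻¹' Set.Ico r (r + 3 * ε) := by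
    rintro y ⟨h1, h2⟩
    have h1' := h1
    rw [mem_J hD] at h1'
    have hp' : (p : ℝ) + 1 ≤ D := by exact_mod_cast hp
    have hp0 : (0 : ℝ) ≤ p := by positivity
    have hy1 : 1 ≤ y := by
      by_contra hcon
      push Not at hcon
      nlinarith
    have hy2 : y ≤ 2 := by
      by_contra hcon
      push Not at hcon
      nlinarith
    obtain ⟨h3, h4⟩ : _ ≤ a * y + b ∧ a * y + b < r := h2
    have h5 : a * y + b ≤ a' * y + b' := by nlinarith
    have h6 : a' * y + b' ≤ a * y + b + 3 * ε := by nlinarith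
    by_cases h : a' * y + b' < r
    · left; exact ⟨h1, h3.trans h5, h⟩
    · right; exact ⟨not_lt.1 h, by linarith⟩
  have hv := pre_Ico_vol (a := a') (by linarith) b' r (r + 3 * ε)
  have hfin : volume ((fun y => a' * y + b') ⁻¹' Set.Ico r (r + 3 * ε)) ≠ ⊤ := by
    rw [hv]; exact ENNReal.ofReal_ne_top
  have hfin2 : volume (J D p ∩ (fun y => a' * y + b') ⁻¹' J D q) ≠ ⊤ :=
    ne_top_of_le_ne_top (J_ne_top D p) (measure_mono Set.inter_subset_left)
  unfold wA
  refine (measureReal_mono hsub ?_).trans ((measureReal_union_le _ _).trans ?_)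
  · exact (measure_union_lt_top hfin2.lt_top hfin.lt_top).ne
  · gcongr
    rw [measureReal_def, hv, ENNReal.toReal_ofReal (div_nonneg (by linarith) (by linarith))]
    rw [div_le_iff₀ (by linarith)]
    nlinarith

/-- A good finite stage. -/
structure Stage (K : ℝ) (D : ℕ) (G : Finset ℕ) : Prop where
  Dpos : 0 < D
  ne : G.Nonempty
  sub : ∀ g ∈ G, g < D
  est : ∀ a b : ℝ, 1 / 2 ≤ a → a ≤ 2 → 0 < b → b ≤ 3 →
    ((D : ℝ) / G.card) ^ 2 * Q a b D G ≤ K * b ^ (-(3 / 4) : ℝ)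

/-- active cells -/
def Act (m c : ℕ) (G : Finset ℕ) : Finset ℕ := (Finset.range (m ^ 2)).filter (fun i => i / c ∈ G)

theorem Act_card {D c m : ℕ} {G : Finset ℕ} (hc : 0 < c) (hmc : m ^ 2 = D * c)
    (hG : ∀ g ∈ G, g < D) : (Act m c G).card = G.card * c := by
  rw [← Finset.card_range c, ← Finset.card_product, Finset.card_range]
  apply Finset.card_nbij' (fun i => (i / c, i % c)) (fun x => x.1 * c + x.2)
  · intro i hi
    simp only [Act, Finset.coe_filter, Finset.mem_range, Set.mem_ofPred_eq] at hi
    simp only [Finset.coe_product, Set.mem_prod, Finset.mem_coe, Finset.mem_range]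
    exact ⟨hi.2, Nat.mod_lt _ hc⟩
  · rintro ⟨g, r⟩ hx
    simp only [Finset.coe_product, Set.mem_prod, Finset.mem_coe, Finset.mem_range] at hx
    simp only [Act, Finset.coe_filter, Finset.mem_range, Set.mem_ofPred_eq]
    have h1 : (g * c + r) / c = g := by
      rw [Nat.mul_comm, Nat.mul_add_div hc, Nat.div_eq_of_lt hx.2, Nat.add_zero]
    refine ⟨?_, by rw [h1]; exact hx.1⟩
    have := hG g hx.1
    rw [hmc]
    calc g * c + r < g * c + c := by omega
      _ = (g + 1) * c := by ring
      _ ≤ D * c := Nat.mul_le_mul_right _ this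
  · intro i _
    exact Nat.div_add_mod' i c
  · rintro ⟨g, r⟩ hx
    simp only [Finset.coe_product, Set.mem_prod, Finset.mem_coe, Finset.mem_range] at hx
    have h1 : (g * c + r) / c = g := by
      rw [Nat.mul_comm, Nat.mul_add_div hc, Nat.div_eq_of_lt hx.2, Nat.add_zero]
    have h2 : (g * c + r) % c = r := by
      rw [Nat.mul_comm, Nat.mul_add_mod, Nat.mod_eq_of_lt hx.2]
    simp [h1, h2]

/-- index map -/
def ix (m : ℕ) {A : Finset ℕ} (p : A × Fin m) : ℕ := (p.1 : ℕ) * m + p.2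

theorem ix_inj (m : ℕ) (A : Finset ℕ) : Function.Injective (ix m (A := A)) := by
  rintro ⟨⟨i, hi⟩, u, hu⟩ ⟨⟨j, hj⟩, v, hv⟩ h
  simp only [ix] at h
  have hm : 0 < m := by omega
  have h1 : (i * m + u) / m = i := by
    rw [Nat.mul_comm, Nat.mul_add_div hm, Nat.div_eq_of_lt hu, Nat.add_zero]
  have h2 : (j * m + v) / m = j := by
    rw [Nat.mul_comm, Nat.mul_add_div hm, Nat.div_eq_of_lt hv, Nat.add_zero]
  have hij : i = j := by rw [← h1, ← h2, h]
  subst hij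
  have : u = v := by omega
  subst this; rfl

/-- off-diagonal weights -/
noncomputable def ww (a b : ℝ) (m : ℕ) (A : Finset ℕ) (p q : A × Fin m) : ℝ :=
  if p.1 = q.1 then 0 else wA a b (m ^ 2 * m) (ix m p) (ix m q)

theorem ww_le (a b : ℝ) (m : ℕ) (A : Finset ℕ) (p q : A × Fin m) :
    ww a b m A p q ≤ wA a b (m ^ 2 * m) (ix m p) (ix m q) := by
  unfold ww; split_ifs
  · exact wA_nonneg _ _ _ _ _
  · exact le_rfl

theorem ww_Wt {a b : ℝ} {m : ℕ} (hm : 0 < m) (A : Finset ℕ) (ha : 1 / 2 ≤ a) (ha2 : a ≤ 2) :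
    Wt m (ww a b m A) where
  nn p q := by
    unfold ww; split_ifs
    · exact le_rfl
    · exact wA_nonneg _ _ _ _ _
  diag l u v := by simp [ww]
  row p := by
    refine (Finset.sum_le_sum fun q _ => ww_le a b m A p q).trans ?_
    refine (wA_row (by positivity) (ix m) (ix_inj m A) a b (ix m p)).trans (le_of_eq ?_)
    push_cast; ring
  col q := by
    refine (Finset.sum_le_sum fun p _ => ww_le a b m A p q).trans ?_
    refine (wA_col (by positivity) (ix m) (ix_inj m A) a b ha (ix m q)).trans (le_of_eq ?_)
    push_cast; ring
  nbr1 i := by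
    obtain ⟨α, hα⟩ := nbr1 (c := m ^ 2) (by positivity) (b := b) ha ha2 i
    obtain ⟨s, hs, hz⟩ := near_card A
      (fun j => ∃ y, y ∈ J (m ^ 2) i ∧ a * y + b ∈ J (m ^ 2) j) α (fun j => hα j)
    refine ⟨s, hs, fun j hj u v => ?_⟩
    by_contra hcon
    refine hz j hj (wA_ne_zero hm (by positivity) u.2 v.2 (b := b) ?_)
    intro h0
    have := ww_le a b m A (i, u) (j, v)
    apply hcon
    unfold ww; split_ifs
    · rfl
    · exact h0
  nbr2 i := by
    obtain ⟨α, hα⟩ := nbr2 (c := m ^ 2) (by positivity) (b := b) ha i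
    obtain ⟨s, hs, hz⟩ := near_card A
      (fun j => ∃ y, y ∈ J (m ^ 2) j ∧ a * y + b ∈ J (m ^ 2) i) α (fun j => hα j)
    refine ⟨s, hs, fun j hj u v => ?_⟩
    by_contra hcon
    refine hz j hj (wA_ne_zero hm (by positivity) u.2 v.2 (b := b) ?_)
    intro h0
    apply hcon
    unfold ww; split_ifs
    · rfl
    · exact h0

/-- new index set -/
def newG (m : ℕ) (A : Finset ℕ) (X : A → Fin m) : Finset ℕ :=
  Finset.univ.image (fun i : A => ix m (i, X i))

theorem newG_card (m : ℕ) (A : Finset ℕ) (X : A → Fin m) : (newG m A X).card = A.card := by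
  unfold newG
  rw [Finset.card_image_of_injective]
  · simp
  · intro i j h
    have := ix_inj m A h
    exact (Prod.ext_iff.1 this).1

/-- The grid estimate coming from the random construction. -/
theorem core_grid {K : ℝ} {D m c : ℕ} {G : Finset ℕ} (hS : Stage K D G) (hm : 4 ≤ m) (hc : 0 < c)
    (hmc : m ^ 2 = D * c) (η : ℝ) (hη0 : 0 < η) (hη1 : η ≤ 1)
    (hbig : (((2 * m ^ 7 + 1) * (3 * m ^ 7 + 1) : ℕ) : ℝ) < Real.exp (η ^ 2 / 144 * m)) :
    ∃ X : Act m c G → Fin m, ∀ p q : ℕ, m ^ 7 ≤ 2 * p → p ≤ 2 * m ^ 7 → q ≤ 3 * m ^ 7 →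
      (m : ℝ) ^ 2 * ∑ i, ∑ j, ww ((p : ℝ) / (m : ℝ) ^ 7) ((q : ℝ) / (m : ℝ) ^ 7) m (Act m c G) (i, X i) (j, X j)
        ≤ Q ((p : ℝ) / (m : ℝ) ^ 7) ((q : ℝ) / (m : ℝ) ^ 7) D G + η := by
  classical
  have hmpos : (0 : ℝ) < m := by exact_mod_cast (by omega : 0 < m)
  set 𝒜 : Finset (ℕ × ℕ) := ((Finset.range (2 * m ^ 7 + 1)) ×ˢ (Finset.range (3 * m ^ 7 + 1))).filter
    (fun x => m ^ 7 ≤ 2 * x.1) with h𝒜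
  have hcard : 𝒜.card ≤ (2 * m ^ 7 + 1) * (3 * m ^ 7 + 1) := by
    refine (Finset.card_filter_le _ _).trans ?_
    simp
  have hcardA : Fintype.card (Act m c G) ≤ m ^ 2 := by
    rw [Fintype.card_coe]
    refine (Finset.card_filter_le _ _).trans ?_
    simp
  have hWt : ∀ x ∈ 𝒜, Wt m (ww ((x.1 : ℝ) / (m : ℝ) ^ 7) ((x.2 : ℝ) / (m : ℝ) ^ 7) m (Act m c G)) := by
    rintro ⟨p, q⟩ hx
    simp only [h𝒜, Finset.mem_filter, Finset.mem_product, Finset.mem_range] at hx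
    apply ww_Wt (by omega)
    · rw [le_div_iff₀ (by positivity)]
      have : (m : ℝ) ^ 7 ≤ 2 * p := by exact_mod_cast hx.2
      linarith
    · rw [div_le_iff₀ (by positivity)]
      have : p ≤ 2 * m ^ 7 := by omega
      exact_mod_cast this
  obtain ⟨X, hX⟩ := derand hm 𝒜 _ hWt hcardA η hη0 hη1
    (lt_of_le_of_lt (by exact_mod_cast hcard) hbig)
  refine ⟨X, fun p q h1 h2 h3 => ?_⟩
  have hmem : (p, q) ∈ 𝒜 := by
    simp only [h𝒜, Finset.mem_filter, Finset.mem_product, Finset.mem_range]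
    omega
  refine (hX (p, q) hmem).trans ?_
  gcongr
  refine (Finset.sum_le_sum fun p' _ => Finset.sum_le_sum fun q' _ => ww_le _ _ m _ p' q').trans ?_
  apply wA_full (by positivity) (ix m) (ix_inj m _) _ _ (H D G) _ (H_ne_top D G)
  rintro ⟨⟨i, hi⟩, u⟩
  simp only [Act, Finset.mem_filter] at hi
  refine (J_sub (by omega) (by positivity) i u u.2).trans ?_
  rw [hmc]
  refine (J_sub' hS.Dpos hc i).trans ?_
  exact Set.subset_biUnion_of_mem (u := fun g => J D g) hi.2

theorem ix_lt {m : ℕ} {A : Finset ℕ} (hA : ∀ i ∈ A, i < m ^ 2) (p : A × Fin m) :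
    ix m p < m ^ 2 * m := by
  obtain ⟨⟨i, hi⟩, u, hu⟩ := p
  simp only [ix]
  calc i * m + u < (i + 1) * m := by rw [Nat.add_mul]; omega
    _ ≤ _ := Nat.mul_le_mul_right _ (hA i hi)

theorem Act_lt {m c : ℕ} {G : Finset ℕ} : ∀ i ∈ Act m c G, i < m ^ 2 := by
  intro i hi
  simp only [Act, Finset.mem_filter, Finset.mem_range] at hi
  exact hi.1

theorem core_bound {K : ℝ} {D m : ℕ} {G A : Finset ℕ} (hS : Stage K D G) (hm : 4 ≤ m)
    (hA : ∀ i ∈ A, i < m ^ 2) (η : ℝ) (X : A → Fin m)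
    (hX : ∀ p q : ℕ, m ^ 7 ≤ 2 * p → p ≤ 2 * m ^ 7 → q ≤ 3 * m ^ 7 →
      (m : ℝ) ^ 2 * ∑ i, ∑ j, ww ((p : ℝ) / (m : ℝ) ^ 7) ((q : ℝ) / (m : ℝ) ^ 7) m A (i, X i) (j, X j)
        ≤ Q ((p : ℝ) / (m : ℝ) ^ 7) ((q : ℝ) / (m : ℝ) ^ 7) D G + η) (hK : 0 ≤ K)
    (a b : ℝ) (ha : 1 / 2 ≤ a) (ha2 : a ≤ 2) (hb : 4 / (m : ℝ) ^ 2 ≤ b) (hb3 : b ≤ 3) :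
    (m : ℝ) ^ 2 * Q a b (m ^ 2 * m) (newG m A X) ≤
      K * b ^ (-(3 / 4) : ℝ) / ((D : ℝ) / G.card) ^ 2 + η + 6 / m + 14 / (m * b) := by
  classical
  have hmpos : (0 : ℝ) < m := by exact_mod_cast (by omega : 0 < m)
  have hb0 : 0 < b := lt_of_lt_of_le (by positivity) hb
  set M : ℝ := (m : ℝ) ^ 7 with hM
  have hMpos : 0 < M := by positivity
  have hMc : M = ((m ^ 7 : ℕ) : ℝ) := by rw [hM]; push_cast; rfl
  set p := ⌈a * M⌉₊ with hp
  set q := ⌈b * M⌉₊ with hq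
  have hp1 : a * M ≤ p := Nat.le_ceil _
  have hp2 : (p : ℝ) < a * M + 1 := Nat.ceil_lt_add_one (by positivity)
  have hq1 : b * M ≤ q := Nat.le_ceil _
  have hq2 : (q : ℝ) < b * M + 1 := Nat.ceil_lt_add_one (by positivity)
  have hpa : m ^ 7 ≤ 2 * p := by
    have : ((m ^ 7 : ℕ) : ℝ) ≤ ((2 * p : ℕ) : ℝ) := by rw [← hMc]; push_cast; nlinarith
    exact_mod_cast this
  have hpb : p ≤ 2 * m ^ 7 := by
    rw [hp, Nat.ceil_le]; push_cast; rw [← hM]; gcongr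
  have hqb : q ≤ 3 * m ^ 7 := by
    rw [hq, Nat.ceil_le]; push_cast; rw [← hM]; gcongr
  set a' := (p : ℝ) / M with ha'
  set b' := (q : ℝ) / M with hb'
  have haa : a ≤ a' := by rw [ha', le_div_iff₀ hMpos]; exact hp1
  have haa' : a' ≤ a + 1 / M := by
    rw [ha', div_le_iff₀ hMpos, add_mul, one_div, inv_mul_cancel₀ hMpos.ne']; exact hp2.le
  have hbb : b ≤ b' := by rw [hb', le_div_iff₀ hMpos]; exact hq1
  have hbb' : b' ≤ b + 1 / M := by
    rw [hb', div_le_iff₀ hMpos, add_mul, one_div, inv_mul_cancel₀ hMpos.ne']; exact hq2.le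
  have ha'2 : a' ≤ 2 := by
    rw [ha', div_le_iff₀ hMpos, hMc]; exact_mod_cast hpb
  have hb'3 : b' ≤ 3 := by
    rw [hb', div_le_iff₀ hMpos, hMc]; exact_mod_cast hqb
  have hgrid := hX p q hpa hpb hqb
  have hest := hS.est a' b' (by linarith) ha'2 (by linarith) hb'3
  have hbpow : b' ^ (-(3 / 4) : ℝ) ≤ b ^ (-(3 / 4) : ℝ) :=
    Real.rpow_le_rpow_of_nonpos hb0 hbb (by norm_num)
  have hWpos : (0 : ℝ) < ((D : ℝ) / G.card) ^ 2 := by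
    have h1 : (0 : ℝ) < D := by exact_mod_cast hS.Dpos
    have h2 : (0 : ℝ) < G.card := by exact_mod_cast hS.ne.card_pos
    positivity
  have hQold : Q a' b' D G ≤ K * b ^ (-(3 / 4) : ℝ) / ((D : ℝ) / G.card) ^ 2 := by
    rw [le_div_iff₀ hWpos, mul_comm]
    exact hest.trans (by gcongr)
  -- the new overlap
  have hcardA : (A.card : ℝ) ≤ (m : ℝ) ^ 2 := by
    have : A.card ≤ m ^ 2 := by
      rw [← Finset.card_range (m ^ 2)]
      exact Finset.card_le_card fun i hi => Finset.mem_range.2 (hA i hi)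
    exact_mod_cast this
  have h1 : Q a b (m ^ 2 * m) (newG m A X) ≤
      ∑ i : A, ∑ j : A, wA a b (m ^ 2 * m) (ix m (i, X i)) (ix m (j, X j)) := by
    apply Q_le_sum a b _ (fun i : A => ix m (i, X i))
    intro g hg
    simpa [newG] using hg
  have h2 : ∑ i : A, ∑ j : A, wA a b (m ^ 2 * m) (ix m (i, X i)) (ix m (j, X j)) ≤
      ∑ i : A, ∑ j : A, (wA a' b' (m ^ 2 * m) (ix m (i, X i)) (ix m (j, X j)) + 6 * (1 / M)) :=
    Finset.sum_le_sum fun i _ => Finset.sum_le_sum fun j _ =>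
      wA_lip (ix_lt hA _) ha haa haa' hbb hbb'
  have hcc : (A.card : ℝ) * A.card * (6 * (1 / M)) ≤ (m : ℝ) ^ 2 * (m : ℝ) ^ 2 * (6 * (1 / M)) := by
    gcongr
  have h4 : ∑ i : A, ∑ j : A, (wA a' b' (m ^ 2 * m) (ix m (i, X i)) (ix m (j, X j)) + 6 * (1 / M))
      = ∑ i : A, ∑ j : A, ww a' b' m A (i, X i) (j, X j) +
        ∑ i : A, wA a' b' (m ^ 2 * m) (ix m (i, X i)) (ix m (i, X i)) +
        A.card * A.card * (6 * (1 / M)) := by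
    have h3 : ∀ i j : A, wA a' b' (m ^ 2 * m) (ix m (i, X i)) (ix m (j, X j)) + 6 * (1 / M) =
        ww a' b' m A (i, X i) (j, X j) +
          (if i = j then wA a' b' (m ^ 2 * m) (ix m (i, X i)) (ix m (i, X i)) else 0) + 6 * (1 / M) := by
      intro i j
      unfold ww
      by_cases h : i = j <;> simp [h]
    rw [Finset.sum_congr rfl fun i _ => Finset.sum_congr rfl fun j _ => h3 i j]
    clear h3
    simp only [Finset.sum_add_distrib, Finset.sum_ite_eq, Finset.mem_univ, if_true, Finset.sum_const,
      Finset.card_univ, Fintype.card_coe, nsmul_eq_mul]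
    ring
  -- diagonal
  have h5 : ∑ i : A, wA a' b' (m ^ 2 * m) (ix m (i, X i)) (ix m (i, X i)) ≤ 14 / b * (1 / (m : ℝ) ^ 3) := by
    set Dg : Finset A := Finset.univ.filter
      (fun i => wA a' b' (m ^ 2 * m) (ix m (i, X i)) (ix m (i, X i)) ≠ 0) with hDg
    rw [← Finset.sum_filter_ne_zero]
    have hcd : (Dg.card : ℝ) ≤ 14 / b' := by
      rw [← Finset.card_map (Function.Embedding.subtype _)]
      apply diag_card (c := m ^ 2) (a := a') (by positivity) _ hb'3
      · intro i hi
        simp only [Finset.mem_map, hDg, Finset.mem_filter, Finset.mem_univ, true_and] at hi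
        obtain ⟨⟨k, hk⟩, hi, rfl⟩ := hi
        refine ⟨hA k hk, ?_⟩
        exact wA_ne_zero (by omega) (by positivity) (X ⟨k, hk⟩).2 (X ⟨k, hk⟩).2 hi
      · push_cast; linarith
    calc _ ≤ ∑ i ∈ Dg, (1 / (m : ℝ) ^ 3) := by
          apply Finset.sum_le_sum
          intro i _
          refine (wA_le _ _ _ _).trans (le_of_eq ?_)
          push_cast; ring
      _ = Dg.card * (1 / (m : ℝ) ^ 3) := by simp
      _ ≤ 14 / b' * (1 / (m : ℝ) ^ 3) := by gcongr
      _ ≤ _ := by gcongr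
  calc (m : ℝ) ^ 2 * Q a b (m ^ 2 * m) (newG m A X)
      ≤ (m : ℝ) ^ 2 * (∑ i : A, ∑ j : A, ww a' b' m A (i, X i) (j, X j) +
        14 / b * (1 / (m : ℝ) ^ 3) + (m : ℝ) ^ 2 * (m : ℝ) ^ 2 * (6 * (1 / M))) := by
        apply mul_le_mul_of_nonneg_left _ (by positivity)
        refine (h1.trans (h2.trans (le_of_eq h4))).trans ?_
        linarith
    _ = (m : ℝ) ^ 2 * ∑ i : A, ∑ j : A, ww a' b' m A (i, X i) (j, X j) + 14 / (m * b) + 6 / m := by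
        rw [hM]; field_simp
    _ ≤ _ := by linarith

theorem step_core {K K' : ℝ} {D m c : ℕ} {G : Finset ℕ} (hS : Stage K D G) (hm : 4 ≤ m) (hc : 0 < c)
    (hmc : m ^ 2 = D * c) (hK : 0 ≤ K) (η : ℝ) (hη0 : 0 < η) (hη1 : η ≤ 1)
    (hbig : (((2 * m ^ 7 + 1) * (3 * m ^ 7 + 1) : ℕ) : ℝ) < Real.exp (η ^ 2 / 144 * m))
    (hN2 : ((D : ℝ) / G.card) ^ 2 * (3 * η + 18 / m + 14 / Real.sqrt m) ≤ K' - K)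
    (hN3 : 4 * ((D : ℝ) / G.card) ≤ K' * Real.sqrt m) :
    ∃ X : Act m c G → Fin m, Stage K' (m ^ 2 * m) (newG m (Act m c G) X) := by
  obtain ⟨X, hX⟩ := core_grid hS hm hc hmc η hη0 hη1 hbig
  have hmpos : (0 : ℝ) < m := by exact_mod_cast (by omega : 0 < m)
  have hDp : (0 : ℝ) < D := by exact_mod_cast hS.Dpos
  have hGp : (0 : ℝ) < G.card := by exact_mod_cast hS.ne.card_pos
  have hcp : (0 : ℝ) < c := by exact_mod_cast hc
  have hcard : (newG m (Act m c G) X).card = G.card * c := by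
    rw [newG_card, Act_card hc hmc hS.sub]
  have hmc' : (m : ℝ) ^ 2 = D * c := by exact_mod_cast hmc
  have hW : ((m ^ 2 * m : ℕ) : ℝ) / (newG m (Act m c G) X).card = m * ((D : ℝ) / G.card) := by
    rw [hcard]; push_cast; rw [hmc']; field_simp
  have hD'0 : 0 < m ^ 2 * m := by positivity
  refine ⟨X, hD'0, ?_, ?_, ?_⟩
  · rw [← Finset.card_pos, hcard]
    have := hS.ne.card_pos
    positivity
  · intro g hg
    simp only [newG, Finset.mem_image, Finset.mem_univ, true_and] at hg
    obtain ⟨i, rfl⟩ := hg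
    exact ix_lt Act_lt _
  intro a b ha ha2 hb0 hb3
  rw [hW]
  set W := (D : ℝ) / G.card with hWdef
  have hWpos : 0 < W := by positivity
  set s := Real.sqrt m with hs
  have hspos : 0 < s := Real.sqrt_pos.2 hmpos
  have hss : s ^ 2 = m := Real.sq_sqrt hmpos.le
  have hs34 : ∀ x : ℝ, 0 < x → x ≤ 4 / (m : ℝ) ^ 2 → s ^ 3 / 4 ≤ x ^ (-(3 / 4) : ℝ) := by
    intro x hx hx4
    have h1 : (4 / (m : ℝ) ^ 2) ^ (-(3 / 4) : ℝ) ≤ x ^ (-(3 / 4) : ℝ) :=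
      Real.rpow_le_rpow_of_nonpos hx hx4 (by norm_num)
    refine le_trans ?_ h1
    rw [Real.rpow_neg (by positivity), Real.div_rpow (by norm_num) (by positivity), inv_div]
    have h2 : ((m : ℝ) ^ 2) ^ (3 / 4 : ℝ) = s ^ 3 := by
      rw [← hss, ← Real.rpow_natCast, ← Real.rpow_natCast, ← Real.rpow_natCast, ← Real.rpow_mul hspos.le,
        ← Real.rpow_mul hspos.le]
      norm_num
    rw [h2]
    have h3 : (4 : ℝ) ^ (3 / 4 : ℝ) ≤ 4 := by
      conv_rhs => rw [← Real.rpow_one 4]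
      exact Real.rpow_le_rpow_of_exponent_le (by norm_num) (by norm_num)
    gcongr
  by_cases hb : 4 / (m : ℝ) ^ 2 ≤ b
  · have hcb := core_bound hS hm Act_lt η X hX hK a b ha ha2 hb hb3
    rw [← hWdef] at hcb
    set B := b ^ (-(3 / 4) : ℝ) with hB
    have hBpos : 0 < B := Real.rpow_pos_of_pos hb0 _
    have hB1 : 1 ≤ 3 * B := by
      have h1 : (3 : ℝ) ^ (-(3 / 4) : ℝ) ≤ B := Real.rpow_le_rpow_of_nonpos hb0 hb3 (by norm_num)
      have h2 : (3 : ℝ) ^ (-1 : ℝ) ≤ (3 : ℝ) ^ (-(3 / 4) : ℝ) :=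
        Real.rpow_le_rpow_of_exponent_le (by norm_num) (by norm_num)
      rw [Real.rpow_neg_one] at h2
      linarith
    have hB2 : 1 / b ≤ B * s := by
      have h1 : 1 / b = B * b ^ (-(1 / 4) : ℝ) := by
        rw [hB, ← Real.rpow_add hb0, one_div, ← Real.rpow_neg_one]; norm_num
      rw [h1]
      gcongr
      have h2 : b ^ (-(1 / 4) : ℝ) ≤ (4 / (m : ℝ) ^ 2) ^ (-(1 / 4) : ℝ) :=
        Real.rpow_le_rpow_of_nonpos (by positivity) hb (by norm_num)
      refine h2.trans ?_
      have h3 : (1 / (m : ℝ) ^ 2) ^ (-(1 / 4) : ℝ) = s := by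
        rw [← hss, one_div, ← Real.rpow_natCast, ← Real.rpow_natCast, ← Real.rpow_mul hspos.le,
          ← Real.rpow_neg hspos.le, ← Real.rpow_mul hspos.le]
        norm_num
      rw [← h3]
      apply Real.rpow_le_rpow_of_nonpos (by positivity) _ (by norm_num)
      gcongr; norm_num
    have hlast : 14 / (m * b) ≤ 14 / s * B := by
      calc 14 / (m * b) = 14 / m * (1 / b) := by field_simp
        _ ≤ 14 / m * (B * s) := by gcongr
        _ = 14 / s * B := by rw [← hss]; field_simp
    calc (m * W) ^ 2 * Q a b (m ^ 2 * m) (newG m (Act m c G) X)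
        = W ^ 2 * ((m : ℝ) ^ 2 * Q a b (m ^ 2 * m) (newG m (Act m c G) X)) := by ring
      _ ≤ W ^ 2 * (K * B / W ^ 2 + η * (3 * B) + 6 / m * (3 * B) + 14 / s * B) := by
          gcongr
          refine hcb.trans ?_
          have e1 : η ≤ η * (3 * B) := le_mul_of_one_le_right hη0.le hB1
          have e2 : (6 : ℝ) / m ≤ 6 / m * (3 * B) := le_mul_of_one_le_right (by positivity) hB1
          linarith
      _ = (K + W ^ 2 * (3 * η + 18 / m + 14 / s)) * B := by field_simp; ring
      _ ≤ (K + (K' - K)) * B := by gcongr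
      _ = K' * B := by ring
  · push Not at hb
    have hQ : Q a b (m ^ 2 * m) (newG m (Act m c G) X) ≤ 1 / (m * W) := by
      refine (measureReal_mono Set.inter_subset_left (H_ne_top _ _)).trans ?_
      rw [H_real hD'0, ← hW]
      rw [one_div_div]
    have hK' : 0 ≤ K' := by
      by_contra hcon
      push Not at hcon
      nlinarith
    calc (m * W) ^ 2 * Q a b (m ^ 2 * m) (newG m (Act m c G) X) ≤ (m * W) ^ 2 * (1 / (m * W)) := by gcongr
      _ = s ^ 2 * W := by rw [hss]; field_simp
      _ ≤ K' * (s ^ 3 / 4) := by nlinarith [sq_nonneg s]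
      _ ≤ _ := by
        gcongr
        exact hs34 b hb0 hb.le

theorem step {K K' : ℝ} {D : ℕ} {G : Finset ℕ} (hS : Stage K D G) (hK : 0 ≤ K) (hKK : K < K') :
    ∃ m c : ℕ, 4 ≤ m ∧ 3 ≤ c ∧ m ^ 2 = D * c ∧
      ∃ X : Act m c G → Fin m, Stage K' (m ^ 2 * m) (newG m (Act m c G) X) := by
  have hDp : (0 : ℝ) < D := by exact_mod_cast hS.Dpos
  have hGp : (0 : ℝ) < G.card := by exact_mod_cast hS.ne.card_pos
  set W := (D : ℝ) / G.card with hWdef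
  have hWpos : 0 < W := by positivity
  set η := min 1 ((K' - K) / (6 * W ^ 2)) with hη
  have hη0 : 0 < η := lt_min one_pos (div_pos (by linarith) (by positivity))
  have hη1 : η ≤ 1 := min_le_left _ _
  have hη2 : W ^ 2 * (3 * η) ≤ (K' - K) / 2 := by
    have : η ≤ (K' - K) / (6 * W ^ 2) := min_le_right _ _
    rw [le_div_iff₀ (by positivity)] at this
    linarith
  have hev1 : ∀ᶠ x : ℝ in Filter.atTop, (2 * x ^ 7 + 1) * (3 * x ^ 7 + 1) < Real.exp (η ^ 2 / 144 * x) := by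
    have hT : Filter.Tendsto (fun x : ℝ => Real.exp (η ^ 2 / 144 * x) / x ^ 14) Filter.atTop Filter.atTop := by
      have := tendsto_exp_mul_div_rpow_atTop 14 (η ^ 2 / 144) (by positivity)
      refine this.congr fun x => ?_
      norm_cast
    filter_upwards [hT.eventually_gt_atTop 12, Filter.eventually_ge_atTop 1] with x hx hx1
    rw [lt_div_iff₀ (by positivity)] at hx
    refine lt_of_le_of_lt ?_ hx
    have h7 : 1 ≤ x ^ 7 := one_le_pow₀ hx1
    have : x ^ 14 = x ^ 7 * x ^ 7 := by ring
    rw [this]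
    nlinarith
  have hev2 : ∀ᶠ x : ℝ in Filter.atTop, W ^ 2 * (18 / x + 14 / Real.sqrt x) < (K' - K) / 2 := by
    have h1 : Filter.Tendsto (fun x : ℝ => W ^ 2 * (18 / x + 14 / Real.sqrt x)) Filter.atTop
        (nhds (W ^ 2 * (0 + 0))) :=
      ((Filter.tendsto_id.const_div_atTop 18).add
        (Real.tendsto_sqrt_atTop.const_div_atTop 14)).const_mul _
    apply h1.eventually_lt_const
    simp; linarith
  have hev3 : ∀ᶠ x : ℝ in Filter.atTop, 4 * W / K' ≤ Real.sqrt x :=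
    Real.tendsto_sqrt_atTop.eventually_ge_atTop _
  have hT : Filter.Tendsto (fun n : ℕ => ((D * n : ℕ) : ℝ)) Filter.atTop Filter.atTop := by
    push_cast
    exact (tendsto_natCast_atTop_atTop).const_mul_atTop hDp
  obtain ⟨n, h1, h2, h3, h4⟩ := ((hT.eventually hev1).and ((hT.eventually hev2).and
    ((hT.eventually hev3).and (Filter.eventually_ge_atTop 4)))).exists
  have hD1 : 1 ≤ D := hS.Dpos
  refine ⟨D * n, D * n ^ 2, ?_, ?_, by ring, ?_⟩
  · nlinarith
  · nlinarith
  apply step_core hS (by nlinarith) (by positivity) (by ring) hK η hη0 hη1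
  · push_cast at h1 ⊢; exact h1
  · rw [← hWdef]
    calc W ^ 2 * (3 * η + 18 / ((D * n : ℕ) : ℝ) + 14 / Real.sqrt ((D * n : ℕ) : ℝ))
        = W ^ 2 * (3 * η) + W ^ 2 * (18 / ((D * n : ℕ) : ℝ) + 14 / Real.sqrt ((D * n : ℕ) : ℝ)) := by ring
      _ ≤ (K' - K) / 2 + (K' - K) / 2 := add_le_add hη2 h2.le
      _ = _ := by ring
  · rw [← hWdef]
    rw [div_le_iff₀ (by linarith)] at h3
    linarith

theorem pre_vol {a : ℝ} (ha : 0 < a) (b : ℝ) (s : Set ℝ) :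
    volume ((fun z : ℝ => a * z + b) ⁻¹' s) = ENNReal.ofReal a⁻¹ * volume s := by
  have h : (fun z : ℝ => a * z + b) ⁻¹' s = (fun z : ℝ => a * z) ⁻¹' ((fun z => z + b) ⁻¹' s) := rfl
  rw [h, Real.volume_preimage_mul_left ha.ne', measure_preimage_add_right, abs_of_pos (inv_pos.2 ha)]

theorem pre_real {a : ℝ} (ha : 0 < a) (b : ℝ) (s : Set ℝ) :
    volume.real ((fun z : ℝ => a * z + b) ⁻¹' s) = a⁻¹ * volume.real s := by
  rw [measureReal_def, pre_vol ha, ENNReal.toReal_mul, ENNReal.toReal_ofReal (by positivity)]; rfl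

/-- scaled copy -/
def V (x r : ℝ) (A : Set ℝ) : Set ℝ := (fun z : ℝ => r⁻¹ * z + -(x / r)) ⁻¹' A

theorem V_meas {x r : ℝ} {A : Set ℝ} (hA : MeasurableSet A) : MeasurableSet (V x r A) :=
  (aff_meas _ _) hA

theorem V_real {x r : ℝ} (hr : 0 < r) (A : Set ℝ) : volume.real (V x r A) = r * volume.real A := by
  rw [V, pre_real (inv_pos.2 hr), inv_inv]

theorem V_inter {x r x' r' : ℝ} (hr : 0 < r) (hr' : 0 < r') (A : Set ℝ) :
    V x r A ∩ V x' r' A = V x r (A ∩ (fun y => r / r' * y + (x - x') / r') ⁻¹' A) := by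
  ext z
  simp only [V, Set.mem_inter_iff, Set.mem_preimage]
  have : r / r' * (r⁻¹ * z + -(x / r)) + (x - x') / r' = r'⁻¹ * z + -(x' / r') := by
    field_simp; ring
  rw [this]

theorem V_sub {x r : ℝ} (hr : 0 < r) {A U : Set ℝ} (h : ∀ y ∈ A, x + r * y ∈ U) : V x r A ⊆ U := by
  intro z hz
  have := h _ hz
  convert this using 1
  field_simp; ring

theorem l2 {ι : Type} (s : Finset ι) (V : ι → Set ℝ) (hV : ∀ i ∈ s, MeasurableSet (V i)) (U : Set ℝ)
    (hU : MeasurableSet U) (hUf : volume U ≠ ⊤) (hVU : ∀ i ∈ s, V i ⊆ U) (t : ℝ) :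
    2 * t * ∑ i ∈ s, volume.real (V i) - t ^ 2 * ∑ i ∈ s, ∑ j ∈ s, volume.real (V i ∩ V j) ≤
      volume.real U := by
  have hf : ∀ A : Set ℝ, MeasurableSet A → A ⊆ U → Integrable (A.indicator (fun _ => (1 : ℝ))) :=
    fun A hA hAU => (integrable_indicator_iff hA).2
      (integrableOn_const (ne_top_of_le_ne_top hUf (measure_mono hAU)))
  have hi : ∀ A : Set ℝ, MeasurableSet A → ∫ x, A.indicator (fun _ => (1 : ℝ)) x = volume.real A := by
    intro A hA
    rw [integral_indicator hA]; simp
  have e1 : ∑ i ∈ s, volume.real (V i) = ∫ x, ∑ i ∈ s, (V i).indicator (fun _ => (1 : ℝ)) x := by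
    rw [integral_finsetSum _ (fun i h => hf _ (hV i h) (hVU i h))]
    exact Finset.sum_congr rfl fun i h => (hi _ (hV i h)).symm
  have hij : ∀ i ∈ s, ∀ j ∈ s, Integrable ((V i ∩ V j).indicator (fun _ => (1 : ℝ))) := fun i h j h' =>
    hf _ ((hV i h).inter (hV j h')) (Set.inter_subset_left.trans (hVU i h))
  have e2 : ∑ i ∈ s, ∑ j ∈ s, volume.real (V i ∩ V j) =
      ∫ x, ∑ i ∈ s, ∑ j ∈ s, (V i ∩ V j).indicator (fun _ => (1 : ℝ)) x := by
    rw [integral_finsetSum _ (fun i h => integrable_finsetSum _ (fun j h' => hij i h j h'))]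
    refine Finset.sum_congr rfl fun i h => ?_
    rw [integral_finsetSum _ (fun j h' => hij i h j h')]
    exact Finset.sum_congr rfl fun j h' => (hi _ ((hV i h).inter (hV j h'))).symm
  have I1 : Integrable (fun x => ∑ i ∈ s, (V i).indicator (fun _ => (1 : ℝ)) x) :=
    integrable_finsetSum _ (fun i h => hf _ (hV i h) (hVU i h))
  have I2 : Integrable (fun x => ∑ i ∈ s, ∑ j ∈ s, (V i ∩ V j).indicator (fun _ => (1 : ℝ)) x) :=
    integrable_finsetSum _ (fun i h => integrable_finsetSum _ (fun j h' => hij i h j h'))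
  rw [e1, e2, ← hi U hU, ← integral_const_mul, ← integral_const_mul,
    ← integral_sub (I1.const_mul _) (I2.const_mul _)]
  apply integral_mono ((I1.const_mul _).sub (I2.const_mul _)) (hf U hU subset_rfl)
  intro x
  have e3 : ∑ i ∈ s, ∑ j ∈ s, (V i ∩ V j).indicator (fun _ => (1 : ℝ)) x =
      (∑ i ∈ s, (V i).indicator (fun _ => (1 : ℝ)) x) ^ 2 := by
    rw [sq, Finset.sum_mul_sum]
    refine Finset.sum_congr rfl fun i _ => Finset.sum_congr rfl fun j _ => ?_
    by_cases h1 : x ∈ V i <;> by_cases h2 : x ∈ V j <;> simp [h1, h2]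
  change 2 * t * ∑ i ∈ s, (V i).indicator (fun _ => (1 : ℝ)) x -
    t ^ 2 * ∑ i ∈ s, ∑ j ∈ s, (V i ∩ V j).indicator (fun _ => (1 : ℝ)) x ≤ _
  rw [e3]
  by_cases hx : x ∈ U
  · rw [Set.indicator_of_mem hx]
    nlinarith [sq_nonneg (1 - t * ∑ i ∈ s, (V i).indicator (fun _ => (1 : ℝ)) x)]
  · have : ∑ i ∈ s, (V i).indicator (fun _ => (1 : ℝ)) x = 0 :=
      Finset.sum_eq_zero fun i h => Set.indicator_of_notMem (fun h' => hx (hVU i h h')) _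
    rw [this, Set.indicator_of_notMem hx]; simp

theorem quarter_sum (n : ℕ) :
    ∑ e ∈ Finset.range (n + 1), (e : ℝ) ^ (-(3 / 4) : ℝ) ≤ 4 * (n : ℝ) ^ (1 / 4 : ℝ) := by
  induction n with
  | zero =>
    simp [Real.zero_rpow]
  | succ n ih =>
    rw [Finset.sum_range_succ]
    have hn : (0 : ℝ) ≤ n := n.cast_nonneg
    set p := ((n + 1 : ℕ) : ℝ) ^ (1 / 4 : ℝ) with hp
    set q := (n : ℝ) ^ (1 / 4 : ℝ) with hq
    have hp0 : 0 < p := Real.rpow_pos_of_pos (by positivity) _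
    have hq0 : 0 ≤ q := Real.rpow_nonneg hn _
    have hp4 : p ^ 4 = n + 1 := by
      rw [hp, ← Real.rpow_natCast, ← Real.rpow_mul (by positivity)]; norm_num
    have hq4 : q ^ 4 = n := by
      rw [hq, ← Real.rpow_natCast, ← Real.rpow_mul (by positivity)]; norm_num
    have hqp : q ≤ p := Real.rpow_le_rpow hn (by push_cast; linarith) (by norm_num)
    have h3 : ((n + 1 : ℕ) : ℝ) ^ (-(3 / 4) : ℝ) = 1 / p ^ 3 := by
      rw [hp, ← Real.rpow_natCast, ← Real.rpow_mul (by positivity), Real.rpow_neg (by positivity), one_div]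
      norm_num
    have h4 : 1 / p ^ 3 ≤ 4 * (p - q) := by
      rw [div_le_iff₀ (by positivity)]
      have : (p - q) * (p ^ 3 + p ^ 2 * q + p * q ^ 2 + q ^ 3) = 1 := by
        have : (p - q) * (p ^ 3 + p ^ 2 * q + p * q ^ 2 + q ^ 3) = p ^ 4 - q ^ 4 := by ring
        rw [this, hp4, hq4]; ring
      rw [← this]
      have h5 : p ^ 3 + p ^ 2 * q + p * q ^ 2 + q ^ 3 ≤ 4 * p ^ 3 := by
        have e1 : p ^ 2 * q ≤ p ^ 2 * p := by gcongr
        have e2 : p * q ^ 2 ≤ p * p ^ 2 := by gcongr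
        have e3 : q ^ 3 ≤ p ^ 3 := by gcongr
        nlinarith
      nlinarith [mul_le_mul_of_nonneg_left h5 (sub_nonneg.2 hqp)]
    rw [h3]
    linarith

theorem dist_sum (ψ : ℕ → ℝ) (hψ : ∀ e, 0 ≤ ψ e) (L d : ℕ) (hd : d < L) :
    ∑ d' ∈ Finset.range L, ψ ((d - d') + (d' - d)) ≤ 2 * ∑ e ∈ Finset.range L, ψ e := by
  classical
  rw [← Finset.sum_filter_add_sum_filter_not _ (fun d' => d' ≤ d), two_mul]
  apply add_le_add
  · rw [← Finset.sum_image (g := fun d' => (d - d') + (d' - d))]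
    · apply Finset.sum_le_sum_of_subset_of_nonneg
      · intro e he
        simp only [Finset.mem_image, Finset.mem_filter, Finset.mem_range] at he ⊢
        omega
      · intro e _ _; exact hψ e
    · intro x hx y hy h
      simp only [Finset.coe_filter, Finset.mem_range, Set.mem_ofPred_eq] at hx hy
      simp only at h
      omega
  · rw [← Finset.sum_image (g := fun d' => (d - d') + (d' - d))]
    · apply Finset.sum_le_sum_of_subset_of_nonneg
      · intro e he
        simp only [Finset.mem_image, Finset.mem_filter, Finset.mem_range] at he ⊢
        omega
      · intro e _ _; exact hψ e
    · intro x hx y hy h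
      simp only [Finset.coe_filter, Finset.mem_range, Set.mem_ofPred_eq] at hx hy
      simp only at h
      omega

theorem overlap {K : ℝ} {D : ℕ} {G : Finset ℕ} (hS : Stage K D G) (hK : 0 ≤ K) {x r x' r' : ℝ}
    (hr1 : 1 ≤ r) (hr2 : r ≤ 2) (hr1' : 1 ≤ r') (hr2' : r' ≤ 2) (δ : ℝ) (hδ : 0 < δ)
    (hx : δ ≤ x - x') (hx1 : x - x' ≤ 1) :
    volume.real (V x r (H D G) ∩ V x' r' (H D G)) ≤
      4 * K / ((D : ℝ) / G.card) ^ 2 * δ ^ (-(3 / 4) : ℝ) := by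
  have h1 : (0 : ℝ) < D := by exact_mod_cast hS.Dpos
  have h2 : (0 : ℝ) < G.card := by exact_mod_cast hS.ne.card_pos
  have hW : (0 : ℝ) < ((D : ℝ) / G.card) ^ 2 := by positivity
  rw [V_inter (by linarith) (by linarith), V_real (by linarith)]
  change r * Q _ _ D G ≤ _
  have hr' : 0 < r' := by linarith
  have hb : δ / 2 ≤ (x - x') / r' := by
    rw [div_le_div_iff₀ (by norm_num) hr']; nlinarith
  have hb3 : (x - x') / r' ≤ 3 := by rw [div_le_iff₀ hr']; linarith
  have := hS.est (r / r') ((x - x') / r') (by rw [le_div_iff₀ hr']; linarith)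
    (by rw [div_le_iff₀ hr']; linarith) (by linarith) hb3
  have hQ : 0 ≤ Q (r / r') ((x - x') / r') D G := measureReal_nonneg
  have hp : ((x - x') / r') ^ (-(3 / 4) : ℝ) ≤ (δ / 2) ^ (-(3 / 4) : ℝ) :=
    Real.rpow_le_rpow_of_nonpos (by positivity) hb (by norm_num)
  have hp2 : (δ / 2) ^ (-(3 / 4) : ℝ) ≤ 2 * δ ^ (-(3 / 4) : ℝ) := by
    rw [Real.div_rpow hδ.le (by norm_num), Real.rpow_neg (by norm_num : (0 : ℝ) ≤ 2), div_inv_eq_mul, mul_comm]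
    gcongr
    conv_rhs => rw [← Real.rpow_one 2]
    exact Real.rpow_le_rpow_of_exponent_le (by norm_num) (by norm_num)
  have hQ2 : Q (r / r') ((x - x') / r') D G ≤ K * (2 * δ ^ (-(3 / 4) : ℝ)) / ((D : ℝ) / G.card) ^ 2 := by
    rw [le_div_iff₀ hW, mul_comm]
    exact this.trans (mul_le_mul_of_nonneg_left (hp.trans hp2) hK)
  calc r * Q (r / r') ((x - x') / r') D G ≤ 2 * Q (r / r') ((x - x') / r') D G := by gcongr
    _ ≤ 2 * (K * (2 * δ ^ (-(3 / 4) : ℝ)) / ((D : ℝ) / G.card) ^ 2) := by gcongr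
    _ = _ := by ring

theorem main_est {K : ℝ} {D : ℕ} {G : Finset ℕ} (hS : Stage K D G) (hK : 0 ≤ K) (U T : Set ℝ)
    (hU : MeasurableSet U) (hUf : volume U ≠ ⊤) (t₀ : ℝ) (hT : T ⊆ Set.Ico t₀ (t₀ + 1))
    (h : ∀ x ∈ T, ∃ r : ℝ, 1 ≤ r ∧ r ≤ 2 ∧ ∀ y ∈ H D G, x + r * y ∈ U) :
    volume.real T ^ 2 ≤ (64 * K + 8) * volume.real U := by
  classical
  have h1 : (0 : ℝ) < D := by exact_mod_cast hS.Dpos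
  have h2 : (0 : ℝ) < G.card := by exact_mod_cast hS.ne.card_pos
  set W := (D : ℝ) / G.card with hWd
  have hW : 0 < W := by positivity
  obtain ⟨L, hL⟩ := exists_nat_ge W
  have hL0 : (0 : ℝ) < L := hW.trans_le hL
  have hLn : 0 < L := by exact_mod_cast hL0
  set I : ℕ → Set ℝ := fun d => Set.Icc (t₀ + d / L) (t₀ + (d + 1) / L) with hI
  set S := (Finset.range L).filter (fun d => (T ∩ I d).Nonempty) with hSd
  have hch : ∀ d : ℕ, ∃ x r : ℝ, d ∈ S → x ∈ T ∧ x ∈ I d ∧ 1 ≤ r ∧ r ≤ 2 ∧ ∀ y ∈ H D G, x + r * y ∈ U := by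
    intro d
    by_cases hd : d ∈ S
    · have := (Finset.mem_filter.1 hd).2
      obtain ⟨x, hx, hxI⟩ := this
      obtain ⟨r, hr⟩ := h x hx
      exact ⟨x, r, fun _ => ⟨hx, hxI, hr⟩⟩
    · exact ⟨0, 0, fun hd' => absurd hd' hd⟩
  choose x r hxr using hch
  -- covering
  have hcov : volume.real T ≤ S.card / L := by
    have hsub : T ⊆ ⋃ d ∈ S, I d := by
      intro z hz
      have hz' := hT hz
      have hz0 : 0 ≤ (z - t₀) * L := mul_nonneg (by linarith [hz'.1]) hL0.le
      have f1 : ((⌊(z - t₀) * L⌋₊ : ℕ) : ℝ) ≤ (z - t₀) * L := Nat.floor_le hz0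
      have f2 : (z - t₀) * L < (⌊(z - t₀) * L⌋₊ : ℕ) + 1 := Nat.lt_floor_add_one _
      have hzI : z ∈ I ⌊(z - t₀) * L⌋₊ := by
        constructor
        · rw [← le_sub_iff_add_le', div_le_iff₀ hL0]; exact f1
        · rw [← sub_le_iff_le_add', le_div_iff₀ hL0]; exact f2.le
      refine Set.mem_biUnion (x := ⌊(z - t₀) * L⌋₊) ?_ hzI
      simp only [hSd, Finset.coe_filter, Finset.mem_range, Set.mem_ofPred_eq]
      refine ⟨?_, z, hz, hzI⟩
      have : ((⌊(z - t₀) * L⌋₊ : ℕ) : ℝ) < L := by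
        have : (z - t₀) * L < 1 * L := mul_lt_mul_of_pos_right (by linarith [hz'.2]) hL0
        linarith
      exact_mod_cast this
    have hv : ∀ d, volume.real (I d) = 1 / L := by
      intro d
      rw [hI, measureReal_def, Real.volume_Icc, ENNReal.toReal_ofReal]
      · ring
      · have : (0 : ℝ) ≤ 1 / L := by positivity
        have e : t₀ + ((d : ℝ) + 1) / L - (t₀ + d / L) = 1 / L := by ring
        rw [e]; exact this
    have hfin : volume (⋃ d ∈ S, I d) ≠ ⊤ := by
      refine ((measure_biUnion_finset_le S I).trans_lt ?_).ne
      exact ENNReal.sum_lt_top.2 fun d _ => by rw [hI, Real.volume_Icc]; exact ENNReal.ofReal_lt_top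
    refine (measureReal_mono hsub hfin).trans ((measureReal_biUnion_finset_le S I).trans (le_of_eq ?_))
    simp [hv]; ring
  set Vd : ℕ → Set ℝ := fun d => V (x d) (r d) (H D G) with hVd
  have hHr : volume.real (H D G) = 1 / W := by rw [H_real hS.Dpos, hWd, one_div_div]
  have hVr : ∀ d ∈ S, volume.real (Vd d) = r d * (1 / W) := by
    intro d hd
    rw [hVd, V_real (by linarith [(hxr d hd).2.2.1]), hHr]
  have hVU : ∀ d ∈ S, Vd d ⊆ U := fun d hd =>
    V_sub (by linarith [(hxr d hd).2.2.1]) (hxr d hd).2.2.2.2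
  have hVm : ∀ d ∈ S, MeasurableSet (Vd d) := fun d _ => V_meas (H_meas D G)
  set ψ : ℕ → ℝ := fun e => (if e ≤ 1 then 2 / W else 0) +
    8 * K / W ^ 2 * (L : ℝ) ^ (3 / 4 : ℝ) * (e : ℝ) ^ (-(3 / 4) : ℝ) with hψ
  have hψ0 : ∀ e, 0 ≤ ψ e := by
    intro e
    have : 0 ≤ 8 * K / W ^ 2 * (L : ℝ) ^ (3 / 4 : ℝ) * (e : ℝ) ^ (-(3 / 4) : ℝ) := by positivity
    simp only [hψ]
    split_ifs
    · positivity
    · linarith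
  have hfar : ∀ d ∈ S, ∀ d' ∈ S, d' + 2 ≤ d → volume.real (Vd d ∩ Vd d') ≤ ψ (d - d') := by
    intro d hd d' hd' hdd
    obtain ⟨a1, a2, a3, a4, _⟩ := hxr d hd
    obtain ⟨b1, b2, b3, b4, _⟩ := hxr d' hd'
    have hee : (0 : ℝ) < ((d - d' : ℕ) : ℝ) := by
      have : 0 < d - d' := by omega
      exact_mod_cast this
    have hec : ((d - d' : ℕ) : ℝ) = d - d' := by rw [Nat.cast_sub (by omega)]
    have he2 : (2 : ℝ) ≤ ((d - d' : ℕ) : ℝ) := by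
      have : 2 ≤ d - d' := by omega
      exact_mod_cast this
    have hδ : ((d - d' : ℕ) : ℝ) / (2 * L) ≤ x d - x d' := by
      have c1 := a2.1
      have c2 := b2.2
      have : ((d - d' : ℕ) : ℝ) / (2 * L) ≤ d / L - (d' + 1) / L := by
        rw [← sub_div, div_le_div_iff₀ (by positivity) hL0]
        nlinarith
      linarith
    have := overlap hS hK a3 a4 b3 b4 _ (by positivity) hδ (by linarith [(hT a1).2, (hT b1).1])
    refine this.trans ?_
    have hp : (((d - d' : ℕ) : ℝ) / (2 * L)) ^ (-(3 / 4) : ℝ) ≤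
        2 * (L : ℝ) ^ (3 / 4 : ℝ) * ((d - d' : ℕ) : ℝ) ^ (-(3 / 4) : ℝ) := by
      rw [Real.div_rpow hee.le (by positivity), Real.rpow_neg (by positivity : (0 : ℝ) ≤ 2 * L), div_inv_eq_mul,
        mul_comm, Real.mul_rpow (by norm_num) hL0.le]
      gcongr
      conv_rhs => rw [← Real.rpow_one 2]
      exact Real.rpow_le_rpow_of_exponent_le (by norm_num) (by norm_num)
    have hn : ¬ (d - d' ≤ 1) := by omega
    simp only [hψ, if_neg hn, zero_add]
    calc _ ≤ 4 * K / W ^ 2 * (2 * (L : ℝ) ^ (3 / 4 : ℝ) * ((d - d' : ℕ) : ℝ) ^ (-(3 / 4) : ℝ)) := by gcongr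
      _ = _ := by ring
  have hpair : ∀ d ∈ S, ∀ d' ∈ S, volume.real (Vd d ∩ Vd d') ≤ ψ ((d - d') + (d' - d)) := by
    intro d hd d' hd'
    rcases le_or_gt (d' + 2) d with hc | hc
    · have e : (d - d') + (d' - d) = d - d' := by omega
      rw [e]; exact hfar d hd d' hd' hc
    rcases le_or_gt (d + 2) d' with hc' | hc'
    · have e : (d - d') + (d' - d) = d' - d := by omega
      rw [e, Set.inter_comm]; exact hfar d' hd' d hd hc'
    · have e : (d - d') + (d' - d) ≤ 1 := by omega
      refine (measureReal_mono Set.inter_subset_left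
        (ne_top_of_le_ne_top hUf (measure_mono (hVU d hd)))).trans ?_
      rw [hVr d hd]
      simp only [hψ, if_pos e]
      have : 0 ≤ 8 * K / W ^ 2 * (L : ℝ) ^ (3 / 4 : ℝ) *
        (((d - d') + (d' - d) : ℕ) : ℝ) ^ (-(3 / 4) : ℝ) := by positivity
      have h3 : r d * (1 / W) ≤ 2 * (1 / W) := by
        gcongr; exact (hxr d hd).2.2.2.1
      have h4 : 2 * (1 / W) = 2 / W := by ring
      linarith
  have hψsum : ∑ e ∈ Finset.range L, ψ e ≤ 4 / W + 32 * K / W ^ 2 * L := by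
    simp only [hψ]
    rw [Finset.sum_add_distrib, ← Finset.mul_sum]
    have c1 : ∑ e ∈ Finset.range L, (if e ≤ 1 then 2 / W else 0) ≤ 4 / W := by
      rw [← Finset.sum_filter, Finset.sum_const, nsmul_eq_mul]
      have : ((Finset.range L).filter (fun e => e ≤ 1)).card ≤ 2 := by
        refine (Finset.card_le_card (t := Finset.range 2) ?_).trans (by simp)
        intro e he
        simp only [Finset.mem_filter, Finset.mem_range] at he ⊢
        omega
      have : (((Finset.range L).filter (fun e => e ≤ 1)).card : ℝ) ≤ 2 := by exact_mod_cast this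
      calc _ ≤ 2 * (2 / W) := by gcongr
        _ = _ := by ring
    have c2 : ∑ e ∈ Finset.range L, (e : ℝ) ^ (-(3 / 4) : ℝ) ≤ 4 * (L : ℝ) ^ (1 / 4 : ℝ) := by
      refine le_trans ?_ (quarter_sum L)
      apply Finset.sum_le_sum_of_subset_of_nonneg
      · intro e he; simp only [Finset.mem_range] at he ⊢; omega
      · intro e _ _; positivity
    have c3 : (L : ℝ) ^ (3 / 4 : ℝ) * (L : ℝ) ^ (1 / 4 : ℝ) = L := by
      rw [← Real.rpow_add hL0]; norm_num
    calc _ ≤ 4 / W + 8 * K / W ^ 2 * (L : ℝ) ^ (3 / 4 : ℝ) * (4 * (L : ℝ) ^ (1 / 4 : ℝ)) := by gcongr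
      _ = 4 / W + 32 * K / W ^ 2 * ((L : ℝ) ^ (3 / 4 : ℝ) * (L : ℝ) ^ (1 / 4 : ℝ)) := by ring
      _ = _ := by rw [c3]
  set κ := 64 * K + 8 with hκ
  have hκ0 : 0 < κ := by positivity
  have hsumB : ∑ d ∈ S, ∑ d' ∈ S, volume.real (Vd d ∩ Vd d') ≤ κ * (L / W) ^ 2 := by
    have hSL : S ⊆ Finset.range L := Finset.filter_subset _ _
    calc ∑ d ∈ S, ∑ d' ∈ S, volume.real (Vd d ∩ Vd d')
        ≤ ∑ d ∈ S, ∑ d' ∈ S, ψ ((d - d') + (d' - d)) :=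
          Finset.sum_le_sum fun d hd => Finset.sum_le_sum fun d' hd' => hpair d hd d' hd'
      _ ≤ ∑ d ∈ S, ∑ d' ∈ Finset.range L, ψ ((d - d') + (d' - d)) :=
          Finset.sum_le_sum fun d hd => Finset.sum_le_sum_of_subset_of_nonneg hSL fun _ _ _ => hψ0 _
      _ ≤ ∑ d ∈ S, 2 * (4 / W + 32 * K / W ^ 2 * L) :=
          Finset.sum_le_sum fun d hd => (dist_sum ψ hψ0 L d (Finset.mem_range.1 (hSL hd))).trans
            (by linarith)
      _ ≤ ∑ d ∈ Finset.range L, 2 * (4 / W + 32 * K / W ^ 2 * L) :=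
          Finset.sum_le_sum_of_subset_of_nonneg hSL fun _ _ _ => by positivity
      _ = 8 * (L / W) + 64 * K * (L / W) ^ 2 := by
          rw [Finset.sum_const, Finset.card_range, nsmul_eq_mul]; field_simp; ring
      _ ≤ κ * (L / W) ^ 2 := by
          have : 1 ≤ L / W := by rw [le_div_iff₀ hW]; linarith
          rw [hκ]; nlinarith
  have hsumA : (S.card : ℝ) / W ≤ ∑ d ∈ S, volume.real (Vd d) := by
    have : ∑ d ∈ S, (1 / W) ≤ ∑ d ∈ S, volume.real (Vd d) := by
      apply Finset.sum_le_sum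
      intro d hd
      rw [hVr d hd]
      exact le_mul_of_one_le_left (by positivity) (hxr d hd).2.2.1
    refine le_trans (le_of_eq ?_) this
    simp; ring
  have key := l2 S Vd hVm U hU hUf hVU (S.card * W / (κ * L ^ 2))
  set t := S.card * W / (κ * L ^ 2) with ht
  have ht0 : 0 ≤ t := by positivity
  have k1 : 2 * t * (S.card / W) - t ^ 2 * (κ * (L / W) ^ 2) ≤ volume.real U := by
    refine le_trans ?_ key
    have e1 : 2 * t * (S.card / W) ≤ 2 * t * ∑ i ∈ S, volume.real (Vd i) := by gcongr
    have e2 := mul_le_mul_of_nonneg_left hsumB (sq_nonneg t)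
    linarith
  have k2 : 2 * t * (S.card / W) - t ^ 2 * (κ * (L / W) ^ 2) = (S.card / L) ^ 2 / κ := by
    rw [ht]; field_simp; ring
  rw [k2, div_le_iff₀ hκ0] at k1
  calc volume.real T ^ 2 ≤ (S.card / L) ^ 2 := by gcongr
    _ ≤ _ := by linarith

theorem null_unit {K : ℝ} (hK : 0 ≤ K) (Ds : ℕ → ℕ) (Gs : ℕ → Finset ℕ) (Cs : ℕ → Set ℝ)
    (hS : ∀ k, Stage K (Ds k) (Gs k)) (hanti : Antitone Cs) (hcpt : ∀ k, IsCompact (Cs k))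
    (hH : ∀ k, H (Ds k) (Gs k) ⊆ Cs k) (B : Set ℝ) (hB : volume B = 0) (t₀ : ℝ) :
    volume ({x | ∃ r : ℝ, 1 ≤ r ∧ r ≤ 2 ∧ ∀ y ∈ ⋂ k, Cs k, x + r * y ∈ B} ∩ Set.Ico t₀ (t₀ + 1)) = 0 := by
  set T := {x | ∃ r : ℝ, 1 ≤ r ∧ r ≤ 2 ∧ ∀ y ∈ ⋂ k, Cs k, x + r * y ∈ B} ∩ Set.Ico t₀ (t₀ + 1) with hT
  have hκ : 0 < 64 * K + 8 := by positivity
  have key : ∀ ε : ℝ, 0 < ε → volume T ≤ ENNReal.ofReal ε := by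
    intro ε hε
    set ρ := ε ^ 2 / (64 * K + 8) with hρ
    have hρ0 : 0 < ρ := by positivity
    obtain ⟨U, hBU, hUo, hUv⟩ := Set.exists_isOpen_le_add B volume
      (ε := ENNReal.ofReal ρ) (by simpa using hρ0)
    rw [hB, zero_add] at hUv
    have hUf : volume U ≠ ⊤ := ne_top_of_le_ne_top ENNReal.ofReal_ne_top hUv
    have hUr : volume.real U ≤ ρ := by
      rw [measureReal_def]
      exact ENNReal.toReal_le_of_le_ofReal hρ0.le hUv
    set Tk : ℕ → Set ℝ := fun k =>
      {x | ∃ r : ℝ, 1 ≤ r ∧ r ≤ 2 ∧ ∀ y ∈ Cs k, x + r * y ∈ U} ∩ Set.Ico t₀ (t₀ + 1) with hTk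
    have hmono : Monotone Tk := by
      intro k l hkl x hx
      obtain ⟨⟨r, h1, h2, h3⟩, hx2⟩ := hx
      exact ⟨⟨r, h1, h2, fun y hy => h3 y (hanti hkl hy)⟩, hx2⟩
    have hsub : T ⊆ ⋃ k, Tk k := by
      rintro x ⟨⟨r, h1, h2, h3⟩, hx2⟩
      have hop : IsOpen ((fun y : ℝ => x + r * y) ⁻¹' U) := hUo.preimage (by fun_prop)
      obtain ⟨k, hk⟩ := exists_subset_nhds_of_isCompact (V := Cs)
        (hanti.directed_ge) hcpt (U := (fun y : ℝ => x + r * y) ⁻¹' U)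
        (fun y hy => hop.mem_nhds (hBU (h3 y hy)))
      exact Set.mem_iUnion.2 ⟨k, ⟨r, h1, h2, fun y hy => hk hy⟩, hx2⟩
    refine (measure_mono hsub).trans ?_
    rw [hmono.measure_iUnion]
    refine iSup_le fun k => ?_
    have hfin : volume (Tk k) ≠ ⊤ := by
      refine ne_top_of_le_ne_top ?_ (measure_mono Set.inter_subset_right)
      rw [Real.volume_Ico]; exact ENNReal.ofReal_ne_top
    have hm := main_est (hS k) hK U (Tk k) hUo.measurableSet hUf t₀ Set.inter_subset_right
      (by
        rintro x ⟨⟨r, h1, h2, h3⟩, -⟩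
        exact ⟨r, h1, h2, fun y hy => h3 y (hH k hy)⟩)
    have h2 : volume.real (Tk k) ^ 2 ≤ ε ^ 2 := by
      refine hm.trans ?_
      calc (64 * K + 8) * volume.real U ≤ (64 * K + 8) * ρ := by gcongr
        _ = ε ^ 2 := by rw [hρ]; field_simp
    have h3 : volume.real (Tk k) ≤ ε := abs_le_of_sq_le_sq' h2 hε.le |>.2
    rw [← ENNReal.ofReal_toReal hfin]
    exact ENNReal.ofReal_le_ofReal h3
  by_contra hne
  have hpos : 0 < volume T := pos_iff_ne_zero.2 hne
  have hfin : volume T ≠ ⊤ := ne_top_of_le_ne_top ENNReal.ofReal_ne_top (key 1 one_pos)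
  have hp : 0 < (volume T).toReal := ENNReal.toReal_pos hne hfin
  have := key ((volume T).toReal / 2) (by positivity)
  have := ENNReal.toReal_le_of_le_ofReal (by positivity) this
  linarith

theorem null_all {K : ℝ} (hK : 0 ≤ K) (Ds : ℕ → ℕ) (Gs : ℕ → Finset ℕ) (Cs : ℕ → Set ℝ)
    (hS : ∀ k, Stage K (Ds k) (Gs k)) (hanti : Antitone Cs) (hcpt : ∀ k, IsCompact (Cs k))
    (hH : ∀ k, H (Ds k) (Gs k) ⊆ Cs k) (B : Set ℝ) (hB : volume B = 0) :
    volume {x | ∃ r : ℝ, 1 ≤ r ∧ r ≤ 2 ∧ ∀ y ∈ ⋂ k, Cs k, x + r * y ∈ B} = 0 := by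
  have hsub : {x | ∃ r : ℝ, 1 ≤ r ∧ r ≤ 2 ∧ ∀ y ∈ ⋂ k, Cs k, x + r * y ∈ B} ⊆
      ⋃ n : ℤ, {x | ∃ r : ℝ, 1 ≤ r ∧ r ≤ 2 ∧ ∀ y ∈ ⋂ k, Cs k, x + r * y ∈ B} ∩ Set.Ico (n : ℝ) (n + 1) := by
    intro x hx
    exact Set.mem_iUnion.2 ⟨⌊x⌋, hx, Int.floor_le x, Int.lt_floor_add_one x⟩
  exact measure_mono_null hsub (measure_iUnion_null fun n => null_unit hK Ds Gs Cs hS hanti hcpt hH B hB n)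

theorem null_scaled {K : ℝ} (hK : 0 ≤ K) (Ds : ℕ → ℕ) (Gs : ℕ → Finset ℕ) (Cs : ℕ → Set ℝ)
    (hS : ∀ k, Stage K (Ds k) (Gs k)) (hanti : Antitone Cs) (hcpt : ∀ k, IsCompact (Cs k))
    (hH : ∀ k, H (Ds k) (Gs k) ⊆ Cs k) (B : Set ℝ) (hB : volume B = 0) :
    volume {x | ∃ r : ℝ, 0 < r ∧ ∀ y ∈ ⋂ k, Cs k, x + r * y ∈ B} = 0 := by
  have hsub : {x | ∃ r : ℝ, 0 < r ∧ ∀ y ∈ ⋂ k, Cs k, x + r * y ∈ B} ⊆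
      ⋃ n : ℤ, (fun z : ℝ => ((2 : ℝ) ^ n)⁻¹ * z + 0) ⁻¹' {x | ∃ r : ℝ, 1 ≤ r ∧ r ≤ 2 ∧ ∀ y ∈ ⋂ k, Cs k,
        x + r * y ∈ (fun z : ℝ => (2 : ℝ) ^ n * z + 0) ⁻¹' B} := by
    rintro x ⟨r, hr, hx⟩
    obtain ⟨n, hn1, hn2⟩ := exists_mem_Ico_zpow hr (by norm_num : (1 : ℝ) < 2)
    have h2 : (0 : ℝ) < 2 ^ n := by positivity
    refine Set.mem_iUnion.2 ⟨n, ((2 : ℝ) ^ n)⁻¹ * r, ?_, ?_, ?_⟩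
    · rw [inv_mul_eq_div, le_div_iff₀ h2]; linarith
    · rw [inv_mul_eq_div, div_le_iff₀ h2]
      rw [zpow_add_one₀ (by norm_num)] at hn2; linarith
    · intro y hy
      have := hx y hy
      simp only [Set.mem_preimage]
      convert this using 1
      field_simp; ring
  refine measure_mono_null hsub (measure_iUnion_null fun n => ?_)
  have h2 : (0 : ℝ) < 2 ^ n := by positivity
  rw [pre_vol (inv_pos.2 h2), null_all hK Ds Gs Cs hS hanti hcpt hH, mul_zero]
  rw [pre_vol h2, hB, mul_zero]

theorem dimH_le_of_cover (A : Set ℝ) (s : NNReal) {ι : ℕ → Type} [∀ n, Fintype (ι n)]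
    (t : ∀ n, ι n → Set ℝ) (ρ : ℕ → ℝ) (hρ0 : ∀ n, 0 ≤ ρ n)
    (hρ : Filter.Tendsto ρ Filter.atTop (nhds 0))
    (hd : ∀ n i, Metric.ediam (t n i) ≤ ENNReal.ofReal (ρ n)) (hc : ∀ n, A ⊆ ⋃ i, t n i)
    (hM : ∀ n, (Fintype.card (ι n) : ℝ) * ρ n ^ (s : ℝ) ≤ 1) : dimH A ≤ s := by
  apply dimH_le_of_hausdorffMeasure_ne_top
  have h1 : Filter.Tendsto (fun n => ENNReal.ofReal (ρ n)) Filter.atTop (nhds 0) := by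
    simpa using ENNReal.tendsto_ofReal hρ
  have h2 := Measure.hausdorffMeasure_le_liminf_sum (s : ℝ) A (fun n => ENNReal.ofReal (ρ n)) h1 t
    (Filter.Eventually.of_forall hd) (Filter.Eventually.of_forall hc)
  refine ne_top_of_le_ne_top ENNReal.one_ne_top (h2.trans ?_)
  refine Filter.liminf_le_of_le (by isBoundedDefault) ?_
  intro b hb
  obtain ⟨n, hn⟩ := hb.exists
  refine hn.trans ?_
  calc ∑ i, Metric.ediam (t n i) ^ (s : ℝ) ≤ ∑ i : ι n, ENNReal.ofReal (ρ n ^ (s : ℝ)) := by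
        apply Finset.sum_le_sum
        intro i _
        rw [← ENNReal.ofReal_rpow_of_nonneg (hρ0 n) s.coe_nonneg]
        exact ENNReal.rpow_le_rpow (hd n i) s.coe_nonneg
    _ = ENNReal.ofReal ((Fintype.card (ι n) : ℝ) * ρ n ^ (s : ℝ)) := by
        rw [Finset.sum_const, nsmul_eq_mul, ENNReal.ofReal_mul (by positivity), ENNReal.ofReal_natCast]; rfl
    _ ≤ ENNReal.ofReal 1 := ENNReal.ofReal_le_ofReal (hM n)
    _ = 1 := ENNReal.ofReal_one

theorem vol_pos_dimH {A : Set ℝ} (h : volume A ≠ 0) : dimH A = 1 := by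
  apply le_antisymm
  · exact (dimH_mono (Set.subset_univ A)).trans (le_of_eq Real.dimH_univ)
  · have : μH[(1 : NNReal)] A ≠ 0 := by
      rw [NNReal.coe_one, hausdorffMeasure_real]; exact h
    simpa using le_dimH_of_hausdorffMeasure_ne_zero this

theorem cf_bound {c : ℝ} (h1 : 0 ≤ c) (h2 : c < 1) (f : ℕ → Bool) :
    0 ≤ Cardinal.cantorFunction c f ∧ Cardinal.cantorFunction c f ≤ (1 - c)⁻¹ := by
  constructor
  · exact tsum_nonneg fun n => Cardinal.cantorFunctionAux_nonneg h1
  · rw [← tsum_geometric_of_lt_one h1 h2]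
    apply (Cardinal.summable_cantor_function f h1 h2).tsum_le_tsum _ (summable_geometric_of_lt_one h1 h2)
    intro n
    cases h : f n
    · simp [h, pow_nonneg h1]
    · simp [h]

theorem cf_shift {c : ℝ} (h1 : 0 ≤ c) (h2 : c < 1) (n : ℕ) (f g : ℕ → Bool) (h : ∀ k < n, f k = g k) :
    Cardinal.cantorFunction c f - Cardinal.cantorFunction c g =
      c ^ n * (Cardinal.cantorFunction c (fun k => f (k + n)) -
        Cardinal.cantorFunction c (fun k => g (k + n))) := by
  induction n generalizing f g with
  | zero => simp
  | succ n ih =>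
    rw [Cardinal.cantorFunction_succ f h1 h2, Cardinal.cantorFunction_succ g h1 h2, h 0 (by omega)]
    have := ih (fun k => f (k + 1)) (fun k => g (k + 1)) (fun k hk => h _ (by omega))
    have e1 : (fun k => f (k + n + 1)) = fun k => f (k + (n + 1)) := rfl
    have e2 : (fun k => g (k + n + 1)) = fun k => g (k + (n + 1)) := rfl
    rw [add_sub_add_left_eq_sub, ← mul_sub, this, e1, e2]; ring

theorem cf_upper {c : ℝ} (h1 : 0 ≤ c) (h2 : c < 1) (n : ℕ) (f g : ℕ → Bool) (h : ∀ k < n, f k = g k) :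
    |Cardinal.cantorFunction c f - Cardinal.cantorFunction c g| ≤ c ^ n * (1 - c)⁻¹ := by
  rw [cf_shift h1 h2 n f g h, abs_mul, abs_of_nonneg (pow_nonneg h1 n)]
  apply mul_le_mul_of_nonneg_left _ (pow_nonneg h1 n)
  have := cf_bound h1 h2 (fun k => f (k + n))
  have := cf_bound h1 h2 (fun k => g (k + n))
  rw [abs_le]; constructor <;> linarith

theorem cf_lower {c : ℝ} (h1 : 0 ≤ c) (h2 : c < 1) (n : ℕ) (f g : ℕ → Bool) (h : ∀ k < n, f k = g k)
    (hn : f n ≠ g n) :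
    c ^ n * (1 - c * (1 - c)⁻¹) ≤ |Cardinal.cantorFunction c f - Cardinal.cantorFunction c g| := by
  rw [cf_shift h1 h2 n f g h, abs_mul, abs_of_nonneg (pow_nonneg h1 n)]
  apply mul_le_mul_of_nonneg_left _ (pow_nonneg h1 n)
  rw [Cardinal.cantorFunction_succ _ h1 h2, Cardinal.cantorFunction_succ (fun k => g (k + n)) h1 h2]
  have b1 := cf_bound h1 h2 (fun k => f (k + 1 + n))
  have b2 := cf_bound h1 h2 (fun k => g (k + 1 + n))
  have c1 := mul_le_mul_of_nonneg_left b1.2 h1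
  have c2 := mul_le_mul_of_nonneg_left b2.2 h1
  have d1 := mul_nonneg h1 b1.1
  have d2 := mul_nonneg h1 b2.1
  simp only [zero_add]
  rcases hf : f n <;> rcases hg : g n
  · simp [hf, hg] at hn
  · simp only [cond_true, cond_false]
    rw [abs_sub_comm]
    refine le_trans ?_ (le_abs_self _)
    linarith
  · simp only [cond_true, cond_false]
    refine le_trans ?_ (le_abs_self _)
    linarith
  · simp [hf, hg] at hn

theorem cf_cont {c : ℝ} (h1 : 0 ≤ c) (h2 : c < 1) : Continuous (Cardinal.cantorFunction c) := by
  unfold Cardinal.cantorFunction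
  refine continuous_tsum (u := fun n => c ^ n) ?_ (summable_geometric_of_lt_one h1 h2) ?_
  · intro n
    have : (fun f : ℕ → Bool => Cardinal.cantorFunctionAux c f n) =
      (fun b : Bool => cond b (c ^ n) 0) ∘ (fun f : ℕ → Bool => f n) := rfl
    rw [this]
    exact (continuous_of_discreteTopology).comp (continuous_apply n)
  · intro n f
    rw [Real.norm_eq_abs, abs_of_nonneg (Cardinal.cantorFunctionAux_nonneg h1)]
    cases h : f n
    · simp [h, pow_nonneg h1]
    · simp [h]

theorem exists_E (s : ℝ) (hs0 : 0 < s) (hs1 : s < 1) : ∃ E : Set ℝ, E ⊆ Set.Icc 1 2 ∧ E.Nonempty ∧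
    IsCompact E ∧ Perfect E ∧ dimH E = ENNReal.ofReal s := by
  classical
  set c : ℝ := 2 ^ (-(1 / s)) with hc
  have hc0 : 0 < c := Real.rpow_pos_of_pos (by norm_num) _
  have hchalf : c < 1 / 2 := by
    have : c < (2 : ℝ) ^ (-1 : ℝ) := by
      apply Real.rpow_lt_rpow_of_exponent_lt (by norm_num)
      rw [neg_lt_neg_iff, lt_div_iff₀ hs0]; linarith
    rwa [Real.rpow_neg_one, ← one_div] at this
  have hc1 : c < 1 := by linarith
  have hcs : c ^ s = 1 / 2 := by
    rw [hc, ← Real.rpow_mul (by norm_num)]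
    have : -(1 / s) * s = -1 := by field_simp
    rw [this, Real.rpow_neg_one, one_div]
  have hcns : ∀ n : ℕ, (c ^ n) ^ s = (1 / 2) ^ n := by
    intro n
    rw [← Real.rpow_natCast, ← Real.rpow_mul hc0.le, mul_comm, Real.rpow_mul hc0.le, hcs, Real.rpow_natCast]
  have h1c : 0 < 1 - c := by linarith
  set φ : (ℕ → Bool) → ℝ := fun f => 1 + (1 - c) * Cardinal.cantorFunction c f with hφ
  have hφc : Continuous φ := by
    have := cf_cont hc0.le hc1
    fun_prop
  have hφi : Function.Injective φ := by
    intro f g h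
    apply Cardinal.cantorFunction_injective hc0 hchalf
    have : (1 - c) * Cardinal.cantorFunction c f = (1 - c) * Cardinal.cantorFunction c g := by
      simpa [hφ] using h
    exact mul_left_cancel₀ h1c.ne' this
  have hup : ∀ n f g, (∀ k < n, f k = g k) → |φ f - φ g| ≤ c ^ n := by
    intro n f g h
    have e : φ f - φ g = (1 - c) * (Cardinal.cantorFunction c f - Cardinal.cantorFunction c g) := by
      simp only [hφ]; ring
    rw [e, abs_mul, abs_of_pos h1c]
    calc _ ≤ (1 - c) * (c ^ n * (1 - c)⁻¹) := by gcongr; exact cf_upper hc0.le hc1 n f g h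
      _ = c ^ n := by field_simp
  have hlow : ∀ n f g, (∀ k < n, f k = g k) → f n ≠ g n → c ^ n * (1 - 2 * c) ≤ |φ f - φ g| := by
    intro n f g h hn
    have e : φ f - φ g = (1 - c) * (Cardinal.cantorFunction c f - Cardinal.cantorFunction c g) := by
      simp only [hφ]; ring
    rw [e, abs_mul, abs_of_pos h1c]
    calc c ^ n * (1 - 2 * c) = (1 - c) * (c ^ n * (1 - c * (1 - c)⁻¹)) := by field_simp; ring
      _ ≤ _ := by gcongr; exact cf_lower hc0.le hc1 n f g h hn
  have hpow : Filter.Tendsto (fun n : ℕ => c ^ n) Filter.atTop (nhds 0) :=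
    tendsto_pow_atTop_nhds_zero_of_lt_one hc0.le hc1
  refine ⟨Set.range φ, ?_, Set.range_nonempty _, isCompact_range hφc, ?_, ?_⟩
  · rintro _ ⟨f, rfl⟩
    have := cf_bound hc0.le hc1 f
    have h2 := mul_le_mul_of_nonneg_left this.2 h1c.le
    rw [mul_inv_cancel₀ h1c.ne'] at h2
    have h3 := mul_nonneg h1c.le this.1
    constructor <;> simp only [hφ] <;> linarith
  · refine ⟨(isCompact_range hφc).isClosed, ?_⟩
    rw [preperfect_iff_nhds]
    rintro _ ⟨f, rfl⟩ U hU
    obtain ⟨ε, hε, hb⟩ := Metric.mem_nhds_iff.1 hU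
    obtain ⟨n, hn⟩ := (hpow.eventually_lt_const hε).exists
    refine ⟨φ (Function.update f n (!f n)), ⟨hb ?_, Set.mem_range_self _⟩, ?_⟩
    · rw [Metric.mem_ball, Real.dist_eq]
      refine (hup n _ _ ?_).trans_lt hn
      intro k hk
      rw [Function.update_of_ne (by omega)]
    · intro h
      have := congrFun (hφi h) n
      simp at this
  · apply le_antisymm
    · have hsc : ((NNReal.mk s hs0.le) : ENNReal) = ENNReal.ofReal s :=
        (ENNReal.ofReal_eq_coe_nnreal hs0.le).symm
      rw [← hsc]
      apply dimH_le_of_cover (ι := fun n => Fin n → Bool) _ _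
        (fun n σ => φ '' {f | ∀ i : Fin n, f i = σ i}) (fun n => c ^ n) (fun n => by positivity) hpow
      · intro n σ
        apply Metric.ediam_le
        rintro _ ⟨f, hf, rfl⟩ _ ⟨g, hg, rfl⟩
        rw [edist_dist, Real.dist_eq]
        apply ENNReal.ofReal_le_ofReal
        apply hup
        intro k hk
        exact (hf ⟨k, hk⟩).trans (hg ⟨k, hk⟩).symm
      · rintro n _ ⟨f, rfl⟩
        exact Set.mem_iUnion.2 ⟨fun i => f i, f, fun i => rfl, rfl⟩
      · intro n
        change _ * (c ^ n) ^ s ≤ 1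
        rw [hcns]
        simp
    · set δ : (ℕ → Bool) → ℝ := fun f => Real.ofDigits (fun i => if f i then (1 : Fin 2) else 0) with hδ
      set h : ℝ → ℝ := fun x => δ (Function.invFun φ x) with hh
      have hhφ : ∀ f, h (φ f) = δ f := fun f => by
        simp only [hh]; rw [Function.leftInverse_invFun hφi f]
      set M : NNReal := ⟨((1 - 2 * c) ^ s)⁻¹, by
        have : 0 < 1 - 2 * c := by linarith
        positivity⟩ with hM
      have hHol : HolderOnWith M (NNReal.mk s hs0.le) h (Set.range φ) := by
        rintro _ ⟨f, rfl⟩ _ ⟨g, rfl⟩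
        rw [hhφ, hhφ]
        by_cases hfg : f = g
        · simp [hfg]
        have hex : ∃ n, f n ≠ g n := Function.ne_iff.mp hfg
        have hn := Nat.find_spec hex
        have hlt : ∀ k < Nat.find hex, f k = g k := fun k hk => not_not.1 (Nat.find_min hex hk)
        set n := Nat.find hex
        have hl := hlow n f g hlt hn
        have hc2 : 0 < 1 - 2 * c := by linarith
        have hd : |δ f - δ g| ≤ ((1 - 2 * c) ^ s)⁻¹ * |φ f - φ g| ^ s := by
          have h1 : |δ f - δ g| ≤ ((2 : ℕ) ^ n : ℝ)⁻¹ := by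
            apply Real.abs_ofDigits_sub_ofDigits_le
            intro i hi
            rw [hlt i hi]
          refine h1.trans ?_
          have h2 : (c ^ n * (1 - 2 * c)) ^ s ≤ |φ f - φ g| ^ s :=
            Real.rpow_le_rpow (by positivity) hl hs0.le
          rw [Real.mul_rpow (by positivity) hc2.le, hcns] at h2
          have h3 : 0 < (1 - 2 * c) ^ s := Real.rpow_pos_of_pos hc2 _
          rw [inv_mul_eq_div, le_div_iff₀ h3]
          refine le_trans (le_of_eq ?_) h2
          simp
        rw [edist_dist, edist_dist, Real.dist_eq, Real.dist_eq]
        change _ ≤ (M : ENNReal) * (ENNReal.ofReal |φ f - φ g|) ^ s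
        have hMe : (M : ENNReal) = ENNReal.ofReal (((1 - 2 * c) ^ s)⁻¹) := by
          rw [hM]; exact (ENNReal.ofReal_eq_coe_nnreal _).symm
        rw [hMe, ENNReal.ofReal_rpow_of_nonneg (abs_nonneg _) hs0.le, ← ENNReal.ofReal_mul (by positivity)]
        exact ENNReal.ofReal_le_ofReal hd
      have himg := hHol.dimH_image_le (r := (NNReal.mk s hs0.le)) (by exact_mod_cast hs0)
      have hsub : Set.Icc (0 : ℝ) 1 ⊆ h '' Set.range φ := by
        intro y hy
        obtain ⟨a, -, ha⟩ := Real.ofDigits_SurjOn (b := 2) (by norm_num) hy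
        refine ⟨φ (fun i => decide (a i = 1)), Set.mem_range_self _, ?_⟩
        rw [hhφ, ← ha]
        simp only [hδ]
        congr 1
        ext i
        have : a i = 0 ∨ a i = 1 := by
          have := (a i).isLt
          rcases hai : a i with ⟨v, hv⟩
          interval_cases v
          · left; rfl
          · right; rfl
        rcases this with h | h <;> simp [h]
      have h1 : (1 : ENNReal) ≤ dimH (Set.range φ) / ENNReal.ofReal s := by
        have e : dimH (Set.Icc (0 : ℝ) 1) = 1 := vol_pos_dimH (by simp)
        rw [← e]
        refine (dimH_mono hsub).trans (himg.trans (le_of_eq ?_))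
        rw [ENNReal.ofReal_eq_coe_nnreal hs0.le]
      rw [ENNReal.le_div_iff_mul_le (Or.inl (by simpa using hs0)) (Or.inl ENNReal.ofReal_ne_top)] at h1
      simpa using h1

/-- closed grid interval -/
def I (D g : ℕ) : Set ℝ := Set.Icc (1 + (g : ℝ) / D) (1 + ((g : ℝ) + 1) / D)

theorem mem_I {D : ℕ} (hD : 0 < D) (g : ℕ) (y : ℝ) :
    y ∈ I D g ↔ (g : ℝ) ≤ (y - 1) * D ∧ (y - 1) * D ≤ g + 1 := by
  have hD' : (0 : ℝ) < D := by exact_mod_cast hD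
  unfold I
  rw [Set.mem_Icc, ← le_sub_iff_add_le', div_le_iff₀ hD', ← sub_le_iff_le_add', le_div_iff₀ hD']

theorem I_sub {D c : ℕ} (hD : 0 < D) (hc : 0 < c) (i : ℕ) : I (D * c) i ⊆ I D (i / c) := by
  intro y hy
  rw [mem_I (by positivity)] at hy
  rw [mem_I hD]
  have hc' : (0 : ℝ) < c := by exact_mod_cast hc
  push_cast at hy
  have h1 : ((i / c : ℕ) : ℝ) * c ≤ i := by exact_mod_cast Nat.div_mul_le_self i c
  have h2 : (i : ℝ) + 1 ≤ ((i / c : ℕ) + 1 : ℝ) * c := by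
    have : i + 1 ≤ (i / c + 1) * c := by
      have := Nat.lt_div_mul_add (a := i) hc
      rw [Nat.add_mul]; omega
    exact_mod_cast this
  constructor
  · refine le_of_mul_le_mul_right ?_ hc'
    linarith [hy.1]
  · refine le_of_mul_le_mul_right ?_ hc'
    linarith [hy.2]

theorem I_disj {D g g' : ℕ} (hD : 0 < D) (h : g + 1 < g') : Disjoint (I D g) (I D g') := by
  rw [Set.disjoint_left]
  intro y hy hy'
  rw [mem_I hD] at hy hy'
  have h1 : (g : ℝ) + 1 < g' := by exact_mod_cast h
  linarith [hy.2, hy'.1]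

theorem I_nonempty (D g : ℕ) : (I D g).Nonempty := by
  unfold I
  rw [Set.nonempty_Icc]
  gcongr; linarith

/-- refinement relation between consecutive stages -/
structure Rel (D : ℕ) (G : Finset ℕ) (D' : ℕ) (G' : Finset ℕ) : Prop where
  grow : 2 * D ≤ D'
  cardle : G'.card ^ 3 ≤ D' ^ 2
  parent : ∀ g' ∈ G', ∃ g ∈ G, I D' g' ⊆ I D g
  child : ∀ g ∈ G, ∃ g₁ ∈ G', ∃ g₂ ∈ G', I D' g₁ ⊆ I D g ∧ I D' g₂ ⊆ I D g ∧ Disjoint (I D' g₁) (I D' g₂)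

theorem step' {K K' : ℝ} {D : ℕ} {G : Finset ℕ} (hS : Stage K D G) (hK : 0 ≤ K) (hKK : K < K') :
    ∃ p : ℕ × Finset ℕ, Stage K' p.1 p.2 ∧ Rel D G p.1 p.2 := by
  obtain ⟨m, c, hm, hc, hmc, X, hX⟩ := step hS hK hKK
  refine ⟨(m ^ 2 * m, newG m (Act m c G) X), hX, ?_, ?_, ?_, ?_⟩
  · rw [hmc]
    have : 2 ≤ c * m := by nlinarith
    calc 2 * D = D * 2 := by ring
      _ ≤ D * (c * m) := Nat.mul_le_mul_left _ this
      _ = _ := by ring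
  · change (newG m (Act m c G) X).card ^ 3 ≤ _
    rw [newG_card]
    have h1 : (Act m c G).card ≤ m ^ 2 := by
      rw [← Finset.card_range (m ^ 2)]
      exact Finset.card_le_card fun i hi => Finset.mem_range.2 (Act_lt i hi)
    calc _ ≤ (m ^ 2) ^ 3 := Nat.pow_le_pow_left h1 3
      _ = _ := by ring
  · intro g' hg'
    simp only [newG, Finset.mem_image, Finset.mem_univ, true_and] at hg'
    obtain ⟨⟨i, hi⟩, rfl⟩ := hg'
    have hi' := hi
    simp only [Act, Finset.mem_filter] at hi'
    refine ⟨i / c, hi'.2, ?_⟩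
    have h1 := I_sub (D := m ^ 2) (c := m) (by positivity) (by omega) (ix m ((⟨i, hi⟩ : Act m c G), X ⟨i, hi⟩))
    have h2 : ix m ((⟨i, hi⟩ : Act m c G), X ⟨i, hi⟩) / m = i := by
      simp only [ix]
      rw [Nat.mul_comm, Nat.mul_add_div (by omega), Nat.div_eq_of_lt (X ⟨i, hi⟩).2, Nat.add_zero]
    rw [h2] at h1
    refine h1.trans ?_
    rw [hmc]
    exact I_sub hS.Dpos (by omega) i
  · intro g hg
    have hgD := hS.sub g hg
    have hdiv : ∀ e < c, (g * c + e) / c = g := by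
      intro e he
      rw [Nat.mul_comm, Nat.mul_add_div (by omega), Nat.div_eq_of_lt he, Nat.add_zero]
    have hact : ∀ e < c, g * c + e ∈ Act m c G := by
      intro e he
      simp only [Act, Finset.mem_filter, Finset.mem_range]
      refine ⟨?_, by rw [hdiv e he]; exact hg⟩
      rw [hmc]
      calc g * c + e < (g + 1) * c := by rw [Nat.add_mul]; omega
        _ ≤ D * c := Nat.mul_le_mul_right _ hgD
    have hex : ∀ e, e < c → ∃ g' ∈ newG m (Act m c G) X, I (m ^ 2 * m) g' ⊆ I D g ∧
        (g * c + e) * m ≤ g' ∧ g' < (g * c + e) * m + m := by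
      intro e he
      generalize hi0 : (⟨g * c + e, hact e he⟩ : Act m c G) = i0
      have hi1 : (i0 : ℕ) = g * c + e := by rw [← hi0]
      have hX := (X i0).2
      have hv : ix m (i0, X i0) = (g * c + e) * m + (X i0 : ℕ) := by
        simp only [ix]
        rw [hi1]
      refine ⟨ix m (i0, X i0), ?_, ?_, ?_, ?_⟩
      · unfold newG
        exact Finset.mem_image.2 ⟨i0, Finset.mem_univ _, rfl⟩
      · have h1 := I_sub (D := m ^ 2) (c := m) (by positivity) (by omega) (ix m (i0, X i0))
        have h2 : ix m (i0, X i0) / m = g * c + e := by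
          rw [hv, Nat.mul_comm, Nat.mul_add_div (by omega), Nat.div_eq_of_lt hX, Nat.add_zero]
        rw [h2] at h1
        refine h1.trans ?_
        rw [hmc]
        have := I_sub hS.Dpos (by omega : 0 < c) (g * c + e)
        rwa [hdiv e he] at this
      · rw [hv]; omega
      · rw [hv]; omega
    obtain ⟨g1, hg1, hs1, -, hu1⟩ := hex 0 (by omega)
    obtain ⟨g2, hg2, hs2, hl2, -⟩ := hex 2 (by omega)
    refine ⟨g1, hg1, g2, hg2, hs1, hs2, ?_⟩
    apply I_disj (by positivity)
    have h3 : (g * c + 2) * m = (g * c + 0) * m + 2 * m := by ring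
    rw [h3] at hl2
    omega

theorem stage0 : Stage 3 1 {0} := by
  refine ⟨one_pos, by simp, by simp, ?_⟩
  intro a b _ _ hb hb3
  have hQ : Q a b 1 {0} ≤ 1 := by
    refine (measureReal_mono Set.inter_subset_left (H_ne_top _ _)).trans ?_
    rw [H_real one_pos]; simp
  have h1 : (3 : ℝ) ^ (-(3 / 4) : ℝ) ≤ b ^ (-(3 / 4) : ℝ) := Real.rpow_le_rpow_of_nonpos hb hb3 (by norm_num)
  have h2 : (3 : ℝ) ^ (-1 : ℝ) ≤ (3 : ℝ) ^ (-(3 / 4) : ℝ) :=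
    Real.rpow_le_rpow_of_exponent_le (by norm_num) (by norm_num)
  rw [Real.rpow_neg_one] at h2
  have : ((1 : ℕ) : ℝ) / (({0} : Finset ℕ).card : ℝ) = 1 := by simp
  rw [this, one_pow, one_mul]
  linarith

theorem Stage.mono {K K' : ℝ} {D : ℕ} {G : Finset ℕ} (hS : Stage K D G) (h : K ≤ K') : Stage K' D G :=
  ⟨hS.Dpos, hS.ne, hS.sub, fun a b h1 h2 h3 h4 => (hS.est a b h1 h2 h3 h4).trans
    (mul_le_mul_of_nonneg_right h (Real.rpow_nonneg h3.le _))⟩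

theorem exists_seq : ∃ (Ds : ℕ → ℕ) (Gs : ℕ → Finset ℕ), Ds 0 = 1 ∧ Gs 0 = {0} ∧
    (∀ k, Stage 4 (Ds k) (Gs k)) ∧ ∀ k, Rel (Ds k) (Gs k) (Ds (k + 1)) (Gs (k + 1)) := by
  have hp : ∀ k : ℕ, (0 : ℝ) < (1 / 2) ^ k := fun k => by positivity
  have hp1 : ∀ k : ℕ, ((1 : ℝ) / 2) ^ k ≤ 1 := fun k => pow_le_one₀ (by norm_num) (by norm_num)
  have hst : ∀ (k : ℕ) (p : {p : ℕ × Finset ℕ // Stage (4 - (1 / 2) ^ k) p.1 p.2}),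
      ∃ q : {p : ℕ × Finset ℕ // Stage (4 - (1 / 2) ^ (k + 1)) p.1 p.2},
        Rel p.1.1 p.1.2 q.1.1 q.1.2 := by
    intro k p
    obtain ⟨q, hq, hr⟩ := step' (K' := 4 - (1 / 2) ^ (k + 1)) p.2 (by linarith [hp1 k])
      (by rw [pow_succ]; linarith [hp k])
    exact ⟨⟨q, hq⟩, hr⟩
  choose F hF using hst
  set f : (k : ℕ) → {p : ℕ × Finset ℕ // Stage (4 - (1 / 2) ^ k) p.1 p.2} := fun k =>
    Nat.rec ⟨(1, {0}), by have := stage0; norm_num; exact this⟩ (fun k p => F k p) k with hf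
  refine ⟨fun k => (f k).1.1, fun k => (f k).1.2, rfl, rfl, fun k => ?_, fun k => ?_⟩
  · exact (f k).2.mono (by linarith [hp k])
  · exact hF k (f k)

theorem exists_C : ∃ C : Set ℝ, C ⊆ Set.Icc 1 2 ∧ IsCompact C ∧ Perfect C ∧ dimH C ≤ ENNReal.ofReal (2 / 3) ∧
    ∀ B : Set ℝ, volume B = 0 → volume {x | ∃ r : ℝ, 0 < r ∧ ∀ y ∈ C, x + r * y ∈ B} = 0 := by
  obtain ⟨Ds, Gs, hD0, hG0, hS, hR⟩ := exists_seq
  set Cs : ℕ → Set ℝ := fun k => ⋃ g ∈ Gs k, I (Ds k) g with hCs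
  have hcpt : ∀ k, IsCompact (Cs k) := fun k =>
    (Gs k).isCompact_biUnion fun g _ => isCompact_Icc
  have hanti : Antitone Cs := by
    apply antitone_nat_of_succ_le
    intro k
    apply Set.iUnion₂_subset
    intro g' hg'
    obtain ⟨g, hg, hsub⟩ := (hR k).parent g' hg'
    exact hsub.trans (Set.subset_biUnion_of_mem (u := fun g => I (Ds k) g) hg)
  have hH : ∀ k, H (Ds k) (Gs k) ⊆ Cs k := fun k =>
    Set.iUnion₂_mono fun g _ => Set.Ico_subset_Icc_self
  set C := ⋂ k, Cs k with hC
  have hCk : ∀ k, C ⊆ Cs k := fun k => Set.iInter_subset _ k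
  have hCcl : IsClosed C := isClosed_iInter fun k => (hcpt k).isClosed
  have hDpow : ∀ k, 2 ^ k ≤ Ds k := by
    intro k
    induction k with
    | zero => simp [hD0]
    | succ k ih =>
      have := (hR k).grow
      rw [pow_succ]; omega
  have hρ : Filter.Tendsto (fun k => 1 / (Ds k : ℝ)) Filter.atTop (nhds 0) := by
    have h1 : Filter.Tendsto (fun k : ℕ => ((1 : ℝ) / 2) ^ k) Filter.atTop (nhds 0) :=
      tendsto_pow_atTop_nhds_zero_of_lt_one (by norm_num) (by norm_num)
    refine squeeze_zero (fun k => by positivity) (fun k => ?_) h1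
    have : (2 : ℝ) ^ k ≤ Ds k := by exact_mod_cast hDpow k
    rw [one_div_pow]
    gcongr
  -- points in each cell
  have hpt : ∀ k, ∀ g ∈ Gs k, (C ∩ I (Ds k) g).Nonempty := by
    intro k g hg
    have hdesc : ∀ j, ∃ g' ∈ Gs (k + j), I (Ds (k + j)) g' ⊆ I (Ds k) g := by
      intro j
      induction j with
      | zero => exact ⟨g, hg, subset_rfl⟩
      | succ j ih =>
        obtain ⟨g', hg', hsub⟩ := ih
        obtain ⟨g₁, h₁, -, -, h₂, -⟩ := (hR (k + j)).child g' hg'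
        exact ⟨g₁, h₁, h₂.trans hsub⟩
    have := IsCompact.nonempty_iInter_of_sequence_nonempty_isCompact_isClosed
      (fun j => Cs (k + j) ∩ I (Ds k) g)
      (fun j => Set.inter_subset_inter_left _ (hanti (by omega)))
      (fun j => by
        obtain ⟨g', hg', hsub⟩ := hdesc j
        obtain ⟨y, hy⟩ := I_nonempty (Ds (k + j)) g'
        exact ⟨y, Set.mem_biUnion (t := fun g => I (Ds (k + j)) g) hg' hy, hsub hy⟩)
      ((hcpt _).inter_right isClosed_Icc)
      (fun j => (hcpt _).isClosed.inter isClosed_Icc)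
    obtain ⟨y, hy⟩ := this
    rw [Set.mem_iInter] at hy
    refine ⟨y, Set.mem_iInter.2 fun j => hanti (by omega : j ≤ k + j) (hy j).1, (hy 0).2⟩
  refine ⟨C, ?_, (hcpt 0).of_isClosed_subset hCcl (hCk 0), ⟨hCcl, ?_⟩, ?_, ?_⟩
  · refine (hCk 0).trans ?_
    simp only [hCs, hD0, hG0]
    intro y hy
    simp only [Finset.mem_singleton, Set.iUnion_iUnion_eq_left, I] at hy
    norm_num at hy
    exact hy
  · rw [preperfect_iff_nhds]
    intro x hx U hU
    obtain ⟨ε, hε, hb⟩ := Metric.mem_nhds_iff.1 hU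
    obtain ⟨k, hk⟩ := (hρ.eventually_lt_const hε).exists
    have hxk := hCk k hx
    simp only [hCs, Set.mem_iUnion] at hxk
    obtain ⟨g, hg, hxg⟩ := hxk
    obtain ⟨g₁, h₁, g₂, h₂, s₁, s₂, hdis⟩ := (hR k).child g hg
    have hball : ∀ y ∈ I (Ds k) g, y ∈ U := by
      intro y hy
      apply hb
      rw [Metric.mem_ball, Real.dist_eq]
      refine lt_of_le_of_lt ?_ hk
      have e : 1 + ((g : ℝ) + 1) / Ds k - (1 + (g : ℝ) / Ds k) = 1 / Ds k := by ring
      rw [← e, abs_le]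
      constructor <;> linarith [hxg.1, hxg.2, hy.1, hy.2]
    obtain ⟨y₁, hy₁, hy₁'⟩ := hpt (k + 1) g₁ h₁
    obtain ⟨y₂, hy₂, hy₂'⟩ := hpt (k + 1) g₂ h₂
    by_cases h : y₁ = x
    · refine ⟨y₂, ⟨hball _ (s₂ hy₂'), hy₂⟩, ?_⟩
      intro h'
      exact Set.disjoint_left.1 hdis hy₁' (by rw [h, ← h']; exact hy₂')
    · exact ⟨y₁, ⟨hball _ (s₁ hy₁'), hy₁⟩, h⟩
  · have h23 : (0 : ℝ) ≤ 2 / 3 := by norm_num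
    rw [ENNReal.ofReal_eq_coe_nnreal h23]
    apply dimH_le_of_cover (ι := fun k => Gs (k + 1)) _ _ (fun k g => I (Ds (k + 1)) g)
      (fun k => 1 / (Ds (k + 1) : ℝ)) (fun k => by positivity) (hρ.comp (Filter.tendsto_add_atTop_nat 1))
    · intro k g
      unfold I
      rw [Real.ediam_Icc]
      apply ENNReal.ofReal_le_ofReal
      apply le_of_eq; ring
    · intro k y hy
      have := hCk (k + 1) hy
      simp only [hCs, Set.mem_iUnion] at this
      obtain ⟨g, hg, hyg⟩ := this
      exact Set.mem_iUnion.2 ⟨⟨g, hg⟩, hyg⟩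
    · intro k
      rw [Fintype.card_coe]
      change ((Gs (k + 1)).card : ℝ) * (1 / (Ds (k + 1) : ℝ)) ^ (2 / 3 : ℝ) ≤ 1
      have hDp : (0 : ℝ) < Ds (k + 1) := by exact_mod_cast (hS (k + 1)).Dpos
      have hcc : ((Gs (k + 1)).card : ℝ) ^ 3 ≤ (Ds (k + 1) : ℝ) ^ 2 := by exact_mod_cast (hR k).cardle
      refine le_of_pow_le_pow_left₀ (n := 3) (by norm_num) (by norm_num) ?_
      have e : ((1 / (Ds (k + 1) : ℝ)) ^ (2 / 3 : ℝ)) ^ 3 = (1 / (Ds (k + 1) : ℝ)) ^ 2 := by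
        rw [← Real.rpow_natCast, ← Real.rpow_mul (by positivity), ← Real.rpow_natCast]
        norm_num
      rw [mul_pow, e, one_pow, one_div_pow, mul_one_div, div_le_one (by positivity)]
      exact hcc
  · intro B hB
    exact null_scaled (by norm_num : (0 : ℝ) ≤ 4) Ds Gs Cs hS hanti hcpt hH B hB

theorem case_one : ∃ C : Set ℝ, C ⊆ Set.Icc 1 2 ∧ C.Nonempty ∧ IsCompact C ∧
    IsNowhereDense C ∧ Perfect C ∧ dimH C = 1 ∧ volume C ≠ 0 := by
  have hcount : (Set.range ((↑) : ℚ → ℝ)).Countable := Set.countable_range _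
  set A : Set ℝ := Set.Icc 1 2 \ Set.range ((↑) : ℚ → ℝ) with hA
  have hAm : MeasurableSet A := measurableSet_Icc.diff hcount.measurableSet
  have hAv : 0 < volume A := by
    rw [hA, measure_sdiff_null (hcount.measure_zero volume), Real.volume_Icc]
    norm_num
  obtain ⟨Kc, hKA, hKc, hKv⟩ := hAm.exists_lt_isCompact hAv
  obtain ⟨V, D, hV, hD, hKVD⟩ := exists_countable_union_perfect_of_isClosed hKc.isClosed
  have hDK : D ⊆ Kc := by rw [hKVD]; exact Set.subset_union_right
  have hDv : volume D ≠ 0 := by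
    intro h0
    have : volume Kc ≤ volume V + volume D := by rw [hKVD]; exact measure_union_le _ _
    rw [hV.measure_zero, h0, add_zero] at this
    exact absurd hKv (not_lt.2 this)
  refine ⟨D, (hDK.trans hKA).trans Set.sdiff_subset, ?_, hKc.of_isClosed_subset hD.closed hDK, ?_, hD,
    vol_pos_dimH hDv, hDv⟩
  · by_contra h
    rw [Set.not_nonempty_iff_eq_empty] at h
    simp [h] at hDv
  · rw [hD.closed.isNowhereDense_iff, Set.eq_empty_iff_forall_notMem]
    intro x hx
    obtain ⟨q, hq⟩ := (Rat.denseRange_cast (𝕜 := ℝ)).exists_mem_open isOpen_interior ⟨x, hx⟩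
    exact (hKA (hDK (interior_subset hq))).2 ⟨q, rfl⟩

theorem final (s : ℝ) (hs₁ : 2 / 3 < s) (hs₂ : s ≤ 1) :
    ∃ C : Set ℝ, C ⊆ Set.Icc 1 2 ∧ C.Nonempty ∧ IsCompact C ∧
      IsNowhereDense C ∧ Perfect C ∧ dimH C = ENNReal.ofReal s ∧
      ∀ B S : Set ℝ, 0 < volume S →
        (∀ x ∈ S, ∃ r > (0 : ℝ), x +ᵥ (r • C : Set ℝ) ⊆ B) →
        0 < volume B := by
  rcases hs₂.eq_or_lt with h1 | h1
  · obtain ⟨C, c1, c2, c3, c4, c5, c6, c7⟩ := case_one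
    refine ⟨C, c1, c2, c3, c4, c5, by rw [c6, h1, ENNReal.ofReal_one], ?_⟩
    intro B S hS h
    obtain ⟨x, hx⟩ := nonempty_of_measure_ne_zero hS.ne'
    obtain ⟨r, hr, hB⟩ := h x hx
    refine lt_of_lt_of_le ?_ (measure_mono hB)
    rw [measure_vadd, Measure.addHaar_smul]
    refine ENNReal.mul_pos ?_ c7
    simp [hr.ne']
  · obtain ⟨C, c1, c2, c3, c4, c5⟩ := exists_C
    obtain ⟨E, e1, e2, e3, e4, e5⟩ := exists_E s (by linarith) h1
    have hdim : dimH (C ∪ E) = ENNReal.ofReal s := by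
      rw [dimH_union, e5]
      exact max_eq_right (c4.trans (ENNReal.ofReal_le_ofReal hs₁.le))
    have hcl : IsClosed (C ∪ E) := c3.closed.union e4.closed
    refine ⟨C ∪ E, Set.union_subset c1 e1, e2.mono Set.subset_union_right, c2.union e3, ?_, ⟨hcl, ?_⟩, hdim, ?_⟩
    · rw [hcl.isNowhereDense_iff]
      apply Measure.interior_eq_empty_of_null (μ := volume)
      by_contra h
      have := vol_pos_dimH h
      rw [hdim] at this
      have h2 : ENNReal.ofReal s < 1 := by rwa [ENNReal.ofReal_lt_one]
      exact h2.ne this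
    · rintro x (hx | hx)
      · exact (c3.acc x hx).mono (Filter.principal_mono.2 Set.subset_union_left)
      · exact (e4.acc x hx).mono (Filter.principal_mono.2 Set.subset_union_right)
    · intro B S hS h
      rw [pos_iff_ne_zero]
      intro hB
      have h0 := c5 B hB
      have : volume S = 0 := by
        refine measure_mono_null ?_ h0
        intro x hx
        obtain ⟨r, hr, hsub⟩ := h x hx
        refine ⟨r, hr, fun y hy => hsub ?_⟩
        exact Set.vadd_mem_vadd_set (Set.smul_mem_smul_set (Set.mem_union_left _ hy))
      exact hS.ne' this

end LP

/-- **Łaba–Pramanik theorem.** For every `s ∈ (2/3, 1]` there is a Cantor set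
`C ⊆ [1,2]` of Hausdorff dimension `s` such that whenever `S ⊆ ℝ` has positive
Lebesgue outer measure and `B` contains a scaled copy `x + r • C` of `C` around every
`x ∈ S`, the set `B` also has positive Lebesgue outer measure. -/
theorem laba_pramanik (s : ℝ) (hs₁ : 2 / 3 < s) (hs₂ : s ≤ 1) :
    ∃ C : Set ℝ, C ⊆ Set.Icc 1 2 ∧ C.Nonempty ∧ IsCompact C ∧
      IsNowhereDense C ∧ Perfect C ∧ dimH C = ENNReal.ofReal s ∧
      ∀ B S : Set ℝ, 0 < volume S →
        (∀ x ∈ S, ∃ r > (0 : ℝ), x +ᵥ (r • C : Set ℝ) ⊆ B) →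
        0 < volume B := by
  exact LP.final s hs₁ hs₂
end

section
/- For every s ∈ (0, 1) there exist a Cantor set C ⊆ ℝ of Hausdorff dimension s and a Borel set B ⊆ ℝ of Hausdorff dimension (s + 1)/2 such that for every x ∈ ℝ there exists r > 0 with x + r • C ⊆ B. (Máthé's theorem.) -/
open MeasureTheory Filter
open scoped ENNReal Pointwise NNReal

/-- exponent sequence -/
noncomputable def aa (s : ℝ) : ℕ → ℕ
  | 0 => 2
  | n + 1 => 2 * aa s n + 2 * ⌊(1 - s) / 2 * (((n : ℝ) + 4) * aa s n)⌋₊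
      + ⌊s * (((n : ℝ) + 4) * aa s n)⌋₊

noncomputable def ll (s : ℝ) (n : ℕ) : ℕ := ⌊(1 - s) / 2 * (((n : ℝ) + 4) * aa s n)⌋₊
noncomputable def pp (s : ℝ) (n : ℕ) : ℕ := ⌊s * (((n : ℝ) + 4) * aa s n)⌋₊

lemma aa_succ (s : ℝ) (n : ℕ) : aa s (n + 1) = 2 * aa s n + 2 * ll s n + pp s n := rfl

lemma two_le_aa (s : ℝ) (n : ℕ) : 2 ≤ aa s n := by
  induction n with
  | zero => exact le_refl 2
  | succ n ih => rw [aa_succ]; omega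

lemma aa_growth (s : ℝ) (n : ℕ) : aa s n + 1 ≤ aa s (n + 1) := by
  have := two_le_aa s n
  rw [aa_succ]; omega

lemma le_aa (s : ℝ) (n : ℕ) : n ≤ aa s n := by
  induction n with
  | zero => simp
  | succ n ih => have := aa_growth s n; omega

noncomputable def DD (s : ℝ) (n : ℕ) : ℕ := 2 ^ aa s n
noncomputable def LL (s : ℝ) (n : ℕ) : ℕ := 2 ^ ll s n
noncomputable def PP (s : ℝ) (n : ℕ) : ℕ := 2 ^ pp s n
noncomputable def QQ (s : ℝ) : ℕ → ℕ
  | 0 => 1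
  | n + 1 => QQ s n * PP s n

lemma DD_succ (s : ℝ) (n : ℕ) : DD s (n + 1) = DD s n ^ 2 * LL s n ^ 2 * PP s n := by
  simp only [DD, LL, PP, aa_succ, ← pow_mul, ← pow_add]
  congr 1; ring

lemma LL_pos (s : ℝ) (n : ℕ) : 1 ≤ LL s n := Nat.one_le_two_pow
lemma PP_pos (s : ℝ) (n : ℕ) : 1 ≤ PP s n := Nat.one_le_two_pow
lemma four_le_DD (s : ℝ) (n : ℕ) : 4 ≤ DD s n := by
  have := Nat.pow_le_pow_right (n := 2) (by norm_num) (two_le_aa s n)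
  simpa [DD] using this
lemma QQ_pos (s : ℝ) (n : ℕ) : 1 ≤ QQ s n := by
  induction n with
  | zero => exact le_refl 1
  | succ n ih => exact Nat.mul_pos ih (PP_pos s n)
lemma DD_double (s : ℝ) (n : ℕ) : 2 * DD s n ≤ DD s (n + 1) := by
  have := Nat.pow_le_pow_right (n := 2) (by norm_num) (aa_growth s n)
  rw [pow_succ] at this
  simp only [DD]; omega

lemma DD_tendsto (s : ℝ) : Tendsto (fun n => (DD s n : ℝ)) atTop atTop := by
  refine tendsto_natCast_atTop_atTop.comp ?_
  refine tendsto_atTop_mono (fun n => ?_) tendsto_id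
  exact (le_aa s n).trans (Nat.lt_two_pow_self).le

lemma eventually_lin (e K : ℝ) (he : 0 < e) : ∀ᶠ n : ℕ in atTop, K ≤ e * ((n : ℝ) + 4) := by
  filter_upwards [eventually_ge_atTop ⌈K / e⌉₊] with n hn
  have h1 : K / e ≤ n := (Nat.le_ceil _).trans (by exact_mod_cast hn)
  rw [div_le_iff₀ he] at h1
  nlinarith

lemma floors (s : ℝ) (hs₀ : 0 < s) (hs₁ : s < 1) (n : ℕ) :
    (pp s n : ℝ) ≤ s * (((n : ℝ) + 4) * aa s n) ∧
    s * (((n : ℝ) + 4) * aa s n) < pp s n + 1 ∧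
    (ll s n : ℝ) ≤ (1 - s) / 2 * (((n : ℝ) + 4) * aa s n) ∧
    (1 - s) / 2 * (((n : ℝ) + 4) * aa s n) < ll s n + 1 ∧
    (2 : ℝ) ≤ aa s n ∧ (aa s (n + 1) : ℝ) = 2 * aa s n + 2 * ll s n + pp s n := by
  have h0 : (0 : ℝ) ≤ ((n : ℝ) + 4) * aa s n := by positivity
  refine ⟨Nat.floor_le (by positivity), Nat.lt_floor_add_one _,
    Nat.floor_le (mul_nonneg (by linarith) h0), Nat.lt_floor_add_one _,
    by exact_mod_cast two_le_aa s n, by rw [aa_succ]; push_cast; ring⟩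

lemma pow_rpow (a : ℕ) (t : ℝ) : ((2 : ℝ) ^ a) ^ t = (2 : ℝ) ^ ((a : ℝ) * t) := by
  rw [Real.rpow_mul (by norm_num), Real.rpow_natCast]

lemma low_bound (s : ℝ) (hs₀ : 0 < s) (hs₁ : s < 1) (t : ℝ) (ht0 : 0 < t) (ht : t < s) :
    ∀ᶠ n : ℕ in atTop, (DD s (n + 1) : ℝ) ^ t ≤ PP s n := by
  filter_upwards [eventually_lin (s - t) 3 (by linarith)] with n hn
  obtain ⟨h1, h2, h3, h4, h5, h6⟩ := floors s hs₀ hs₁ n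
  simp only [DD, PP]
  push_cast
  rw [pow_rpow, ← Real.rpow_natCast 2 (pp s n)]
  apply Real.rpow_le_rpow_of_exponent_le (by norm_num)
  have h7 : (aa s (n + 1) : ℝ) ≤ ((n : ℝ) + 4) * aa s n + 2 * aa s n := by linarith
  have h8 : 3 * (aa s n : ℝ) ≤ (s - t) * ((n : ℝ) + 4) * aa s n :=
    mul_le_mul_of_nonneg_right hn (by linarith)
  have h9 := mul_le_mul_of_nonneg_right h7 ht0.le
  nlinarith

lemma up_aux (s : ℝ) (hs₀ : 0 < s) (hs₁ : s < 1) (n : ℕ) :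
    ((n : ℝ) + 4) * aa s n ≤ aa s (n + 1) := by
  obtain ⟨h1, h2, h3, h4, h5, h6⟩ := floors s hs₀ hs₁ n
  linarith

lemma upC_bound (s : ℝ) (hs₀ : 0 < s) (hs₁ : s < 1) (t : ℝ) (ht : s < t) :
    ∀ᶠ n : ℕ in atTop, ((DD s n * PP s n : ℕ) : ℝ) ≤ (DD s (n + 1) : ℝ) ^ t := by
  filter_upwards [eventually_lin (t - s) 1 (by linarith)] with n hn
  obtain ⟨h1, h2, h3, h4, h5, h6⟩ := floors s hs₀ hs₁ n
  simp only [DD, PP]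
  push_cast
  rw [pow_rpow, ← pow_add, ← Real.rpow_natCast 2 (_ + _)]
  apply Real.rpow_le_rpow_of_exponent_le (by norm_num)
  push_cast
  have h7 := up_aux s hs₀ hs₁ n
  have h8 : 1 * (aa s n : ℝ) ≤ (t - s) * ((n : ℝ) + 4) * aa s n :=
    mul_le_mul_of_nonneg_right hn (by linarith)
  have h9 := mul_le_mul_of_nonneg_right h7 (show 0 ≤ t by linarith)
  nlinarith

lemma upB_bound (s : ℝ) (hs₀ : 0 < s) (hs₁ : s < 1) (t : ℝ) (ht : (s + 1) / 2 < t) :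
    ∀ᶠ n : ℕ in atTop,
      ((DD s n ^ 2 * LL s n * PP s n : ℕ) : ℝ) ≤ (DD s (n + 1) : ℝ) ^ t := by
  filter_upwards [eventually_lin (t - (s + 1) / 2) 2 (by linarith)] with n hn
  obtain ⟨h1, h2, h3, h4, h5, h6⟩ := floors s hs₀ hs₁ n
  simp only [DD, PP, LL]
  push_cast
  rw [pow_rpow, ← pow_mul, ← pow_add, ← pow_add, ← Real.rpow_natCast 2 (_ + _)]
  apply Real.rpow_le_rpow_of_exponent_le (by norm_num)
  push_cast
  have h7 := up_aux s hs₀ hs₁ n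
  have h8 : 2 * (aa s n : ℝ) ≤ (t - (s + 1) / 2) * ((n : ℝ) + 4) * aa s n :=
    mul_le_mul_of_nonneg_right hn (by linarith)
  have h9 := mul_le_mul_of_nonneg_right h7 (show 0 ≤ t by linarith)
  nlinarith

/-- monotone sequences with small steps converge -/
lemma exists_limit (s : ℝ) (u : ℕ → ℝ) (h1 : ∀ n, u n ≤ u (n + 1))
    (h2 : ∀ n, u (n + 1) ≤ u n + 1 / DD s n) :
    ∃ v, ∀ n, u n ≤ v ∧ v ≤ u n + 2 / DD s n := by
  have hm : Monotone u := monotone_nat_of_le_succ h1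
  have ha : Antitone (fun n => u n + 2 / (DD s n : ℝ)) := by
    apply antitone_nat_of_succ_le
    intro n
    have hd : (4 : ℝ) ≤ DD s n := by exact_mod_cast four_le_DD s n
    have hdd : 2 * (DD s n : ℝ) ≤ DD s (n + 1) := by exact_mod_cast DD_double s n
    have : 2 / (DD s (n + 1) : ℝ) ≤ 1 / DD s n := by
      rw [div_le_div_iff₀ (by linarith) (by linarith)]; linarith
    have h3 : 2 / (DD s n : ℝ) = 1 / DD s n + 1 / DD s n := by ring
    have := h2 n
    linarith
  have hle : ∀ m n, u m ≤ u n + 2 / (DD s n : ℝ) := by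
    intro m n
    have e1 := hm (le_max_left m n)
    have e2 := ha (le_max_right m n)
    have e3 : (0 : ℝ) ≤ 2 / (DD s (max m n) : ℝ) := by positivity
    simp only at e2
    linarith
  have hbd : BddAbove (Set.range u) := by
    refine ⟨u 0 + 2 / (DD s 0 : ℝ), ?_⟩
    rintro _ ⟨m, rfl⟩
    exact hle m 0
  exact ⟨⨆ n, u n, fun n => ⟨le_ciSup hbd n, ciSup_le fun m => hle m n⟩⟩

/-- upper bound for the dimension from lattice-like covers -/
lemma dimH_le_of_lattice (S : Set ℝ) (t : ℝ) (ht : 0 < t) (R K : ℕ) (N : ℕ → ℕ) (θ : ℕ → ℝ)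
    (D : ℕ → ℝ) (hD1 : ∀ n, 1 ≤ D n)
    (hD : Tendsto D atTop atTop) (hN : ∀ n, 1 ≤ N n) (hθ0 : ∀ n, 0 ≤ θ n) (hθ1 : ∀ n, θ n ≤ 1)
    (hR : ∀ x ∈ S, |x| ≤ R)
    (hS : ∀ x ∈ S, ∀ n, ∃ k : ℤ, |x - (k + θ n) / N n| ≤ K / D n)
    (hb : ∀ᶠ n in atTop, (N n : ℝ) ≤ D n ^ t) : dimH S ≤ ENNReal.ofReal t := by
  have key : μH[t] S ≤ ENNReal.ofReal ((3 * (R + K + 1)) * (2 * K) ^ t) := by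
    let W : ℕ → ℤ := fun n => N n * (R + K + 1)
    have hW : ∀ n, 0 ≤ W n := fun n => by positivity
    refine (Measure.hausdorffMeasure_le_liminf_sum (β := ℕ)
      (ι := fun n => (Finset.Icc (-(W n)) (W n) : Finset ℤ)) t S (l := atTop)
      (fun n => ENNReal.ofReal (2 * K / D n)) ?_
      (fun n k => Metric.closedBall (((k : ℤ) + θ n) / N n) (K / D n)) ?_ ?_).trans ?_
    · rw [← ENNReal.ofReal_zero]
      exact ENNReal.tendsto_ofReal (hD.const_div_atTop _)
    · refine Eventually.of_forall fun n k => ?_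
      rw [Real.closedBall_eq_Icc, Real.ediam_Icc]
      apply ENNReal.ofReal_le_ofReal
      apply le_of_eq; ring
    · refine Eventually.of_forall fun n x hx => ?_
      obtain ⟨k, hk⟩ := hS x hx n
      have hNn : (1 : ℝ) ≤ N n := by exact_mod_cast hN n
      have hmem : k ∈ Finset.Icc (-(W n)) (W n) := by
        have h1 := hR x hx
        have h2 : (K : ℝ) / D n ≤ K := div_le_self (by positivity) (hD1 n)
        have h3 : |(k + θ n) / N n| ≤ R + K := by
          calc |(k + θ n) / N n| = |x - (x - (k + θ n) / N n)| := by congr 1; ring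
            _ ≤ |x| + |x - (k + θ n) / N n| := abs_sub _ _
            _ ≤ _ := by linarith
        rw [abs_div, abs_of_pos (show (0 : ℝ) < N n by linarith),
          div_le_iff₀ (by linarith), abs_le] at h3
        have := hθ0 n
        have := hθ1 n
        have hWr : ((W n : ℤ) : ℝ) = N n * (R + K + 1) := by simp [W]
        rw [Finset.mem_Icc]
        constructor
        · have : ((-(W n) : ℤ) : ℝ) ≤ k := by
            push_cast; rw [hWr]; nlinarith
          exact_mod_cast this
        · have : (k : ℝ) ≤ (W n : ℤ) := by
            rw [hWr]; nlinarith
          exact_mod_cast this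
      rw [Set.mem_iUnion]
      exact ⟨⟨k, hmem⟩, by rw [Metric.mem_closedBall, Real.dist_eq]; exact hk⟩
    · refine liminf_le_of_frequently_le' (Eventually.frequently ?_)
      filter_upwards [hb] with n hn
      have hDn := hD1 n
      have hNn : (1 : ℝ) ≤ N n := by exact_mod_cast hN n
      have e1 : ∀ k : (Finset.Icc (-(W n)) (W n) : Finset ℤ),
          Metric.ediam (Metric.closedBall (((k : ℤ) + θ n) / N n) ((K : ℝ) / D n)) ^ t
            ≤ ENNReal.ofReal ((2 * K / D n) ^ t) := by
        intro k
        rw [← ENNReal.ofReal_rpow_of_nonneg (by positivity) ht.le]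
        gcongr
        rw [Real.closedBall_eq_Icc, Real.ediam_Icc]
        apply ENNReal.ofReal_le_ofReal
        apply le_of_eq; ring
      refine (Finset.sum_le_sum fun k _ => e1 k).trans ?_
      rw [Finset.sum_const, nsmul_eq_mul, Finset.card_univ, Fintype.card_coe, Int.card_Icc]
      rw [← ENNReal.ofReal_natCast, ← ENNReal.ofReal_mul (by positivity)]
      apply ENNReal.ofReal_le_ofReal
      have hc : (((W n + 1 - -(W n)).toNat : ℕ) : ℝ) ≤ 3 * (R + K + 1) * N n := by
        have : (((W n + 1 - -(W n)).toNat : ℤ) : ℝ) = 2 * (N n * (R + K + 1)) + 1 := by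
          rw [Int.toNat_of_nonneg (by have := hW n; omega)]
          simp [W]; ring
        rw [show (((W n + 1 - -(W n)).toNat : ℕ) : ℝ) = (((W n + 1 - -(W n)).toNat : ℤ) : ℝ) by
          norm_cast, this]
        have hr : (0 : ℝ) ≤ R := by positivity
        have hk : (0 : ℝ) ≤ K := by positivity
        nlinarith
      have hDt : 0 < D n ^ t := by positivity
      calc _ ≤ 3 * (R + K + 1) * N n * (2 * K / D n) ^ t := by gcongr
        _ = 3 * (R + K + 1) * (2 * K) ^ t * (N n / D n ^ t) := by
          rw [Real.div_rpow (by positivity) (by positivity)]; ring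
        _ ≤ 3 * (R + K + 1) * (2 * K) ^ t * 1 := by
          gcongr
          rw [div_le_one hDt]; exact hn
        _ = _ := by ring
  have : dimH S ≤ (t.toNNReal : ℝ≥0∞) := by
    apply dimH_le_of_hausdorffMeasure_ne_top
    rw [Real.coe_toNNReal _ ht.le]
    exact (key.trans_lt ENNReal.ofReal_lt_top).ne
  exact this

noncomputable def dig (s y : ℝ) (n : ℕ) : ℕ := ⌊y * QQ s (n + 1)⌋₊ % PP s n

/-- partial sums of the Cantor parametrization -/
noncomputable def cs (s y : ℝ) : ℕ → ℝ
  | 0 => 0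
  | n + 1 => cs s y n + ((dig s y n : ℝ) + 1 / LL s n) / (DD s n * PP s n)

lemma dig_lt (s y : ℝ) (n : ℕ) : dig s y n + 1 ≤ PP s n := Nat.mod_lt _ (PP_pos s n)

lemma cs_mono (s y : ℝ) (n : ℕ) : cs s y n ≤ cs s y (n + 1) := by
  simp only [cs]
  have : 0 ≤ ((dig s y n : ℝ) + 1 / LL s n) / (DD s n * PP s n) := by positivity
  linarith

lemma cs_step (s y : ℝ) (n : ℕ) : cs s y (n + 1) ≤ cs s y n + 1 / DD s n := by
  simp only [cs]
  have h1 : (dig s y n : ℝ) + 1 ≤ PP s n := by exact_mod_cast dig_lt s y n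
  have h2 : (1 : ℝ) ≤ LL s n := by exact_mod_cast LL_pos s n
  have h3 : (1 : ℝ) ≤ PP s n := by exact_mod_cast PP_pos s n
  have h4 : (4 : ℝ) ≤ DD s n := by exact_mod_cast four_le_DD s n
  have h5 : 1 / (LL s n : ℝ) ≤ 1 := by rw [div_le_one (by linarith)]; exact h2
  have : ((dig s y n : ℝ) + 1 / LL s n) / (DD s n * PP s n) ≤ 1 / DD s n := by
    rw [div_le_div_iff₀ (by positivity) (by positivity)]
    nlinarith
  linarith

noncomputable def gg (s y : ℝ) : ℝ :=
  (exists_limit s (cs s y) (cs_mono s y) (cs_step s y)).choose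

lemma gg_spec (s y : ℝ) (n : ℕ) : cs s y n ≤ gg s y ∧ gg s y ≤ cs s y n + 2 / DD s n :=
  (exists_limit s (cs s y) (cs_mono s y) (cs_step s y)).choose_spec n

lemma cs_lattice (s y : ℝ) (n : ℕ) : ∃ k : ℕ, cs s y n = k / DD s n := by
  induction n with
  | zero => exact ⟨0, by simp [cs]⟩
  | succ n ih =>
    obtain ⟨k, hk⟩ := ih
    refine ⟨(k * PP s n + dig s y n) * LL s n ^ 2 * DD s n + LL s n * DD s n, ?_⟩
    have h2 : (LL s n : ℝ) ≠ 0 := by have := LL_pos s n; positivity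
    have h3 : (PP s n : ℝ) ≠ 0 := by have := PP_pos s n; positivity
    have h4 : (DD s n : ℝ) ≠ 0 := by have := four_le_DD s n; positivity
    simp only [cs, hk, DD_succ]
    push_cast
    field_simp
    ring

lemma cs_lattice' (s y : ℝ) (n : ℕ) :
    ∃ k : ℕ, cs s y (n + 1) = ((k : ℝ) + 1 / LL s n) / (DD s n * PP s n) := by
  obtain ⟨k, hk⟩ := cs_lattice s y n
  refine ⟨k * PP s n + dig s y n, ?_⟩
  have h2 : (LL s n : ℝ) ≠ 0 := by have := LL_pos s n; positivity
  have h3 : (PP s n : ℝ) ≠ 0 := by have := PP_pos s n; positivity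
  have h4 : (DD s n : ℝ) ≠ 0 := by have := four_le_DD s n; positivity
  simp only [cs, hk]
  push_cast
  field_simp
  ring

def GG (s : ℝ) : Set ℝ := gg s '' Set.Ico 0 1

lemma gg_mem (s y : ℝ) : gg s y ∈ Set.Icc (0 : ℝ) 1 := by
  have := gg_spec s y 0
  have h4 : (4 : ℝ) ≤ DD s 0 := by exact_mod_cast four_le_DD s 0
  have h5 : 2 / (DD s 0 : ℝ) ≤ 1 := by rw [div_le_one (by linarith)]; linarith
  simp only [cs] at this
  constructor <;> linarith

/-- The set of points within `ρ` of the shifted lattice `(ℤ + θ)/N` is closed. -/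
lemma isClosed_lattice (N θ ρ : ℝ) (hN : 0 < N) :
    IsClosed {x : ℝ | ∃ k : ℤ, |x - (k + θ) / N| ≤ ρ} := by
  have h : {x : ℝ | ∃ k : ℤ, |x - (k + θ) / N| ≤ ρ} =
      ⋃ k : ℤ, Metric.closedBall (((k : ℝ) + θ) / N) ρ := by
    ext x; simp [Real.dist_eq]
  rw [h]
  apply LocallyFinite.isClosed_iUnion _ (fun _ => Metric.isClosed_closedBall)
  intro x
  refine ⟨Metric.ball x 1, Metric.ball_mem_nhds x one_pos, ?_⟩
  apply (Set.finite_Icc (⌊N * (x - 1 - |ρ|) - θ⌋) (⌈N * (x + 1 + |ρ|) - θ⌉)).subset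
  rintro k ⟨z, hz1, hz2⟩
  rw [Metric.mem_closedBall, Real.dist_eq, abs_le] at hz1
  rw [Metric.mem_ball, Real.dist_eq, abs_lt] at hz2
  have hr := le_abs_self ρ
  have e1 : x - 1 - |ρ| ≤ (k + θ) / N := by linarith
  have e2 : (k + θ) / N ≤ x + 1 + |ρ| := by linarith
  rw [le_div_iff₀ hN] at e1
  rw [div_le_iff₀ hN] at e2
  constructor
  · have : ((⌊N * (x - 1 - |ρ|) - θ⌋ : ℤ) : ℝ) ≤ k := (Int.floor_le _).trans (by linarith)
    exact_mod_cast this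
  · have : (k : ℝ) ≤ (⌈N * (x + 1 + |ρ|) - θ⌉ : ℤ) := le_trans (by linarith) (Int.le_ceil _)
    exact_mod_cast this

lemma closure_GG_Icc (s : ℝ) : closure (GG s) ⊆ Set.Icc 0 1 := by
  apply closure_minimal _ isClosed_Icc
  rintro _ ⟨y, _, rfl⟩
  exact gg_mem s y

lemma closure_GG_lattice (s : ℝ) (n : ℕ) (c : ℝ) (hc : c ∈ closure (GG s)) :
    ∃ k : ℤ, |c - (k + 1 / LL s n) / ((DD s n * PP s n : ℕ) : ℝ)| ≤
      ((2 : ℕ) : ℝ) / DD s (n + 1) := by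
  have h3 := PP_pos s n
  have h4 := four_le_DD s n
  have := closure_minimal (t := {x : ℝ | ∃ k : ℤ, |x - (k + 1 / (LL s n : ℝ)) /
    ((DD s n * PP s n : ℕ) : ℝ)| ≤ ((2 : ℕ) : ℝ) / DD s (n + 1)}) (s := GG s) ?_
    (isClosed_lattice _ _ _ (by positivity))
  · exact this hc
  · rintro _ ⟨y, _, rfl⟩
    obtain ⟨k, hk⟩ := cs_lattice' s y n
    obtain ⟨h1, h2⟩ := gg_spec s y (n + 1)
    refine ⟨k, ?_⟩
    push_cast
    rw [← hk, abs_le]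
    constructor
    · have : (0 : ℝ) ≤ 2 / DD s (n + 1) := by positivity
      linarith
    · linarith

lemma dimH_closure_GG_le (s : ℝ) (hs₀ : 0 < s) (hs₁ : s < 1) :
    dimH (closure (GG s)) ≤ ENNReal.ofReal s := by
  have key : ∀ t : ℝ, s < t → dimH (closure (GG s)) ≤ ENNReal.ofReal t := by
    intro t ht
    refine dimH_le_of_lattice _ t (by linarith) 1 2 (fun n => DD s n * PP s n)
      (fun n => 1 / LL s n) (fun n => DD s (n + 1)) ?_ ?_ ?_ ?_ ?_ ?_ ?_ ?_
    · intro n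
      have : (4 : ℝ) ≤ DD s (n + 1) := by exact_mod_cast four_le_DD s (n + 1)
      linarith
    · exact (DD_tendsto s).comp (tendsto_add_atTop_nat 1)
    · intro n
      have h3 := PP_pos s n
      have h4 := four_le_DD s n
      exact Nat.mul_pos (by omega) h3
    · intro n; positivity
    · intro n
      have h2 : (1 : ℝ) ≤ LL s n := by exact_mod_cast LL_pos s n
      rw [div_le_one (by linarith)]; exact h2
    · intro x hx
      have := closure_GG_Icc s hx
      rw [abs_of_nonneg this.1]; simpa using this.2
    · intro x hx n
      exact closure_GG_lattice s n x hx
    · exact upC_bound s hs₀ hs₁ t ht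
  refine ENNReal.le_of_forall_pos_le_add fun ε hε _ => ?_
  have := key (s + ε) (by have : (0 : ℝ) < ε := hε; linarith)
  rwa [ENNReal.ofReal_add hs₀.le ε.coe_nonneg, ENNReal.ofReal_coe_nnreal] at this

/-! ### lower bound -/

lemma QQ_low (s : ℝ) (hs₀ : 0 < s) (hs₁ : s < 1) (t : ℝ) (ht0 : 0 < t) (ht : t < s) :
    ∃ K : ℝ, 0 < K ∧ ∀ n, (DD s n : ℝ) ^ t ≤ K * QQ s n := by
  obtain ⟨n₀, hn₀⟩ := eventually_atTop.1 (low_bound s hs₀ hs₁ t ht0 ht)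
  refine ⟨(DD s n₀ : ℝ) ^ t + 1, by positivity, fun n => ?_⟩
  have hq : (1 : ℝ) ≤ QQ s n := by exact_mod_cast QQ_pos s n
  have hpos : 0 ≤ (DD s n₀ : ℝ) ^ t := by positivity
  rcases le_or_gt n n₀ with h | h
  · have hm : Monotone (DD s) := monotone_nat_of_le_succ fun k => by
      have := DD_double s k; omega
    have : (DD s n : ℝ) ^ t ≤ (DD s n₀ : ℝ) ^ t := by
      gcongr
      exact hm h
    nlinarith
  · obtain ⟨m, rfl⟩ : ∃ m, n = m + 1 := ⟨n - 1, by omega⟩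
    have h1 := hn₀ m (by omega)
    have hq' : (1 : ℝ) ≤ QQ s m := by exact_mod_cast QQ_pos s m
    have h3 : (1 : ℝ) ≤ PP s m := by exact_mod_cast PP_pos s m
    have h2 : (PP s m : ℝ) ≤ QQ s (m + 1) := by
      simp only [QQ]; push_cast; nlinarith
    nlinarith

lemma QQ_tendsto (s : ℝ) (hs₀ : 0 < s) (hs₁ : s < 1) :
    Tendsto (fun n => (QQ s n : ℝ)) atTop atTop := by
  obtain ⟨K, hK, h⟩ := QQ_low s hs₀ hs₁ (s / 2) (by linarith) (by linarith)
  have h1 : Tendsto (fun n => (DD s n : ℝ) ^ (s / 2) / K) atTop atTop :=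
    ((tendsto_rpow_atTop (by linarith)).comp (DD_tendsto s)).atTop_div_const hK
  refine tendsto_atTop_mono (fun n => ?_) h1
  rw [div_le_iff₀ hK, mul_comm]; exact h n

lemma floor_QQ (s y : ℝ) (n : ℕ) :
    ⌊y * QQ s n⌋₊ = ⌊y * QQ s (n + 1)⌋₊ / PP s n := by
  rw [← Nat.floor_div_natCast]
  congr 1
  have h3 : (PP s n : ℝ) ≠ 0 := by have := PP_pos s n; positivity
  simp only [QQ]; push_cast
  field_simp

lemma floor_eq_of_le (s y y' : ℝ) (m n : ℕ) (hmn : m ≤ n)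
    (h : ⌊y * QQ s n⌋₊ = ⌊y' * QQ s n⌋₊) : ⌊y * QQ s m⌋₊ = ⌊y' * QQ s m⌋₊ := by
  induction n, hmn using Nat.le_induction with
  | base => exact h
  | succ n hmn ih => exact ih (by rw [floor_QQ, h, ← floor_QQ])

lemma cs_eq (s y y' : ℝ) (n : ℕ)
    (h : ⌊y * QQ s n⌋₊ = ⌊y' * QQ s n⌋₊) : cs s y n = cs s y' n := by
  induction n with
  | zero => rfl
  | succ n ih =>
    simp only [cs, dig, h]
    rw [ih (floor_eq_of_le s y y' n (n + 1) (by omega) h)]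

/-- the separation statement -/
lemma separation (s : ℝ) (hs₀ : 0 < s) (hs₁ : s < 1) (y y' : ℝ) (hy0 : 0 ≤ y) (hyy : y < y')
    (hy1 : y' < 1) : ∃ m e : ℕ, 1 ≤ e ∧ e ≤ PP s m ∧
      y' - y ≤ 2 * e / (QQ s m * PP s m) ∧ e / (2 * (DD s m * PP s m)) ≤ gg s y' - gg s y := by
  have hex : ∃ n, ⌊y * QQ s n⌋₊ ≠ ⌊y' * QQ s n⌋₊ := by
    obtain ⟨n, hn⟩ := ((QQ_tendsto s hs₀ hs₁).eventually_gt_atTop (1 / (y' - y))).exists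
    refine ⟨n, fun h => ?_⟩
    have h1 := Nat.lt_floor_add_one (y' * QQ s n)
    have h2 := Nat.floor_le (show 0 ≤ y * QQ s n by positivity)
    rw [h] at h2
    rw [div_lt_iff₀ (by linarith)] at hn
    nlinarith
  classical
  have hn := Nat.find_spec hex
  have hmin := fun k => Nat.find_min hex (m := k)
  set n := Nat.find hex with hndef
  have hn0 : n ≠ 0 := by
    intro h0
    rw [h0] at hn
    apply hn
    simp only [QQ, Nat.cast_one, mul_one]
    rw [Nat.floor_eq_zero.2 hy1, Nat.floor_eq_zero.2 (by linarith)]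
  obtain ⟨m, hm⟩ : ∃ m, n = m + 1 := ⟨n - 1, by omega⟩
  rw [hm] at hn
  have hF : ⌊y * QQ s m⌋₊ = ⌊y' * QQ s m⌋₊ := by
    by_contra h
    exact hmin m (by omega) h
  have hle : ⌊y * QQ s (m + 1)⌋₊ < ⌊y' * QQ s (m + 1)⌋₊ := by
    refine lt_of_le_of_ne (Nat.floor_mono ?_) hn
    gcongr
  have hd : dig s y' m < PP s m := dig_lt s y' m
  have e1 := Nat.div_add_mod ⌊y * QQ s (m + 1)⌋₊ (PP s m)
  have e2 := Nat.div_add_mod ⌊y' * QQ s (m + 1)⌋₊ (PP s m)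
  rw [← floor_QQ] at e1 e2
  rw [hF] at e1
  change _ + dig s y m = _ at e1
  change _ + dig s y' m = _ at e2
  have hdd : dig s y m < dig s y' m := by omega
  refine ⟨m, dig s y' m - dig s y m, by omega, by omega, ?_, ?_⟩
  · rw [Nat.cast_sub hdd.le]
    have h1 := Nat.lt_floor_add_one (y' * QQ s (m + 1))
    have h2 := Nat.floor_le (show 0 ≤ y * QQ s (m + 1) by positivity)
    rw [← e2] at h1
    rw [← e1] at h2
    have h3 : (QQ s (m + 1) : ℝ) = QQ s m * PP s m := by simp [QQ]
    have h4 : (0 : ℝ) < QQ s (m + 1) := by exact_mod_cast QQ_pos s (m + 1)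
    rw [← h3, le_div_iff₀ h4]
    have h5 : (dig s y m : ℝ) + 1 ≤ dig s y' m := by exact_mod_cast hdd
    push_cast at h1 h2
    nlinarith
  · rw [Nat.cast_sub hdd.le]
    have h1 := (gg_spec s y' (m + 1)).1
    have h2 := (gg_spec s y (m + 1)).2
    have h3 := cs_eq s y y' m hF
    simp only [cs] at h1 h2
    rw [h3] at h2
    have hL : (1 : ℝ) ≤ LL s m := by exact_mod_cast LL_pos s m
    have hP : (1 : ℝ) ≤ PP s m := by exact_mod_cast PP_pos s m
    have hD : (4 : ℝ) ≤ DD s m := by exact_mod_cast four_le_DD s m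
    have h5 : (dig s y m : ℝ) + 1 ≤ dig s y' m := by exact_mod_cast hdd
    have h6 : 2 / (DD s (m + 1) : ℝ) ≤ (1 / 2) / (DD s m * PP s m) := by
      rw [DD_succ]; push_cast
      rw [div_le_div_iff₀ (by positivity) (by positivity)]
      have : (4 : ℝ) * 1 ≤ DD s m * (LL s m : ℝ) ^ 2 := by
        apply mul_le_mul hD _ (by norm_num) (by positivity)
        nlinarith
      have hDP : (0 : ℝ) ≤ DD s m * PP s m := by positivity
      nlinarith
    have h7 : ((dig s y' m : ℝ) - dig s y m) / (2 * (DD s m * PP s m)) +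
        (1 / 2) / (DD s m * PP s m) ≤ ((dig s y' m : ℝ) - dig s y m) / (DD s m * PP s m) := by
      have hDP : (0 : ℝ) < DD s m * PP s m := by positivity
      have : ((dig s y' m : ℝ) - dig s y m) / (2 * (DD s m * PP s m)) =
        ((dig s y' m : ℝ) - dig s y m) / 2 / (DD s m * PP s m) := by
          field_simp
      rw [this, ← add_div]
      gcongr
      linarith
    have h8 : ((dig s y' m : ℝ) - dig s y m) / (DD s m * PP s m) =
      ((dig s y' m : ℝ) + 1 / LL s m) / (DD s m * PP s m) -
        ((dig s y m : ℝ) + 1 / LL s m) / (DD s m * PP s m) := by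
          rw [← sub_div]; congr 1; ring
    linarith

lemma gg_strictMono (s : ℝ) (hs₀ : 0 < s) (hs₁ : s < 1) : StrictMonoOn (gg s) (Set.Ico 0 1) := by
  intro y hy y' hy' h
  obtain ⟨m, e, he, _, _, h2⟩ := separation s hs₀ hs₁ y y' hy.1 h hy'.2
  have hP := PP_pos s m
  have hD := four_le_DD s m
  have : (0 : ℝ) < e / (2 * (DD s m * PP s m)) := by positivity
  linarith

lemma gg_holder (s : ℝ) (hs₀ : 0 < s) (hs₁ : s < 1) (t : ℝ) (ht0 : 0 < t) (ht : t < s) :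
    ∃ K : ℝ, 0 < K ∧ ∀ y y' : ℝ, 0 ≤ y → y < y' → y' < 1 →
      y' - y ≤ K * (gg s y' - gg s y) ^ t := by
  obtain ⟨K, hK, hQ⟩ := QQ_low s hs₀ hs₁ t ht0 ht
  refine ⟨4 * K, by positivity, fun y y' hy0 hyy hy1 => ?_⟩
  obtain ⟨m, e, he, heP, h1, h2⟩ := separation s hs₀ hs₁ y y' hy0 hyy hy1
  have hP : (1 : ℝ) ≤ PP s m := by exact_mod_cast PP_pos s m
  have hD : (4 : ℝ) ≤ DD s m := by exact_mod_cast four_le_DD s m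
  have hQp : (1 : ℝ) ≤ QQ s m := by exact_mod_cast QQ_pos s m
  have he' : (1 : ℝ) ≤ e := by exact_mod_cast he
  have heP' : (e : ℝ) ≤ PP s m := by exact_mod_cast heP
  set f : ℝ := e / PP s m with hf
  have hf0 : 0 < f := by positivity
  have hf1 : f ≤ 1 := by rw [hf, div_le_one (by linarith)]; exact heP'
  have hft : f ≤ f ^ t := by
    have := Real.rpow_le_rpow_of_exponent_ge hf0 hf1 (show t ≤ 1 by linarith)
    rwa [Real.rpow_one] at this
  have h2t : (2 : ℝ) ^ t ≤ 2 := by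
    have := Real.rpow_le_rpow_of_exponent_le (show (1 : ℝ) ≤ 2 by norm_num)
      (show t ≤ 1 by linarith)
    rwa [Real.rpow_one] at this
  have h3 : (f / (2 * DD s m)) ^ t ≤ (gg s y' - gg s y) ^ t := by
    apply Real.rpow_le_rpow (by positivity) _ ht0.le
    refine le_of_eq_of_le ?_ h2
    rw [hf]; field_simp
  have h4 : y' - y ≤ 2 * f / QQ s m := by
    refine h1.trans (le_of_eq ?_)
    rw [hf]; field_simp
  refine h4.trans (le_trans ?_ (mul_le_mul_of_nonneg_left h3 (by positivity)))
  rw [Real.div_rpow hf0.le (by positivity), Real.mul_rpow (by norm_num) (by positivity)]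
  have hDt : (0 : ℝ) < (DD s m : ℝ) ^ t := by positivity
  have h2tp : (0 : ℝ) < (2 : ℝ) ^ t := by positivity
  rw [← mul_div_assoc (4 * K), div_le_div_iff₀ (by linarith) (by positivity)]
  calc 2 * f * (2 ^ t * (DD s m : ℝ) ^ t) ≤ 2 * f ^ t * (2 * (K * QQ s m)) := by
        gcongr
        exact hQ m
    _ = 4 * K * f ^ t * QQ s m := by ring

lemma le_dimH_GG (s : ℝ) (hs₀ : 0 < s) (hs₁ : s < 1) :
    ENNReal.ofReal s ≤ dimH (GG s) := by
  have key : ∀ t : ℝ, 0 < t → t < s → ENNReal.ofReal t ≤ dimH (GG s) := by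
    intro t ht0 ht
    obtain ⟨K, hK, hg⟩ := gg_holder s hs₀ hs₁ t ht0 ht
    have hinj := (gg_strictMono s hs₀ hs₁).injOn
    let F := Function.invFunOn (gg s) (Set.Ico 0 1)
    have hF : ∀ y ∈ Set.Ico (0 : ℝ) 1, F (gg s y) = y := fun y hy => hinj.leftInvOn_invFunOn hy
    have himg : F '' (GG s) = Set.Ico 0 1 := by
      ext z
      constructor
      · rintro ⟨_, ⟨y, hy, rfl⟩, rfl⟩
        rw [hF y hy]; exact hy
      · intro hz
        exact ⟨gg s z, ⟨z, hz, rfl⟩, hF z hz⟩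
    have hH : HolderOnWith K.toNNReal t.toNNReal F (GG s) := by
      have main : ∀ y y' : ℝ, 0 ≤ y → y < y' → y' < 1 →
          edist y y' ≤ (K.toNNReal : ℝ≥0∞) * edist (gg s y) (gg s y') ^ (t.toNNReal : ℝ) := by
        intro y y' h0 hyy h1
        have h := hg y y' h0 hyy h1
        have hlt := gg_strictMono s hs₀ hs₁ ⟨h0, by linarith⟩ ⟨by linarith, h1⟩ hyy
        rw [edist_comm, edist_comm (gg s y), edist_dist, edist_dist, Real.dist_eq, Real.dist_eq,
          abs_of_pos (by linarith), abs_of_pos (by linarith), Real.coe_toNNReal _ ht0.le,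
          ENNReal.ofReal_rpow_of_nonneg (by linarith) ht0.le]
        change _ ≤ ENNReal.ofReal K * _
        rw [← ENNReal.ofReal_mul hK.le]
        exact ENNReal.ofReal_le_ofReal h
      rintro _ ⟨y, hy, rfl⟩ _ ⟨y', hy', rfl⟩
      rw [hF y hy, hF y' hy']
      rcases lt_trichotomy y y' with h | h | h
      · exact main y y' hy.1 h hy'.2
      · subst h; simp
      · rw [edist_comm, edist_comm (gg s y)]
        exact main y' y hy'.1 h hy.2
    have h1 := hH.dimH_image_le (Real.toNNReal_pos.2 ht0)
    rw [himg, Real.dimH_of_nonempty_interior (by rw [interior_Ico]; exact ⟨1 / 2, by norm_num⟩)] at h1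
    simp only [Module.finrank_self, Nat.cast_one] at h1
    rw [ENNReal.le_div_iff_mul_le (Or.inl (by simpa using ht0)) (Or.inl (by simp)), one_mul] at h1
    exact h1
  refine le_of_forall_lt fun c hc => ?_
  have hctop : c ≠ ⊤ := (hc.trans ENNReal.ofReal_lt_top).ne
  have hc' : c.toReal < s := by
    rw [← ENNReal.ofReal_toReal hctop] at hc
    exact (ENNReal.ofReal_lt_ofReal_iff hs₀).1 hc
  have hc0 : 0 ≤ c.toReal := ENNReal.toReal_nonneg
  refine lt_of_lt_of_le ?_ (key ((c.toReal + s) / 2) (by linarith) (by linarith))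
  calc c = ENNReal.ofReal c.toReal := (ENNReal.ofReal_toReal hctop).symm
    _ < _ := (ENNReal.ofReal_lt_ofReal_iff (by linarith)).2 (by linarith)

lemma dimH_closure_GG (s : ℝ) (hs₀ : 0 < s) (hs₁ : s < 1) :
    dimH (closure (GG s)) = ENNReal.ofReal s :=
  le_antisymm (dimH_closure_GG_le s hs₀ hs₁)
    ((le_dimH_GG s hs₀ hs₁).trans (dimH_mono subset_closure))

lemma nowhereDense_GG (s : ℝ) (hs₀ : 0 < s) (hs₁ : s < 1) :
    IsNowhereDense (closure (GG s)) := by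
  rw [IsNowhereDense, closure_closure, ← Set.not_nonempty_iff_eq_empty]
  intro h
  have h1 := Real.dimH_of_nonempty_interior h
  rw [dimH_closure_GG s hs₀ hs₁] at h1
  simp at h1
  linarith

lemma perfect_GG (s : ℝ) (hs₀ : 0 < s) (hs₁ : s < 1) : Perfect (closure (GG s)) := by
  apply Preperfect.perfect_closure
  rw [preperfect_iff_nhds]
  rintro _ ⟨y, hy, rfl⟩ U hU
  obtain ⟨ε, hε, hball⟩ := Metric.mem_nhds_iff.1 hU
  have ht : Tendsto (fun n => 2 / (DD s n : ℝ)) atTop (nhds 0) := (DD_tendsto s).const_div_atTop _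
  obtain ⟨n, hn⟩ := (ht.eventually_lt_const hε).exists
  have hq : (0 : ℝ) < QQ s n := by exact_mod_cast QQ_pos s n
  have h1 := Nat.lt_floor_add_one (y * QQ s n)
  have h2 : y < (⌊y * QQ s n⌋₊ + 1) / QQ s n := by rwa [lt_div_iff₀ hq]
  obtain ⟨y', hy1, hy2⟩ := exists_between (lt_min h2 hy.2)
  have hy3 := hy2.trans_le (min_le_left _ _)
  have hy4 := hy2.trans_le (min_le_right _ _)
  rw [lt_div_iff₀ hq] at hy3
  have hfl : ⌊y * QQ s n⌋₊ = ⌊y' * QQ s n⌋₊ := by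
    symm
    rw [Nat.floor_eq_iff (mul_nonneg (hy.1.trans hy1.le) hq.le)]
    refine ⟨(Nat.floor_le (mul_nonneg hy.1 hq.le)).trans ?_, hy3⟩
    gcongr
  have hc := cs_eq s y y' n hfl
  have hmem' : y' ∈ Set.Ico (0 : ℝ) 1 := ⟨hy.1.trans hy1.le, hy4⟩
  refine ⟨gg s y', ⟨hball ?_, ⟨y', hmem', rfl⟩⟩, ?_⟩
  · rw [Metric.mem_ball, Real.dist_eq]
    have g1 := gg_spec s y n
    have g2 := gg_spec s y' n
    rw [← hc] at g2
    refine lt_of_le_of_lt ?_ hn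
    rw [abs_le]; constructor <;> linarith
  · exact (gg_strictMono s hs₀ hs₁ hy hmem' hy1).ne'

/-! ### the set B -/

def BB (s : ℝ) : Set ℝ := ⋂ n : ℕ, {x : ℝ | ∃ k : ℤ,
  |x - (k + 0) / ((DD s n ^ 2 * LL s n * PP s n : ℕ) : ℝ)| ≤ ((11 : ℕ) : ℝ) / DD s (n + 1)}

lemma N_pos (s : ℝ) (n : ℕ) : 1 ≤ DD s n ^ 2 * LL s n * PP s n :=
  Nat.mul_pos (Nat.mul_pos (pow_pos (by have := four_le_DD s n; omega) 2) (LL_pos s n))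
    (PP_pos s n)

lemma isClosed_BB (s : ℝ) : IsClosed (BB s) :=
  isClosed_iInter fun n => isClosed_lattice _ _ _ (by exact_mod_cast N_pos s n)

lemma dimH_BB_le (s : ℝ) (hs₀ : 0 < s) (hs₁ : s < 1) :
    dimH (BB s) ≤ ENNReal.ofReal ((s + 1) / 2) := by
  have key : ∀ t : ℝ, (s + 1) / 2 < t → dimH (BB s) ≤ ENNReal.ofReal t := by
    intro t ht
    have hU : BB s ⊆ ⋃ R : ℕ, (BB s ∩ {x | |x| ≤ R}) := by
      intro x hx
      rw [Set.mem_iUnion]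
      exact ⟨⌈|x|⌉₊, hx, Nat.le_ceil |x|⟩
    refine (dimH_mono hU).trans ?_
    rw [dimH_iUnion]
    refine iSup_le fun R => ?_
    refine dimH_le_of_lattice _ t (by linarith) R 11 (fun n => DD s n ^ 2 * LL s n * PP s n)
      (fun n => 0) (fun n => DD s (n + 1)) ?_ ?_ ?_ ?_ ?_ ?_ ?_ ?_
    · intro n
      have : (4 : ℝ) ≤ DD s (n + 1) := by exact_mod_cast four_le_DD s (n + 1)
      linarith
    · exact (DD_tendsto s).comp (tendsto_add_atTop_nat 1)
    · exact N_pos s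
    · intro n; exact le_refl _
    · intro n; exact zero_le_one
    · intro x hx; exact hx.2
    · intro x hx n
      exact Set.mem_iInter.1 hx.1 n
    · exact upB_bound s hs₀ hs₁ t ht
  refine ENNReal.le_of_forall_pos_le_add fun ε hε _ => ?_
  have := key ((s + 1) / 2 + ε) (by have : (0 : ℝ) < ε := hε; linarith)
  rwa [ENNReal.ofReal_add (by linarith) ε.coe_nonneg, ENNReal.ofReal_coe_nnreal] at this

/-- one step of the choice of the ratio -/
lemma step (s x r : ℝ) (n : ℕ) : ∃ r' : ℝ, r ≤ r' ∧ r' ≤ r + 1 / DD s n ∧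
    ∃ j k : ℤ, r' = j / (DD s n * LL s n) ∧
      |x * DD s (n + 1) + j - k * LL s n| ≤ 1 := by
  have hL : (1 : ℝ) ≤ LL s n := by exact_mod_cast LL_pos s n
  have hD : (4 : ℝ) ≤ DD s n := by exact_mod_cast four_le_DD s n
  have hLz : (0 : ℤ) < LL s n := by exact_mod_cast LL_pos s n
  set z := x * DD s (n + 1) with hz
  set j₀ : ℤ := ⌈r * (DD s n * LL s n)⌉ with hj₀
  set e : ℤ := (-⌊z⌋ - j₀) % (LL s n : ℤ) with he
  have he0 : 0 ≤ e := Int.emod_nonneg _ hLz.ne'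
  have he1 : e + 1 ≤ LL s n := Int.emod_lt_of_pos _ hLz
  have hdm := Int.mul_ediv_add_emod (-⌊z⌋ - j₀) (LL s n : ℤ)
  rw [← he] at hdm
  set w := (-⌊z⌋ - j₀) / (LL s n : ℤ)
  have c1 := Int.le_ceil (r * (DD s n * LL s n))
  have c2 := Int.ceil_lt_add_one (r * (DD s n * LL s n))
  rw [← hj₀] at c1 c2
  have he0' : (0 : ℝ) ≤ e := by exact_mod_cast he0
  have he1' : (e : ℝ) + 1 ≤ LL s n := by exact_mod_cast he1
  refine ⟨((j₀ + e : ℤ) : ℝ) / (DD s n * LL s n), ?_, ?_, j₀ + e, -w, rfl, ?_⟩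
  · rw [le_div_iff₀ (by positivity)]; push_cast; linarith
  · rw [div_le_iff₀ (by positivity)]
    have : (r + 1 / (DD s n : ℝ)) * (DD s n * LL s n) = r * (DD s n * LL s n) + LL s n := by
      field_simp
    rw [this]; push_cast; linarith
  · have hdm' : (LL s n : ℝ) * w + e = -⌊z⌋ - j₀ := by exact_mod_cast hdm
    have f1 := Int.floor_le z
    have f2 := Int.lt_floor_add_one z
    push_cast
    rw [abs_le]
    constructor <;> linarith

noncomputable def rs (s x : ℝ) : ℕ → ℝ
  | 0 => 1
  | n + 1 => (step s x (rs s x n) n).choose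

lemma copy (s x : ℝ) : ∃ r > (0 : ℝ), ∀ c ∈ closure (GG s), x + r * c ∈ BB s := by
  have hstep := fun n => (step s x (rs s x n) n).choose_spec
  obtain ⟨r, hr⟩ := exists_limit s (rs s x) (fun n => (hstep n).1) (fun n => (hstep n).2.1)
  have hr1 : 1 ≤ r := (hr 0).1
  have hr3 : r ≤ 3 := by
    have h4 : (4 : ℝ) ≤ DD s 0 := by exact_mod_cast four_le_DD s 0
    have h5 : 2 / (DD s 0 : ℝ) ≤ 1 := by rw [div_le_one (by linarith)]; linarith
    have := (hr 0).2
    simp only [rs] at this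
    linarith
  refine ⟨r, by linarith, fun c hc => ?_⟩
  refine Set.mem_iInter.2 fun n => ?_
  obtain ⟨k', hk'⟩ := closure_GG_lattice s n c hc
  have hc01 := closure_GG_Icc s hc
  obtain ⟨_, _, j, k, hj, hk⟩ := hstep n
  change rs s x (n + 1) = _ at hj
  obtain ⟨ha, hb⟩ := hr (n + 1)
  have hmono : (1 : ℝ) ≤ rs s x (n + 1) :=
    monotone_nat_of_le_succ (f := rs s x) (fun n => (hstep n).1) (Nat.zero_le (n + 1))
  set ρ := rs s x (n + 1)
  have hL : (1 : ℝ) ≤ LL s n := by exact_mod_cast LL_pos s n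
  have hP : (1 : ℝ) ≤ PP s n := by exact_mod_cast PP_pos s n
  have hD : (4 : ℝ) ≤ DD s n := by exact_mod_cast four_le_DD s n
  have hD' : (4 : ℝ) ≤ DD s (n + 1) := by exact_mod_cast four_le_DD s (n + 1)
  have hDs : (DD s (n + 1) : ℝ) = DD s n ^ 2 * LL s n ^ 2 * PP s n := by
    rw [DD_succ]; push_cast; ring
  set η : ℝ := 1 / DD s (n + 1) with hη
  have hη0 : 0 < η := by positivity
  have h2η : 2 / (DD s (n + 1) : ℝ) = 2 * η := by rw [hη]; ring
  refine ⟨k + j * k', ?_⟩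
  push_cast at hk' ⊢
  rw [h2η] at hk' hb
  set δ := c - ((k' : ℝ) + 1 / LL s n) / (DD s n * PP s n) with hδ
  have hdecomp : x + r * c - ((k : ℝ) + j * k' + 0) / (DD s n ^ 2 * LL s n * PP s n) =
      (x * DD s (n + 1) + j - k * LL s n) * η + ρ * δ + (r - ρ) * c := by
    have : c = δ + ((k' : ℝ) + 1 / LL s n) / (DD s n * PP s n) := by rw [hδ]; ring
    have e2 : ρ * c = ρ * δ + ρ * (((k' : ℝ) + 1 / LL s n) / (DD s n * PP s n)) := by
      rw [this]; ring
    have e3 : x - ((k : ℝ) + j * k' + 0) / (DD s n ^ 2 * LL s n * PP s n) +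
        ρ * (((k' : ℝ) + 1 / LL s n) / (DD s n * PP s n)) =
        (x * DD s (n + 1) + j - k * LL s n) * η := by
      rw [hη, hj, hDs]
      field_simp
      ring
    linear_combination e2 + e3
  rw [hdecomp]
  have t1 : |(x * DD s (n + 1) + j - k * LL s n) * η| ≤ 1 * η := by
    rw [abs_mul, abs_of_pos hη0]; gcongr
  have t2 : |ρ * δ| ≤ 3 * (2 * η) := by
    rw [abs_mul, abs_of_pos (by linarith)]
    gcongr
    linarith
  have t3 : |(r - ρ) * c| ≤ (2 * η) * 1 := by
    rw [abs_mul, abs_of_nonneg (by linarith), abs_of_nonneg hc01.1]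
    exact mul_le_mul (by linarith) hc01.2 hc01.1 (by positivity)
  have h11 : 11 / (DD s (n + 1) : ℝ) = 11 * η := by rw [hη]; ring
  rw [h11]
  have := abs_add_three ((x * DD s (n + 1) + j - k * LL s n) * η) (ρ * δ) ((r - ρ) * c)
  linarith

/-- **Máthé's theorem.** For every `s ∈ (0, 1)` there exist a Cantor set `C ⊆ ℝ` of
Hausdorff dimension `s` and a Borel set `B ⊆ ℝ` of Hausdorff dimension `(s + 1) / 2`
containing a scaled copy of `C` around every point of `ℝ`. -/
theorem mathe_construction (s : ℝ) (hs₀ : 0 < s) (hs₁ : s < 1) :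
    ∃ C B : Set ℝ, C.Nonempty ∧ IsCompact C ∧ IsNowhereDense C ∧ Perfect C ∧
      dimH C = ENNReal.ofReal s ∧
      MeasurableSet B ∧ dimH B = ENNReal.ofReal ((s + 1) / 2) ∧
      ∀ x : ℝ, ∃ r > (0 : ℝ), x +ᵥ (r • C : Set ℝ) ⊆ B := by
  refine ⟨closure (GG s), BB s ∪ closure (GG ((s + 1) / 2)), ?_, ?_, nowhereDense_GG s hs₀ hs₁,
    perfect_GG s hs₀ hs₁, dimH_closure_GG s hs₀ hs₁, ?_, ?_, ?_⟩
  · exact ⟨gg s 0, subset_closure ⟨0, by norm_num, rfl⟩⟩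
  · exact isCompact_Icc.of_isClosed_subset isClosed_closure (closure_GG_Icc s)
  · exact (isClosed_BB s).measurableSet.union isClosed_closure.measurableSet
  · rw [dimH_union, dimH_closure_GG _ (by linarith) (by linarith)]
    exact max_eq_right (dimH_BB_le s hs₀ hs₁)
  · intro x
    obtain ⟨r, hr, h⟩ := copy s x
    refine ⟨r, hr, ?_⟩
    rintro _ ⟨_, ⟨c, hc, rfl⟩, rfl⟩
    exact Or.inl (h c hc)
end
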